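/- arXiv:1011.1690 — 2 statements merged into one kernel-verified Lean document; each statement's English description precedes it below -/
import Mathlib

section
/- Unique continuation up to reparametrization: Let j₁, j₂ be smooth complex structures on the open unit ball B ⊂ ℂ, i.e. smooth maps from B to the real-linear endomorphisms of ℂ with j_a(z) ∘ j_a(z) = −id for all z, and let J be an almost complex structure on ℂⁿ. Suppose u, v : B → ℂⁿ are smooth nonconstant maps that are pseudoholomorphic in the sense that Du(z) ∘ j₁(z) = J(u(z)) ∘ Du(z) and Dv(z) ∘ j₂(z) = J(v(z)) ∘ Dv(z) for all z ∈ B (D denoting the real Fréchet derivative), such that u(0) = v(0) = 0 and the iterated Fréchet derivatives of u and v at 0 agree to all orders. Then for all sufficiently small ε > 0 there exists a smooth embedding φ : B_ε → B — a smooth injective map whose derivative is injective at every point — with φ(0) = 0 such that u = v ∘ φ on B_ε. -/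
open Metric Complex

section AuxiliaryResults

open scoped Topology ContDiff RealInnerProductSpace
open Set Filter Asymptotics MeasureTheory

/-- Differentiation under the integral sign on a strip. -/
theorem hasDerivAt_intervalIntegral_of_continuousOn_strip {F F' : ℝ → ℝ → ℝ} {s₀ a b : ℝ}
    (hF : ContinuousOn (fun p : ℝ × ℝ => F p.1 p.2) (Iio s₀ ×ˢ univ))
    (hF' : ContinuousOn (fun p : ℝ × ℝ => F' p.1 p.2) (Iio s₀ ×ˢ univ))
    (hd : ∀ s < s₀, ∀ t, HasDerivAt (fun x => F x t) (F' s t) s) {s : ℝ} (hs : s < s₀) :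
    HasDerivAt (fun x => ∫ t in a..b, F x t) (∫ t in a..b, F' s t) s := by
  obtain ⟨δ, hδ, hδs⟩ : ∃ δ > 0, s + δ < s₀ := ⟨(s₀ - s) / 2, by linarith, by linarith⟩
  have hsub : Icc (s - δ) (s + δ) ×ˢ uIcc a b ⊆ Iio s₀ ×ˢ univ :=
    prod_mono (fun x hx => lt_of_le_of_lt hx.2 hδs) (subset_univ _)
  obtain ⟨C, hC⟩ := (isCompact_Icc.prod isCompact_uIcc).exists_bound_of_continuousOn
    (hF'.mono hsub)
  have hslice : ∀ {G : ℝ → ℝ → ℝ}, ContinuousOn (fun p : ℝ × ℝ => G p.1 p.2) (Iio s₀ ×ˢ univ) →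
      ∀ x < s₀, Continuous (G x) := fun {G} hG x hx =>
    continuousOn_univ.1 (hG.comp (f := fun t => (x, t)) (by fun_prop) fun t _ => ⟨hx, mem_univ _⟩)
  refine (intervalIntegral.hasDerivAt_integral_of_dominated_loc_of_deriv_le
    (F := F) (F' := F') (bound := fun _ => C)
    (Ioo_mem_nhds (show s - δ < s by linarith) (show s < s + δ by linarith)) ?_ ?_ ?_ ?_ ?_ ?_).2
  · filter_upwards [Iio_mem_nhds hs] with x hx
    exact (hslice hF x hx).aestronglyMeasurable
  · exact (hslice hF s hs).intervalIntegrable _ _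
  · exact (hslice hF' s hs).aestronglyMeasurable
  · refine Eventually.of_forall fun t ht x hx => hC (x, t) ⟨Ioo_subset_Icc_self hx, ?_⟩
    exact uIoc_subset_uIcc ht
  · exact intervalIntegrable_const
  · exact Eventually.of_forall fun t _ x hx => hd x (hx.2.trans hδs) t

/-- A lower bound coming from an almost convex logarithm: a nonnegative function `H` with
`H' ≈ 2 D` and `(D / H)'` almost nonnegative cannot vanish to infinite order at `-∞` without
vanishing identically. -/
theorem eq_zero_of_almost_logConvex {H D H' D' : ℝ → ℝ} {s₀ K : ℝ} (hK : 0 ≤ K)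
    (hH : ∀ s < s₀, HasDerivAt H (H' s) s) (hD : ∀ s < s₀, HasDerivAt D (D' s) s)
    (hpos : ∀ s < s₀, 0 ≤ H s)
    (hH' : ∀ s < s₀, |H' s - 2 * D s| ≤ K * Real.exp s * H s)
    (hD' : ∀ s < s₀, 2 * D s ^ 2 - K * Real.exp s * (H s + |D s|) * H s ≤ H s * D' s)
    (hdecay : ∀ N : ℕ, ∃ C, ∀ s < s₀, H s ≤ C * Real.exp (N * s)) :
    ∀ s < s₀, H s = 0 := by
  intro s₁ hs₁
  by_contra hne
  have hs₁pos : 0 < H s₁ := lt_of_le_of_ne (hpos s₁ hs₁) (Ne.symm hne)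
  set B := Real.sinh (Real.arsinh (D s₁ / H s₁) + 4 * K * Real.exp s₁) with hB
  set M := 2 * B + K * Real.exp s₁ with hM
  -- lower bound as long as `H` stays positive
  have key : ∀ a ≤ s₁, (∀ s ∈ Icc a s₁, 0 < H s) →
      H s₁ * Real.exp (-(M * (s₁ - a))) ≤ H a := by
    intro a ha hp
    have hlt : ∀ s ∈ Icc a s₁, s < s₀ := fun s hs => lt_of_le_of_lt hs.2 hs₁
    have hNd : ∀ s ∈ Icc a s₁, HasDerivAt (fun s => D s / H s)
        ((D' s * H s - D s * H' s) / H s ^ 2) s := fun s hs =>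
      (hD s (hlt s hs)).div (hH s (hlt s hs)) (hp s hs).ne'
    have hN' : ∀ s ∈ Icc a s₁, -(2 * K * Real.exp s * (1 + |D s / H s|)) ≤
        (D' s * H s - D s * H' s) / H s ^ 2 := by
      intro s hs
      have hHs := hp s hs
      rw [le_div_iff₀ (by positivity), abs_div, abs_of_pos hHs]
      have e1 : -(2 * K * Real.exp s * (1 + |D s| / H s)) * H s ^ 2 =
        -(2 * K * Real.exp s * (H s + |D s|) * H s) := by field_simp
      rw [e1]
      have h1 := hD' s (hlt s hs)
      have h2 : D s * (H' s - 2 * D s) ≤ |D s| * (K * Real.exp s * H s) := by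
        refine (le_abs_self _).trans ?_
        rw [abs_mul]
        exact mul_le_mul_of_nonneg_left (hH' s (hlt s hs)) (abs_nonneg _)
      have h3 : 0 ≤ K * Real.exp s * H s * H s := by positivity
      nlinarith
    have hfd : ∀ s ∈ Icc a s₁, HasDerivAt (fun s => Real.arsinh (D s / H s) + 4 * K * Real.exp s)
        ((√(1 + (D s / H s) ^ 2))⁻¹ * ((D' s * H s - D s * H' s) / H s ^ 2)
          + 4 * K * Real.exp s) s := by
      intro s hs
      have h1 := (hNd s hs).arsinh
      have h2 := (Real.hasDerivAt_exp s).const_mul (4 * K)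
      simpa using h1.fun_add h2
    have hmono : MonotoneOn (fun s => Real.arsinh (D s / H s) + 4 * K * Real.exp s)
        (Icc a s₁) := by
      refine monotoneOn_of_deriv_nonneg (convex_Icc _ _)
        (fun s hs => (hfd s hs).continuousAt.continuousWithinAt)
        (fun s hs => (hfd s (interior_subset hs)).differentiableAt.differentiableWithinAt) ?_
      intro s hs
      have hs' := interior_subset hs
      rw [(hfd s hs').deriv]
      set x := D s / H s
      have hsq : 0 < √(1 + x ^ 2) := Real.sqrt_pos.2 (by positivity)
      have hx : 1 + |x| ≤ 2 * √(1 + x ^ 2) := by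
        have h1 : 1 ≤ √(1 + x ^ 2) := Real.one_le_sqrt.2 (by nlinarith [sq_nonneg x])
        have h2 : |x| ≤ √(1 + x ^ 2) := Real.abs_le_sqrt (by linarith)
        linarith
      have h3 : (√(1 + x ^ 2))⁻¹ * -(4 * K * Real.exp s * √(1 + x ^ 2)) ≤
          (√(1 + x ^ 2))⁻¹ * ((D' s * H s - D s * H' s) / H s ^ 2) := by
        refine mul_le_mul_of_nonneg_left (le_trans ?_ (hN' s hs')) (by positivity)
        have : 0 ≤ K * Real.exp s := by positivity
        nlinarith
      have h4 : (√(1 + x ^ 2))⁻¹ * -(4 * K * Real.exp s * √(1 + x ^ 2)) =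
          -(4 * K * Real.exp s) := by
        field_simp
      linarith
    have hNle : ∀ s ∈ Icc a s₁, D s / H s ≤ B := by
      intro s hs
      have h1 := hmono hs (right_mem_Icc.2 ha) hs.2
      simp only at h1
      have h2 : Real.arsinh (D s / H s) ≤ Real.arsinh (D s₁ / H s₁) + 4 * K * Real.exp s₁ := by
        have : 0 ≤ 4 * K * Real.exp s := by positivity
        linarith
      have h3 := Real.sinh_le_sinh.2 h2
      rwa [Real.sinh_arsinh] at h3
    have hLd : ∀ s ∈ Icc a s₁, HasDerivAt (fun s => Real.log (H s) - M * s) (H' s / H s - M) s := by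
      intro s hs
      have h2 := (hasDerivAt_id s).const_mul M
      simpa using ((hH s (hlt s hs)).log (hp s hs).ne').fun_sub h2
    have hanti : AntitoneOn (fun s => Real.log (H s) - M * s) (Icc a s₁) := by
      refine antitoneOn_of_deriv_nonpos (convex_Icc _ _)
        (fun s hs => (hLd s hs).continuousAt.continuousWithinAt)
        (fun s hs => (hLd s (interior_subset hs)).differentiableAt.differentiableWithinAt) ?_
      intro s hs
      have hs' := interior_subset hs
      rw [(hLd s hs').deriv, sub_nonpos, div_le_iff₀ (hp s hs')]
      have h1 := (abs_le.1 (hH' s (hlt s hs'))).2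
      have h2 := hNle s hs'
      rw [div_le_iff₀ (hp s hs')] at h2
      have h3 : Real.exp s ≤ Real.exp s₁ := Real.exp_le_exp.2 hs'.2
      have h4 : K * Real.exp s * H s ≤ K * Real.exp s₁ * H s :=
        mul_le_mul_of_nonneg_right (mul_le_mul_of_nonneg_left h3 hK) (hp s hs').le
      rw [hM]
      nlinarith
    have h1 := hanti (left_mem_Icc.2 ha) (right_mem_Icc.2 ha) ha
    simp only at h1
    have hpa := hp a (left_mem_Icc.2 ha)
    rw [← Real.log_le_log_iff (by positivity) hpa, Real.log_mul hs₁pos.ne' (Real.exp_ne_zero _),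
      Real.log_exp]
    linarith
  -- `H` never vanishes on the left of `s₁`
  have hpos' : ∀ a ≤ s₁, 0 < H a := by
    by_contra hcon
    push Not at hcon
    obtain ⟨a, ha, haz⟩ := hcon
    have hcont : ContinuousOn H (Icc a s₁) := fun s hs =>
      (hH s (lt_of_le_of_lt hs.2 hs₁)).continuousAt.continuousWithinAt
    set Z := Icc a s₁ ∩ H ⁻¹' {0} with hZ
    have hZc : IsClosed Z := hcont.preimage_isClosed_of_isClosed isClosed_Icc isClosed_singleton
    have haZ : a ∈ Z := ⟨left_mem_Icc.2 ha, le_antisymm haz (hpos a (lt_of_le_of_lt ha hs₁))⟩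
    have hbdd : BddAbove Z := ⟨s₁, fun x hx => hx.1.2⟩
    set c := sSup Z
    have hcZ : c ∈ Z := hZc.csSup_mem ⟨a, haZ⟩ hbdd
    have hc0 : H c = 0 := hcZ.2
    have hcs : c < s₁ := lt_of_le_of_ne hcZ.1.2 (by rintro h; rw [h] at hc0; exact hne hc0)
    have hlow : ∀ x ∈ Ioo c s₁, H s₁ * Real.exp (-(M * (s₁ - x))) ≤ H x := by
      intro x hx
      refine key x hx.2.le fun s hs => ?_
      have hcs' : c < s := lt_of_lt_of_le hx.1 hs.1
      refine lt_of_le_of_ne (hpos s (lt_of_le_of_lt hs.2 hs₁)) fun h0 => ?_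
      exact absurd (le_csSup hbdd (show s ∈ Z from ⟨⟨hcZ.1.1.trans hcs'.le, hs.2⟩, h0.symm⟩))
        (not_le.2 hcs')
    have hlim1 : Tendsto H (𝓝[>] c) (𝓝 (H c)) :=
      ((hH c (hcs.trans hs₁)).continuousAt.tendsto).mono_left nhdsWithin_le_nhds
    have hlim2 : Tendsto (fun x => H s₁ * Real.exp (-(M * (s₁ - x)))) (𝓝[>] c)
        (𝓝 (H s₁ * Real.exp (-(M * (s₁ - c))))) :=
      (Continuous.tendsto (by fun_prop) c).mono_left nhdsWithin_le_nhds
    have hle := le_of_tendsto_of_tendsto hlim2 hlim1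
      (by filter_upwards [Ioo_mem_nhdsGT hcs] with x hx using hlow x hx)
    rw [hc0] at hle
    have : 0 < H s₁ * Real.exp (-(M * (s₁ - c))) := by positivity
    linarith
  have hall : ∀ a ≤ s₁, H s₁ * Real.exp (-(M * (s₁ - a))) ≤ H a := fun a ha =>
    key a ha fun s hs => hpos' s hs.2
  -- compare with rapid decay
  obtain ⟨N, hN⟩ := exists_nat_gt (M + 1)
  obtain ⟨C, hC⟩ := hdecay N
  have hcmp : ∀ a ≤ min s₁ 0, H s₁ * Real.exp (-(M * s₁)) ≤ C * Real.exp a := by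
    intro a ha
    have ha1 : a ≤ s₁ := ha.trans (min_le_left _ _)
    have ha0 : a ≤ 0 := ha.trans (min_le_right _ _)
    have h1 := (hall a ha1).trans (hC a (lt_of_le_of_lt ha1 hs₁))
    have hCpos : 0 ≤ C := by
      by_contra hneg
      have : C * Real.exp (N * a) < 0 := mul_neg_of_neg_of_pos (not_le.1 hneg) (Real.exp_pos _)
      have : 0 < H s₁ * Real.exp (-(M * (s₁ - a))) := by positivity
      linarith
    have h2 : Real.exp (-(M * (s₁ - a))) = Real.exp (-(M * s₁)) * Real.exp (M * a) := by
      rw [← Real.exp_add]; ring_nf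
    have h3 : Real.exp (N * a) ≤ Real.exp a * Real.exp (M * a) := by
      rw [← Real.exp_add]
      exact Real.exp_le_exp.2 (by nlinarith)
    rw [h2] at h1
    have h4 : H s₁ * Real.exp (-(M * s₁)) * Real.exp (M * a) ≤
        C * Real.exp a * Real.exp (M * a) := by
      have := mul_le_mul_of_nonneg_left h3 hCpos
      linarith
    exact le_of_mul_le_mul_right h4 (Real.exp_pos _)
  have hlim : Tendsto (fun a => C * Real.exp a) atBot (𝓝 (C * 0)) :=
    Real.tendsto_exp_atBot.const_mul C
  have := ge_of_tendsto hlim (by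
    filter_upwards [Iic_mem_atBot (min s₁ 0)] with a ha using hcmp a ha)
  have : 0 < H s₁ * Real.exp (-(M * s₁)) := by positivity
  linarith

section Cylinder

variable {F : Type*} [NormedAddCommGroup F] [InnerProductSpace ℝ F]

theorem intervalIntegral_deriv_eq_zero_of_periodic {f f' : ℝ → ℝ} {T : ℝ}
    (hd : ∀ t, HasDerivAt f (f' t) t) (hc : Continuous f') (hper : f T = f 0) :
    ∫ t in (0 : ℝ)..T, f' t = 0 := by
  rw [intervalIntegral.integral_eq_sub_of_hasDerivAt (fun t _ => hd t) (hc.intervalIntegrable _ _),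
    hper, sub_self]

/-- Completing the square in the pointwise estimate behind the monotonicity of the frequency. -/
theorem two_mul_norm_sq_sub_le (p x : F) (N c : ℝ) (hc : 0 ≤ c) :
    4 * N * ⟪p, x⟫ - 2 * N ^ 2 * ‖x‖ ^ 2 - (c + c ^ 2 + c * |N|) * ‖x‖ ^ 2 ≤
      2 * ‖p‖ ^ 2 - c * (‖p‖ * ‖x‖ + ‖x‖ ^ 2) := by
  set q := ‖p - N • x‖ with hq
  have h1 : q ^ 2 = ‖p‖ ^ 2 - 2 * N * ⟪p, x⟫ + N ^ 2 * ‖x‖ ^ 2 := by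
    rw [hq, norm_sub_sq_real, inner_smul_right, norm_smul, mul_pow, Real.norm_eq_abs, sq_abs]
    ring
  have h2 : ‖p‖ ≤ q + |N| * ‖x‖ := by
    have := norm_add_le (p - N • x) (N • x)
    rwa [sub_add_cancel, norm_smul, Real.norm_eq_abs] at this
  have h3 : c * (‖p‖ * ‖x‖) ≤ c * ((q + |N| * ‖x‖) * ‖x‖) := by gcongr
  nlinarith [sq_nonneg (q - c * ‖x‖ / 2), sq_nonneg q, sq_nonneg (c * ‖x‖)]

set_option maxHeartbeats 1000000 in
/-- Strong unique continuation on a half cylinder for perturbed Cauchy-Riemann equations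
`∂ₛ g = - a I ∂ₜ g + b ∂ₜ g + O(eˢ |g|)` with `(a, b)` exponentially close to `(1, 0)`. -/
theorem eq_zero_of_cylinder_cauchyRiemann {I : F →L[ℝ] F} (hIskew : ∀ x y, ⟪I x, y⟫ = -⟪x, I y⟫)
    (hIsq : ∀ x, I (I x) = -x)
    {g gs gt gst : ℝ → ℝ → F} {a as at' b bt : ℝ → ℝ → ℝ} {s₀ K : ℝ} (hs₀ : s₀ ≤ 0) (hK : 0 ≤ K)
    (hg : ContinuousOn (fun p : ℝ × ℝ => g p.1 p.2) (Iio s₀ ×ˢ univ))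
    (hgs : ContinuousOn (fun p : ℝ × ℝ => gs p.1 p.2) (Iio s₀ ×ˢ univ))
    (hgt : ContinuousOn (fun p : ℝ × ℝ => gt p.1 p.2) (Iio s₀ ×ˢ univ))
    (hgst : ContinuousOn (fun p : ℝ × ℝ => gst p.1 p.2) (Iio s₀ ×ˢ univ))
    (ha : ContinuousOn (fun p : ℝ × ℝ => a p.1 p.2) (Iio s₀ ×ˢ univ))
    (has : ContinuousOn (fun p : ℝ × ℝ => as p.1 p.2) (Iio s₀ ×ˢ univ))
    (hat : ContinuousOn (fun p : ℝ × ℝ => at' p.1 p.2) (Iio s₀ ×ˢ univ))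
    (hb : ContinuousOn (fun p : ℝ × ℝ => b p.1 p.2) (Iio s₀ ×ˢ univ))
    (hbt : ContinuousOn (fun p : ℝ × ℝ => bt p.1 p.2) (Iio s₀ ×ˢ univ))
    (dgs : ∀ s < s₀, ∀ t, HasDerivAt (fun x => g x t) (gs s t) s)
    (dgt : ∀ s < s₀, ∀ t, HasDerivAt (g s) (gt s t) t)
    (dgts : ∀ s < s₀, ∀ t, HasDerivAt (fun x => gt x t) (gst s t) s)
    (dgst : ∀ s < s₀, ∀ t, HasDerivAt (gs s) (gst s t) t)
    (das : ∀ s < s₀, ∀ t, HasDerivAt (fun x => a x t) (as s t) s)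
    (dat : ∀ s < s₀, ∀ t, HasDerivAt (a s) (at' s t) t)
    (dbt : ∀ s < s₀, ∀ t, HasDerivAt (b s) (bt s t) t)
    (pg : ∀ s < s₀, g s (2 * Real.pi) = g s 0) (pgs : ∀ s < s₀, gs s (2 * Real.pi) = gs s 0)
    (pa : ∀ s < s₀, a s (2 * Real.pi) = a s 0) (pb : ∀ s < s₀, b s (2 * Real.pi) = b s 0)
    (a_ge : ∀ s < s₀, ∀ t, 1 / 2 ≤ a s t)
    (b_le : ∀ s < s₀, ∀ t, |b s t| ≤ K) (as_le : ∀ s < s₀, ∀ t, |as s t| ≤ K * Real.exp s)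
    (at_le : ∀ s < s₀, ∀ t, |at' s t| ≤ K * Real.exp s)
    (bt_le : ∀ s < s₀, ∀ t, |bt s t| ≤ K * Real.exp s)
    (hCR : ∀ s < s₀, ∀ t,
      ‖gs s t + a s t • I (gt s t) - b s t • gt s t‖ ≤ K * Real.exp s * ‖g s t‖)
    (hdecay : ∀ N : ℕ, ∃ C, ∀ s < s₀, ∀ t, ‖g s t‖ ≤ C * Real.exp (N * s)) :
    ∀ s < s₀, ∀ t ∈ Icc 0 (2 * Real.pi), g s t = 0 := by
  have hIn : ∀ x, ‖I x‖ = ‖x‖ := fun x => by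
    have h1 : ⟪I x, I x⟫ = ⟪x, x⟫ := by rw [hIskew, hIsq, inner_neg_right, neg_neg]
    rw [real_inner_self_eq_norm_sq, real_inner_self_eq_norm_sq] at h1
    exact (sq_eq_sq₀ (norm_nonneg _) (norm_nonneg _)).1 h1
  have hI0 : ∀ x, ⟪I x, x⟫ = 0 := fun x => by
    have h1 := hIskew x x
    have h2 := real_inner_comm x (I x)
    linarith
  have hslice : ∀ {X : Type _} [TopologicalSpace X] {G : ℝ → ℝ → X},
      ContinuousOn (fun p : ℝ × ℝ => G p.1 p.2) (Iio s₀ ×ˢ univ) →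
      ∀ x < s₀, Continuous (G x) := fun {X} _ {G} hG x hx =>
    continuousOn_univ.1 (hG.comp (f := fun t => (x, t)) (by fun_prop) fun t _ => ⟨hx, mem_univ _⟩)
  have hIc : ∀ {G : ℝ → ℝ → F}, ContinuousOn (fun p : ℝ × ℝ => G p.1 p.2) (Iio s₀ ×ˢ univ) →
      ContinuousOn (fun p : ℝ × ℝ => I (G p.1 p.2)) (Iio s₀ ×ˢ univ) := fun hG =>
    I.continuous.comp_continuousOn hG
  have hexp : ∀ s < s₀, Real.exp s ≤ 1 := fun s hs => Real.exp_le_one_iff.2 (hs.le.trans hs₀)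
  set T := 2 * Real.pi with hT
  have hTpos : 0 ≤ T := by positivity
  -- the energy on circles and its derivative
  set hfun : ℝ → ℝ → ℝ := fun s t => ‖g s t‖ ^ 2 with hfun_def
  set dfun : ℝ → ℝ → ℝ := fun s t => -(a s t * ⟪I (gt s t), g s t⟫) with dfun_def
  set hfun' : ℝ → ℝ → ℝ := fun s t => 2 * ⟪g s t, gs s t⟫ with hfun'_def
  set dfun' : ℝ → ℝ → ℝ := fun s t => -(as s t * ⟪I (gt s t), g s t⟫ +
    a s t * (⟪I (gt s t), gs s t⟫ + ⟪I (gst s t), g s t⟫)) with dfun'_def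
  have chfun : ContinuousOn (fun p : ℝ × ℝ => hfun p.1 p.2) (Iio s₀ ×ˢ univ) := hg.norm.pow 2
  have chfun' : ContinuousOn (fun p : ℝ × ℝ => hfun' p.1 p.2) (Iio s₀ ×ˢ univ) :=
    continuousOn_const.mul (hg.inner hgs)
  have cdfun : ContinuousOn (fun p : ℝ × ℝ => dfun p.1 p.2) (Iio s₀ ×ˢ univ) :=
    (ha.mul ((hIc hgt).inner hg)).neg
  have cdfun' : ContinuousOn (fun p : ℝ × ℝ => dfun' p.1 p.2) (Iio s₀ ×ˢ univ) :=
    ((has.mul ((hIc hgt).inner hg)).add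
      (ha.mul (((hIc hgt).inner hgs).add ((hIc hgst).inner hg)))).neg
  have dhfun : ∀ s < s₀, ∀ t, HasDerivAt (fun x => hfun x t) (hfun' s t) s := fun s hs t =>
    (dgs s hs t).norm_sq
  have ddfun : ∀ s < s₀, ∀ t, HasDerivAt (fun x => dfun x t) (dfun' s t) s := fun s hs t =>
    ((das s hs t).mul (((I.hasFDerivAt.comp_hasDerivAt s (dgts s hs t))).inner ℝ
      (dgs s hs t))).fun_neg
  have hHd := fun s (hs : s < s₀) =>
    hasDerivAt_intervalIntegral_of_continuousOn_strip (a := 0) (b := T) chfun chfun' dhfun hs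
  have hDd := fun s (hs : s < s₀) =>
    hasDerivAt_intervalIntegral_of_continuousOn_strip (a := 0) (b := T) cdfun cdfun' ddfun hs
  -- integrations by parts over the circle
  have ibp1 : ∀ s < s₀, ∫ t in (0 : ℝ)..T, (bt s t * ‖g s t‖ ^ 2 +
      b s t * (2 * ⟪g s t, gt s t⟫)) = 0 := fun s hs =>
    intervalIntegral_deriv_eq_zero_of_periodic (f := fun t => b s t * ‖g s t‖ ^ 2)
      (fun t => (dbt s hs t).mul (dgt s hs t).norm_sq)
      (hslice (G := fun s t => bt s t * ‖g s t‖ ^ 2 + b s t * (2 * ⟪g s t, gt s t⟫))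
        ((hbt.mul (hg.norm.pow 2)).add (hb.mul (continuousOn_const.mul (hg.inner hgt))))
        s hs) (by simp only [pg s hs, pb s hs])
  have ibp2 : ∀ s < s₀, ∫ t in (0 : ℝ)..T, (at' s t * ⟪I (gs s t), g s t⟫ +
      a s t * (⟪I (gs s t), gt s t⟫ + ⟪I (gst s t), g s t⟫)) = 0 := fun s hs =>
    intervalIntegral_deriv_eq_zero_of_periodic (f := fun t => a s t * ⟪I (gs s t), g s t⟫)
      (fun t => (dat s hs t).mul (((I.hasFDerivAt.comp_hasDerivAt t (dgst s hs t))).inner ℝ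
        (dgt s hs t)))
      (hslice (G := fun s t => at' s t * ⟪I (gs s t), g s t⟫ +
        a s t * (⟪I (gs s t), gt s t⟫ + ⟪I (gst s t), g s t⟫))
        ((hat.mul ((hIc hgs).inner hg)).add
        (ha.mul (((hIc hgs).inner hgt).add ((hIc hgst).inner hg)))) s hs)
      (by simp only [pg s hs, pgs s hs, pa s hs])
  have II : ∀ {G : ℝ → ℝ → ℝ}, ContinuousOn (fun p : ℝ × ℝ => G p.1 p.2) (Iio s₀ ×ˢ univ) →
      ∀ s < s₀, IntervalIntegrable (G s) volume 0 T := fun hG s hs =>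
    (hslice hG s hs).intervalIntegrable _ _
  set c₁ := K * (5 + 3 * K) with hc₁
  have hc₁pos : 0 ≤ c₁ := by positivity
  have hHnonneg : ∀ s, 0 ≤ ∫ t in (0 : ℝ)..T, hfun s t := fun s =>
    intervalIntegral.integral_nonneg hTpos fun t _ => by positivity
  have hcon := eq_zero_of_almost_logConvex (H := fun s => ∫ t in (0 : ℝ)..T, hfun s t)
    (D := fun s => ∫ t in (0 : ℝ)..T, dfun s t) (K := c₁ + c₁ ^ 2 + 3 * K) (s₀ := s₀)
    (by positivity) hHd hDd (fun s _ => hHnonneg s) ?_ ?_ ?_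
  · intro s hs t ht
    have h0 := hcon s hs
    by_contra hne
    have hc : Continuous (hfun s) := hslice chfun s hs
    have : 0 < ∫ t in (0 : ℝ)..T, hfun s t :=
      intervalIntegral.integral_pos (by positivity) hc.continuousOn (fun x _ => by positivity)
        ⟨t, ht, by simp only [hfun_def]; have := norm_pos_iff.2 hne; positivity⟩
    exact this.ne' h0
  · intro s hs
    have e1 : (∫ t in (0 : ℝ)..T, hfun' s t) - 2 * ∫ t in (0 : ℝ)..T, dfun s t =
        ∫ t in (0 : ℝ)..T, (hfun' s t - 2 * dfun s t - (bt s t * ‖g s t‖ ^ 2 +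
          b s t * (2 * ⟪g s t, gt s t⟫))) := by
      have i1 := II chfun' s hs
      have i2 := (II cdfun s hs).const_mul 2
      have i3 := II (G := fun s t => bt s t * ‖g s t‖ ^ 2 + b s t * (2 * ⟪g s t, gt s t⟫))
        ((hbt.mul (hg.norm.pow 2)).add (hb.mul (continuousOn_const.mul (hg.inner hgt)))) s hs
      rw [intervalIntegral.integral_sub (i1.sub i2) i3, ibp1 s hs,
        intervalIntegral.integral_sub i1 i2, intervalIntegral.integral_const_mul 2 (dfun s),
        sub_zero]
    rw [e1, ← intervalIntegral.integral_const_mul (_ * _) (hfun s), ← Real.norm_eq_abs]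
    refine intervalIntegral.norm_integral_le_of_norm_le hTpos
      (Eventually.of_forall fun t _ => ?_) ((II chfun s hs).const_mul _)
    set e := gs s t + a s t • I (gt s t) - b s t • gt s t with he
    have e2 : hfun' s t - 2 * dfun s t - (bt s t * ‖g s t‖ ^ 2 +
          b s t * (2 * ⟪g s t, gt s t⟫)) = 2 * ⟪g s t, e⟫ - bt s t * ‖g s t‖ ^ 2 := by
      simp only [hfun'_def, dfun_def, he, inner_add_right, inner_sub_right, inner_smul_right,
        real_inner_comm (g s t) (I (gt s t))]
      ring
    rw [e2, Real.norm_eq_abs]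
    have h1 : |⟪g s t, e⟫| ≤ ‖g s t‖ * (K * Real.exp s * ‖g s t‖) :=
      (abs_real_inner_le_norm _ _).trans (mul_le_mul_of_nonneg_left (hCR s hs t) (norm_nonneg _))
    have h2 : |bt s t * ‖g s t‖ ^ 2| ≤ K * Real.exp s * ‖g s t‖ ^ 2 := by
      rw [abs_mul, abs_of_nonneg (sq_nonneg ‖g s t‖)]
      exact mul_le_mul_of_nonneg_right (bt_le s hs t) (sq_nonneg _)
    have h3 : |2 * ⟪g s t, e⟫ - bt s t * ‖g s t‖ ^ 2| ≤
        |2 * ⟪g s t, e⟫| + |bt s t * ‖g s t‖ ^ 2| := abs_sub _ _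
    rw [abs_mul, abs_two] at h3
    have h4 : 0 ≤ (c₁ + c₁ ^ 2) * Real.exp s * ‖g s t‖ ^ 2 := by positivity
    simp only [hfun_def]
    nlinarith
  · intro s hs
    set D := ∫ t in (0 : ℝ)..T, dfun s t with hD
    set H := ∫ t in (0 : ℝ)..T, hfun s t with hH
    rcases (hHnonneg s).eq_or_lt with h0 | hHpos
    · have hg0 : ∀ t ∈ Icc 0 T, g s t = 0 := by
        intro t ht
        by_contra hne
        have hc : Continuous (hfun s) := hslice chfun s hs
        have : 0 < ∫ t in (0 : ℝ)..T, hfun s t :=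
          intervalIntegral.integral_pos (by positivity) hc.continuousOn (fun x _ => by positivity)
            ⟨t, ht, by simp only [hfun_def]; have := norm_pos_iff.2 hne; positivity⟩
        exact this.ne h0
      have hD0 : D = 0 := by
        rw [hD, intervalIntegral.integral_congr (g := fun _ => (0 : ℝ))]
        · simp
        · intro t ht
          rw [uIcc_of_le hTpos] at ht
          simp [dfun_def, hg0 t ht]
      have hH0 : H = 0 := h0.symm
      rw [hD0, hH0]; simp
    · set N := D / H with hN
      have hDN : D = N * H := (div_mul_cancel₀ D (ne_of_gt hHpos)).symm
      have hNabs : |D| = |N| * H := by rw [hDN, abs_mul, abs_of_pos hHpos]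
      set c := c₁ * Real.exp s with hc
      have hcpos : 0 ≤ c := by positivity
      have key : 4 * N * D - (2 * N ^ 2 + (c + c ^ 2 + c * |N|)) * H ≤
          ∫ t in (0 : ℝ)..T, dfun' s t := by
        have i4 := II (G := fun s t => at' s t * ⟪I (gs s t), g s t⟫ +
          a s t * (⟪I (gs s t), gt s t⟫ + ⟪I (gst s t), g s t⟫)) ((hat.mul ((hIc hgs).inner hg)).add
          (ha.mul (((hIc hgs).inner hgt).add ((hIc hgst).inner hg)))) s hs
        have e1 : ∫ t in (0 : ℝ)..T, dfun' s t = ∫ t in (0 : ℝ)..T, (dfun' s t +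
            (at' s t * ⟪I (gs s t), g s t⟫ +
              a s t * (⟪I (gs s t), gt s t⟫ + ⟪I (gst s t), g s t⟫))) := by
          rw [intervalIntegral.integral_add (II cdfun' s hs) i4, ibp2 s hs, add_zero]
        rw [e1, ← intervalIntegral.integral_const_mul, ← intervalIntegral.integral_const_mul,
          ← intervalIntegral.integral_sub ((II cdfun s hs).const_mul _)
            ((II chfun s hs).const_mul _)]
        refine intervalIntegral.integral_mono_on hTpos
          (((II cdfun s hs).const_mul _).sub ((II chfun s hs).const_mul _))
          ((II cdfun' s hs).add i4) fun t _ => ?_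
        set e := gs s t + a s t • I (gt s t) - b s t • gt s t with he
        set p := -(a s t • I (gt s t)) with hp
        have hgs_eq : gs s t = p + b s t • gt s t + e := by rw [he, hp]; abel
        have e2 : dfun' s t + (at' s t * ⟪I (gs s t), g s t⟫ +
              a s t * (⟪I (gs s t), gt s t⟫ + ⟪I (gst s t), g s t⟫)) =
            2 * ⟪p, gs s t⟫ - as s t * ⟪I (gt s t), g s t⟫ + at' s t * ⟪I (gs s t), g s t⟫ := by
          simp only [dfun'_def, hp, inner_neg_left, inner_smul_left, hIskew (gs s t) (gt s t),
            real_inner_comm (I (gt s t)) (gs s t)]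
          simp
          ring
        have e3 : ⟪p, gs s t⟫ = ‖p‖ ^ 2 + ⟪p, e⟫ := by
          rw [hgs_eq, inner_add_right, inner_add_right, real_inner_self_eq_norm_sq,
            inner_smul_right, hp]
          simp [inner_smul_left, hI0]
        have e4 : dfun s t = ⟪p, g s t⟫ := by
          simp [dfun_def, hp, inner_smul_left]
        have apos : 0 < a s t := by linarith [a_ge s hs t]
        have n1 : ‖gt s t‖ ≤ 2 * ‖p‖ := by
          rw [hp, norm_neg, norm_smul, hIn, Real.norm_eq_abs, abs_of_pos apos]
          nlinarith [a_ge s hs t, norm_nonneg (gt s t)]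
        have hle : ‖e‖ ≤ K * Real.exp s * ‖g s t‖ := hCR s hs t
        have n2 : ‖gs s t‖ ≤ (1 + 2 * K) * ‖p‖ + K * ‖g s t‖ := by
          have t1 : ‖b s t • gt s t‖ ≤ K * (2 * ‖p‖) := by
            rw [norm_smul, Real.norm_eq_abs]
            exact mul_le_mul (b_le s hs t) n1 (norm_nonneg _) hK
          have t2 : K * Real.exp s * ‖g s t‖ ≤ K * 1 * ‖g s t‖ := by
            gcongr; exact hexp s hs
          have t3 := norm_add₃_le (a := p) (b := b s t • gt s t) (c := e)
          rw [← hgs_eq] at t3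
          linarith
        have m1 : as s t * ⟪I (gt s t), g s t⟫ ≤ K * Real.exp s * (2 * ‖p‖ * ‖g s t‖) := by
          refine (le_abs_self _).trans ?_
          rw [abs_mul]
          refine mul_le_mul (as_le s hs t) ((abs_real_inner_le_norm _ _).trans ?_) (abs_nonneg _)
            (by positivity)
          rw [hIn]
          gcongr
        have m2 : -(at' s t * ⟪I (gs s t), g s t⟫) ≤
            K * Real.exp s * (((1 + 2 * K) * ‖p‖ + K * ‖g s t‖) * ‖g s t‖) := by
          refine (neg_le_abs _).trans ?_
          rw [abs_mul]
          refine mul_le_mul (at_le s hs t) ((abs_real_inner_le_norm _ _).trans ?_) (abs_nonneg _)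
            (by positivity)
          rw [hIn]
          gcongr
        have m3 : -⟪p, e⟫ ≤ ‖p‖ * (K * Real.exp s * ‖g s t‖) :=
          (neg_le_abs _).trans ((abs_real_inner_le_norm _ _).trans
            (mul_le_mul_of_nonneg_left hle (norm_nonneg _)))
        have sq := two_mul_norm_sq_sub_le p (g s t) N c hcpos
        simp only [e2, e3, e4, hfun_def]
        have q1 : 0 ≤ K * Real.exp s * (‖p‖ * ‖g s t‖) := by positivity
        have q2 : 0 ≤ K * Real.exp s * ‖g s t‖ ^ 2 := by positivity
        have q3 : 0 ≤ K * K * Real.exp s * (‖p‖ * ‖g s t‖) := by positivity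
        have q4 : 0 ≤ K * K * Real.exp s * ‖g s t‖ ^ 2 := by positivity
        have q5 : c * (‖p‖ * ‖g s t‖ + ‖g s t‖ ^ 2) = 5 * (K * Real.exp s * (‖p‖ * ‖g s t‖)) +
            5 * (K * Real.exp s * ‖g s t‖ ^ 2) + 3 * (K * K * Real.exp s * (‖p‖ * ‖g s t‖)) +
            3 * (K * K * Real.exp s * ‖g s t‖ ^ 2) := by rw [hc, hc₁]; ring
        have q6 : K * Real.exp s * (2 * ‖p‖ * ‖g s t‖) =
            2 * (K * Real.exp s * (‖p‖ * ‖g s t‖)) := by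
          ring
        have q7 : K * Real.exp s * (((1 + 2 * K) * ‖p‖ + K * ‖g s t‖) * ‖g s t‖) =
            K * Real.exp s * (‖p‖ * ‖g s t‖) + 2 * (K * K * Real.exp s * (‖p‖ * ‖g s t‖)) +
              K * K * Real.exp s * ‖g s t‖ ^ 2 := by ring
        have q8 : ‖p‖ * (K * Real.exp s * ‖g s t‖) = K * Real.exp s * (‖p‖ * ‖g s t‖) := by ring
        have q9 : 4 * N * ⟪p, g s t⟫ - (2 * N ^ 2 + (c + c ^ 2 + c * |N|)) * ‖g s t‖ ^ 2 =
            4 * N * ⟪p, g s t⟫ - 2 * N ^ 2 * ‖g s t‖ ^ 2 -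
              (c + c ^ 2 + c * |N|) * ‖g s t‖ ^ 2 := by ring
        rw [q6] at m1
        rw [q7] at m2
        rw [q8] at m3
        rw [q9]
        linarith
      have hcc : c + c ^ 2 + c * |N| ≤ (c₁ + c₁ ^ 2) * Real.exp s * (1 + |N|) := by
        have h1 : c ^ 2 ≤ c₁ ^ 2 * Real.exp s := by
          rw [hc, mul_pow, sq (Real.exp s)]
          have := mul_le_mul_of_nonneg_left (hexp s hs) (Real.exp_pos s).le
          nlinarith [sq_nonneg c₁]
        have h2 : 0 ≤ c₁ ^ 2 * Real.exp s * |N| := by positivity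
        have h3 : (c₁ + c₁ ^ 2) * Real.exp s * (1 + |N|) =
            c + c * |N| + c₁ ^ 2 * Real.exp s + c₁ ^ 2 * Real.exp s * |N| := by rw [hc]; ring
        linarith
      rw [hNabs, hDN]
      rw [hDN] at key
      have h5 := mul_le_mul_of_nonneg_left key hHpos.le
      have h6 : (c + c ^ 2 + c * |N|) * H * H ≤
          (c₁ + c₁ ^ 2) * Real.exp s * (1 + |N|) * H * H := by gcongr
      have h7 : 0 ≤ 3 * K * Real.exp s * (1 + |N|) * H * H := by
        have := hHpos.le
        positivity
      linarith
  · intro N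
    obtain ⟨C, hC⟩ := hdecay N
    refine ⟨T * C ^ 2, fun s hs => ?_⟩
    have hC0 : 0 ≤ C := by
      have h1 := (norm_nonneg _).trans (hC s hs 0)
      exact nonneg_of_mul_nonneg_left h1 (Real.exp_pos _)
    have h1 : ∀ t ∈ Icc 0 T, hfun s t ≤ C ^ 2 * Real.exp (N * s) := by
      intro t _
      have h2 : ‖g s t‖ ^ 2 ≤ (C * Real.exp (N * s)) ^ 2 :=
        pow_le_pow_left₀ (norm_nonneg _) (hC s hs t) 2
      have h3 : Real.exp (N * s) ≤ 1 := Real.exp_le_one_iff.2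
        (mul_nonpos_of_nonneg_of_nonpos (Nat.cast_nonneg _) (hs.le.trans hs₀))
      have h4 : (C * Real.exp (N * s)) ^ 2 ≤ C ^ 2 * Real.exp (N * s) := by
        rw [mul_pow, sq (Real.exp _)]
        have := mul_le_mul_of_nonneg_left h3 (Real.exp_pos (N * s)).le
        nlinarith [sq_nonneg C]
      exact h2.trans h4
    have h5 := intervalIntegral.integral_mono_on hTpos (II chfun s hs)
      (intervalIntegrable_const (c := C ^ 2 * Real.exp (N * s))) h1
    rw [intervalIntegral.integral_const, sub_zero, smul_eq_mul] at h5
    linarith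

end Cylinder

section CylinderStructure

variable {F : Type*} [NormedAddCommGroup F] [InnerProductSpace ℝ F]

set_option maxHeartbeats 1000000 in
/-- Strong unique continuation on a half cylinder for the Cauchy-Riemann equation
`c ∂ₛ g = I ∂ₛ g + O(eˢ |g|)` where the complex number `c` acts through the frame `(∂ₛ, ∂ₜ)` and is
exponentially close to `i`. -/
theorem eq_zero_of_cylinder_complexStructure {I : F →L[ℝ] F}
    (hIskew : ∀ x y, ⟪I x, y⟫ = -⟪x, I y⟫) (hIsq : ∀ x, I (I x) = -x)
    {g gs gt gst : ℝ → ℝ → F} {c cs ct : ℝ → ℝ → ℂ} {s₀ K : ℝ} (hs₀ : s₀ ≤ 0) (hK : 1 ≤ K)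
    (hg : ContinuousOn (fun p : ℝ × ℝ => g p.1 p.2) (Iio s₀ ×ˢ univ))
    (hgs : ContinuousOn (fun p : ℝ × ℝ => gs p.1 p.2) (Iio s₀ ×ˢ univ))
    (hgt : ContinuousOn (fun p : ℝ × ℝ => gt p.1 p.2) (Iio s₀ ×ˢ univ))
    (hgst : ContinuousOn (fun p : ℝ × ℝ => gst p.1 p.2) (Iio s₀ ×ˢ univ))
    (hc : ContinuousOn (fun p : ℝ × ℝ => c p.1 p.2) (Iio s₀ ×ˢ univ))
    (hcs : ContinuousOn (fun p : ℝ × ℝ => cs p.1 p.2) (Iio s₀ ×ˢ univ))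
    (hct : ContinuousOn (fun p : ℝ × ℝ => ct p.1 p.2) (Iio s₀ ×ˢ univ))
    (dgs : ∀ s < s₀, ∀ t, HasDerivAt (fun x => g x t) (gs s t) s)
    (dgt : ∀ s < s₀, ∀ t, HasDerivAt (g s) (gt s t) t)
    (dgts : ∀ s < s₀, ∀ t, HasDerivAt (fun x => gt x t) (gst s t) s)
    (dgst : ∀ s < s₀, ∀ t, HasDerivAt (gs s) (gst s t) t)
    (dcs : ∀ s < s₀, ∀ t, HasDerivAt (fun x => c x t) (cs s t) s)
    (dct : ∀ s < s₀, ∀ t, HasDerivAt (c s) (ct s t) t)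
    (pg : ∀ s < s₀, g s (2 * Real.pi) = g s 0) (pgs : ∀ s < s₀, gs s (2 * Real.pi) = gs s 0)
    (pc : ∀ s < s₀, c s (2 * Real.pi) = c s 0)
    (c_le : ∀ s < s₀, ∀ t, ‖c s t - Complex.I‖ ≤ 1 / 4)
    (cs_le : ∀ s < s₀, ∀ t, ‖cs s t‖ ≤ K * Real.exp s)
    (ct_le : ∀ s < s₀, ∀ t, ‖ct s t‖ ≤ K * Real.exp s)
    (hCR : ∀ s < s₀, ∀ t,
      ‖(c s t).re • gs s t + (c s t).im • gt s t - I (gs s t)‖ ≤ K * Real.exp s * ‖g s t‖)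
    (hdecay : ∀ N : ℕ, ∃ C, ∀ s < s₀, ∀ t, ‖g s t‖ ≤ C * Real.exp (N * s)) :
    ∀ s < s₀, ∀ t ∈ Icc 0 (2 * Real.pi), g s t = 0 := by
  have hIn : ∀ x, ‖I x‖ = ‖x‖ := fun x => by
    have h1 : ⟪I x, I x⟫ = ⟪x, x⟫ := by rw [hIskew, hIsq, inner_neg_right, neg_neg]
    rw [real_inner_self_eq_norm_sq, real_inner_self_eq_norm_sq] at h1
    exact (sq_eq_sq₀ (norm_nonneg _) (norm_nonneg _)).1 h1
  have hre : ∀ s < s₀, ∀ t, |(c s t).re| ≤ 1 / 4 := fun s hs t => by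
    simpa using (Complex.abs_re_le_norm _).trans (c_le s hs t)
  have him : ∀ s < s₀, ∀ t, |(c s t).im - 1| ≤ 1 / 4 := fun s hs t => by
    simpa using (Complex.abs_im_le_norm _).trans (c_le s hs t)
  have q0 : ∀ s t, 0 < 1 + (c s t).re ^ 2 := fun s t => by positivity
  set A : ℝ → ℝ → ℝ := fun s t => (c s t).im / (1 + (c s t).re ^ 2) with hA
  set A' : ℂ → ℂ → ℝ := fun z z' =>
    (z'.im * (1 + z.re ^ 2) - z.im * (2 * z.re * z'.re)) / (1 + z.re ^ 2) ^ 2 with hA'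
  have dA : ∀ {f : ℝ → ℂ} {f' : ℂ} {x : ℝ}, HasDerivAt f f' x →
      HasDerivAt (fun x => (f x).im / (1 + (f x).re ^ 2)) (A' (f x) f') x := by
    intro f f' x hf
    have h1 : HasDerivAt (fun x => (f x).im) f'.im x :=
      Complex.imCLM.hasFDerivAt.comp_hasDerivAt x hf
    have h2 : HasDerivAt (fun x => (f x).re) f'.re x :=
      Complex.reCLM.hasFDerivAt.comp_hasDerivAt x hf
    have h3 := h1.fun_div ((h2.fun_pow 2).const_add 1) (by positivity)
    refine h3.congr_deriv ?_
    simp [hA']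
  have A'le : ∀ {z z' : ℂ} {δ : ℝ}, |z.re| ≤ 1 / 4 → |z.im - 1| ≤ 1 / 4 → ‖z'‖ ≤ δ →
      |A' z z'| ≤ 2 * δ := by
    intro z z' δ h1 h2 h3
    have h4 := (Complex.abs_re_le_norm z').trans h3
    have h5 := (Complex.abs_im_le_norm z').trans h3
    have hδ : 0 ≤ δ := (norm_nonneg _).trans h3
    have h6 : 1 ≤ 1 + z.re ^ 2 := by nlinarith [sq_nonneg z.re]
    have h7 : |z.im| ≤ 5 / 4 := by
      rw [abs_le] at h2 ⊢; constructor <;> linarith [h2.1, h2.2]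
    have h8 : |z'.im * (1 + z.re ^ 2)| ≤ δ * (1 + z.re ^ 2) := by
      rw [abs_mul, abs_of_pos (by linarith : 0 < 1 + z.re ^ 2)]
      gcongr
    have h9 : |z.im * (2 * z.re * z'.re)| ≤ 5 / 4 * (2 * (1 / 4) * δ) := by
      rw [abs_mul, abs_mul, abs_mul, abs_two]
      gcongr
    rw [hA', abs_div, abs_of_pos (by positivity : 0 < (1 + z.re ^ 2) ^ 2),
      div_le_iff₀ (by positivity)]
    have h10 := abs_sub (z'.im * (1 + z.re ^ 2)) (z.im * (2 * z.re * z'.re))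
    have h11 : δ * (1 + z.re ^ 2) ≤ δ * (1 + z.re ^ 2) ^ 2 := by
      gcongr; nlinarith
    have h12 : δ * 1 ≤ δ * (1 + z.re ^ 2) ^ 2 := by
      gcongr; nlinarith
    linarith
  have cA' : ∀ {f : ℝ → ℝ → ℂ}, ContinuousOn (fun p : ℝ × ℝ => f p.1 p.2) (Iio s₀ ×ˢ univ) →
      ContinuousOn (fun p : ℝ × ℝ => A' (c p.1 p.2) (f p.1 p.2)) (Iio s₀ ×ˢ univ) := by
    intro f hf
    have r1 := Complex.continuous_re.comp_continuousOn hc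
    have r2 := Complex.continuous_im.comp_continuousOn hc
    have r3 := Complex.continuous_re.comp_continuousOn hf
    have r4 := Complex.continuous_im.comp_continuousOn hf
    exact ContinuousOn.div ((r4.mul (continuousOn_const.add (r1.pow 2))).sub
      (r2.mul ((continuousOn_const.mul r1).mul r3))) ((continuousOn_const.add (r1.pow 2)).pow 2)
      fun p _ => by have := q0 p.1 p.2; positivity
  have cA : ContinuousOn (fun p : ℝ × ℝ => A p.1 p.2) (Iio s₀ ×ˢ univ) :=
    (Complex.continuous_im.comp_continuousOn hc).div
      (continuousOn_const.add ((Complex.continuous_re.comp_continuousOn hc).pow 2))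
      fun p _ => (q0 p.1 p.2).ne'
  have cre := Complex.continuous_re.comp_continuousOn hc
  have hAle : ∀ s < s₀, ∀ t, |A s t| ≤ 5 / 4 := fun s hs t => by
    rw [hA, abs_div, abs_of_pos (q0 s t), div_le_iff₀ (q0 s t)]
    have := abs_le.1 (him s hs t)
    have h7 : |(c s t).im| ≤ 5 / 4 := by
      rw [abs_le]; constructor <;> linarith [this.1, this.2]
    nlinarith [sq_nonneg (c s t).re]
  have hKe : ∀ s, 0 ≤ K * Real.exp s := fun s => by positivity
  refine eq_zero_of_cylinder_cauchyRiemann hIskew hIsq (g := g) (gs := gs) (gt := gt) (gst := gst)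
    (a := A) (as := fun s t => A' (c s t) (cs s t)) (at' := fun s t => A' (c s t) (ct s t))
    (b := fun s t => -((c s t).re * A s t))
    (bt := fun s t => -((ct s t).re * A s t + (c s t).re * A' (c s t) (ct s t)))
    (K := 2 * K) hs₀ (by linarith) hg hgs hgt hgst cA (cA' hcs) (cA' hct) (cre.mul cA).neg
    (((Complex.continuous_re.comp_continuousOn hct).mul cA).add (cre.mul (cA' hct))).neg
    dgs dgt dgts dgst (fun s hs t => dA (dcs s hs t)) (fun s hs t => dA (dct s hs t))
    (fun s hs t => (HasDerivAt.fun_mul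
      (Complex.reCLM.hasFDerivAt.comp_hasDerivAt t (dct s hs t)) (dA (dct s hs t))).fun_neg)
    pg pgs (fun s hs => by simp only [hA, pc s hs]) (fun s hs => by simp only [hA, pc s hs])
    ?_ ?_ ?_ ?_ ?_ ?_ hdecay
  · intro s hs t
    rw [hA, le_div_iff₀ (q0 s t)]
    have h1 := abs_le.1 (him s hs t)
    have h2 := abs_le.1 (hre s hs t)
    nlinarith
  · intro s hs t
    rw [abs_neg, abs_mul]
    have := mul_le_mul (hre s hs t) (hAle s hs t) (abs_nonneg _) (by norm_num)
    linarith
  · intro s hs t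
    have := A'le (hre s hs t) (him s hs t) (cs_le s hs t)
    linarith
  · intro s hs t
    have := A'le (hre s hs t) (him s hs t) (ct_le s hs t)
    linarith
  · intro s hs t
    have h1 := A'le (hre s hs t) (him s hs t) (ct_le s hs t)
    have h2 := mul_le_mul ((Complex.abs_re_le_norm (ct s t)).trans (ct_le s hs t)) (hAle s hs t)
      (abs_nonneg _) (hKe s)
    have h3 := mul_le_mul (hre s hs t) h1 (abs_nonneg _) (by norm_num)
    have h4 := abs_add_le ((ct s t).re * A s t) ((c s t).re * A' (c s t) (ct s t))
    rw [abs_mul, abs_mul] at h4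
    rw [abs_neg]
    have := hKe s
    linarith
  · intro s hs t
    set x := (c s t).re with hx
    set y := (c s t).im with hy
    set e := x • gs s t + y • gt s t - I (gs s t) with he
    have h0 := q0 s t
    rw [← hx] at h0
    have e1 : gs s t + A s t • I (gt s t) - (-(x * A s t)) • gt s t =
        (1 + x ^ 2)⁻¹ • (x • e + I e) := by
      have : gs s t = (1 + x ^ 2)⁻¹ • ((1 + x ^ 2) • gs s t) := by
        rw [smul_smul, inv_mul_cancel₀ h0.ne', one_smul]
      rw [this, he]
      simp only [hA, ← hx, ← hy, map_sub, map_add, map_smul, hIsq]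
      module
    rw [e1, norm_smul, norm_inv, Real.norm_of_nonneg h0.le, inv_mul_le_iff₀ h0]
    have h1 : ‖x • e + I e‖ ≤ (1 / 4 + 1) * ‖e‖ := by
      refine (norm_add_le _ _).trans ?_
      rw [norm_smul, hIn, Real.norm_eq_abs, add_mul, one_mul]
      gcongr
      exact hre s hs t
    have h2 := hCR s hs t
    have h3 : 0 ≤ K * Real.exp s * ‖g s t‖ := by positivity
    have h4 : (2 * K * Real.exp s * ‖g s t‖) * 1 ≤
        (2 * K * Real.exp s * ‖g s t‖) * (1 + x ^ 2) := by
      gcongr; nlinarith [sq_nonneg x]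
    linarith

end CylinderStructure

section Polar

variable {F : Type*} [NormedAddCommGroup F] [InnerProductSpace ℝ F]

/-- Polar coordinates `(s, t) ↦ exp (s + i t)`. -/
noncomputable def expPolar (s t : ℝ) : ℂ := Complex.exp (s + t * Complex.I)

theorem norm_expPolar (s t : ℝ) : ‖expPolar s t‖ = Real.exp s := by
  simp [expPolar, Complex.norm_exp]

theorem expPolar_ne_zero (s t : ℝ) : expPolar s t ≠ 0 := Complex.exp_ne_zero _

theorem hasDerivAt_expPolar_left (s t : ℝ) :
    HasDerivAt (fun x => expPolar x t) (expPolar s t) s := by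
  have h : HasDerivAt (fun x : ℝ => (x : ℂ) + t * Complex.I) 1 s :=
    (Complex.ofRealCLM.hasDerivAt (x := s)).add_const _
  simpa [expPolar] using h.cexp

theorem hasDerivAt_expPolar_right (s t : ℝ) :
    HasDerivAt (fun y => expPolar s y) (Complex.I * expPolar s t) t := by
  have h : HasDerivAt (fun y : ℝ => (s : ℂ) + y * Complex.I) (1 * Complex.I) t :=
    ((Complex.ofRealCLM.hasDerivAt (x := t)).mul_const _).const_add _
  simpa [expPolar, mul_comm] using h.cexp

theorem continuous_expPolar : Continuous (fun p : ℝ × ℝ => expPolar p.1 p.2) := by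
  unfold expPolar; fun_prop

theorem expPolar_two_pi (s : ℝ) : expPolar s (2 * Real.pi) = expPolar s 0 := by
  have := Complex.exp_periodic (s : ℂ)
  simpa [expPolar] using this

theorem exists_expPolar_eq {z : ℂ} (hz : z ≠ 0) :
    ∃ t ∈ Icc 0 (2 * Real.pi), expPolar (Real.log ‖z‖) t = z := by
  obtain ⟨t, ht, h⟩ : ∃ t ∈ Icc 0 (2 * Real.pi),
      Complex.exp (t * Complex.I) = Complex.exp (arg z * Complex.I) := by
    rcases le_or_gt 0 (arg z) with h | h
    · exact ⟨arg z, ⟨h, by linarith [arg_le_pi z, Real.pi_pos]⟩, rfl⟩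
    · refine ⟨arg z + 2 * Real.pi, ⟨by linarith [neg_pi_lt_arg z], by linarith⟩, ?_⟩
      push_cast
      rw [add_mul, Complex.exp_periodic]
  refine ⟨t, ht, ?_⟩
  rw [expPolar, Complex.exp_add, h, ← Complex.ofReal_exp, Real.exp_log (norm_pos_iff.2 hz)]
  exact norm_mul_exp_arg_mul_I z

set_option maxHeartbeats 1000000 in
/-- Strong unique continuation at the origin for the differential inequality
`|Dg ∘ j - I ∘ Dg| ≤ C |g|` when `j 0` is the standard complex structure. -/
theorem eventually_eq_zero_of_flat_of_standard_at_zero {I : F →L[ℝ] F}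
    (hIskew : ∀ x y, ⟪I x, y⟫ = -⟪x, I y⟫) (hIsq : ∀ x, I (I x) = -x)
    {g : ℂ → F} {j : ℂ → ℂ →L[ℝ] ℂ} {C : ℝ} (hg : ContDiff ℝ 2 g) (hj : ContDiff ℝ 1 j)
    (hj0 : ∀ w, j 0 w = Complex.I * w)
    (hCR : ∀ᶠ z in 𝓝 0, ∀ w, ‖fderiv ℝ g z (j z w) - I (fderiv ℝ g z w)‖ ≤ C * ‖g z‖ * ‖w‖)
    (hflat : ∀ N : ℕ, g =O[𝓝 0] fun z => ‖z‖ ^ N) :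
    ∀ᶠ z in 𝓝 0, g z = 0 := by
  have hg' : ContDiff ℝ 1 (fderiv ℝ g) := hg.fderiv_right (by norm_num)
  have hgd : ∀ z, HasFDerivAt g (fderiv ℝ g z) z := fun z =>
    (hg.differentiable (by norm_num) z).hasFDerivAt
  have hgdd : ∀ z, HasFDerivAt (fderiv ℝ g) (fderiv ℝ (fderiv ℝ g) z) z := fun z =>
    (hg'.differentiable (by norm_num) z).hasFDerivAt
  have hjd : ∀ z, HasFDerivAt j (fderiv ℝ j z) z := fun z =>
    (hj.differentiable (by norm_num) z).hasFDerivAt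
  have hgc' : Continuous (fderiv ℝ g) := hg'.continuous
  have hgc'' : Continuous (fderiv ℝ (fderiv ℝ g)) := hg'.continuous_fderiv (by norm_num)
  have hjc : Continuous j := hj.continuous
  have hjc' : Continuous (fderiv ℝ j) := hj.continuous_fderiv (by norm_num)
  have hsymm : ∀ z w w', fderiv ℝ (fderiv ℝ g) z w w' = fderiv ℝ (fderiv ℝ g) z w' w := fun z =>
    second_derivative_symmetric (fun y => hgd y) (hgdd z)
  set M := ‖fderiv ℝ j 0‖ + 1 with hM
  have hMpos : 0 < M := by positivity
  have hev1 : ∀ᶠ z in 𝓝 (0 : ℂ), ‖fderiv ℝ j z‖ < M := by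
    have h1 : Continuous fun z => ‖fderiv ℝ j z‖ :=
      (hj.continuous_fderiv (by norm_num)).norm
    exact h1.continuousAt.eventually_lt continuousAt_const (by rw [hM]; exact lt_add_one _)
  have hev2 : ∀ᶠ z in 𝓝 (0 : ℂ), ‖j z - j 0‖ ≤ M * ‖z‖ := by
    obtain ⟨r, hr, hball⟩ := Metric.eventually_nhds_iff_ball.1 hev1
    filter_upwards [ball_mem_nhds (0 : ℂ) hr] with z hz
    simpa using (convex_ball (0 : ℂ) r).norm_image_sub_le_of_norm_fderiv_le (𝕜 := ℝ)
      (fun x _ => (hjd x).differentiableAt) (fun x hx => (hball x hx).le) (mem_ball_self hr) hz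
  have hev3 : ∀ᶠ z in 𝓝 (0 : ℂ), M * ‖z‖ < 1 / 4 := by
    have : Continuous fun z : ℂ => M * ‖z‖ := by fun_prop
    exact this.continuousAt.eventually_lt continuousAt_const (by simp)
  obtain ⟨r, hr, hball⟩ := Metric.eventually_nhds_iff_ball.1 (hev1.and (hev2.and (hev3.and hCR)))
  set s₀ := min 0 (Real.log r) with hs₀
  have hin : ∀ s < s₀, ∀ t, expPolar s t ∈ ball (0 : ℂ) r := fun s hs t => by
    rw [mem_ball_zero_iff, norm_expPolar]
    exact (Real.lt_log_iff_exp_lt hr).1 (hs.trans_le (min_le_right _ _))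
  set K := max 1 (max (3 * M) |C|) with hK
  have hK1 : 3 * M ≤ K := (le_max_left _ _).trans (le_max_right _ _)
  have hK2 : C ≤ K := (le_abs_self C).trans ((le_max_right _ _).trans (le_max_right _ _))
  have ce := continuous_expPolar
  have ce' : Continuous (fun p : ℝ × ℝ => (expPolar p.1 p.2)⁻¹) :=
    ce.inv₀ fun p => expPolar_ne_zero _ _
  have dinv1 : ∀ s t, HasDerivAt (fun x => (expPolar x t)⁻¹) (-(expPolar s t)⁻¹) s := fun s t => by
    refine ((hasDerivAt_expPolar_left s t).fun_inv (expPolar_ne_zero s t)).congr_deriv ?_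
    field_simp [expPolar_ne_zero s t]
  have dinv2 : ∀ s t, HasDerivAt (fun y => (expPolar s y)⁻¹)
      (-(Complex.I * (expPolar s t)⁻¹)) t := fun s t => by
    refine ((hasDerivAt_expPolar_right s t).fun_inv (expPolar_ne_zero s t)).congr_deriv ?_
    field_simp [expPolar_ne_zero s t]
  have hcyl := eq_zero_of_cylinder_complexStructure hIskew hIsq
    (g := fun s t => g (expPolar s t))
    (gs := fun s t => fderiv ℝ g (expPolar s t) (expPolar s t))
    (gt := fun s t => fderiv ℝ g (expPolar s t) (Complex.I * expPolar s t))
    (gst := fun s t => fderiv ℝ (fderiv ℝ g) (expPolar s t) (expPolar s t)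
        (Complex.I * expPolar s t) + fderiv ℝ g (expPolar s t) (Complex.I * expPolar s t))
    (c := fun s t => (expPolar s t)⁻¹ * j (expPolar s t) (expPolar s t))
    (cs := fun s t => (expPolar s t)⁻¹ * fderiv ℝ j (expPolar s t) (expPolar s t) (expPolar s t))
    (ct := fun s t => (expPolar s t)⁻¹ *
      (fderiv ℝ j (expPolar s t) (Complex.I * expPolar s t) (expPolar s t)
      + j (expPolar s t) (Complex.I * expPolar s t) - Complex.I * j (expPolar s t) (expPolar s t)))
    (s₀ := s₀) (K := K) (min_le_left _ _) (le_max_left _ _)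
    (hg.continuous.comp ce).continuousOn
    ((hgc'.comp ce).clm_apply ce).continuousOn
    ((hgc'.comp ce).clm_apply (continuous_const.mul ce)).continuousOn
    ((((hgc''.comp ce).clm_apply ce).clm_apply (continuous_const.mul ce)).add
      ((hgc'.comp ce).clm_apply (continuous_const.mul ce))).continuousOn
    (ce'.mul ((hjc.comp ce).clm_apply ce)).continuousOn
    (ce'.mul (((hjc'.comp ce).clm_apply ce).clm_apply ce)).continuousOn
    (ce'.mul (((((hjc'.comp ce).clm_apply (continuous_const.mul ce)).clm_apply ce).add
      ((hjc.comp ce).clm_apply (continuous_const.mul ce))).sub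
      (continuous_const.mul ((hjc.comp ce).clm_apply ce)))).continuousOn
    (fun s _ t => (hgd _).comp_hasDerivAt s (hasDerivAt_expPolar_left s t))
    (fun s _ t => (hgd _).comp_hasDerivAt t (hasDerivAt_expPolar_right s t))
    (fun s _ t => ((hgdd _).comp_hasDerivAt s (hasDerivAt_expPolar_left s t)).clm_apply
      ((hasDerivAt_expPolar_left s t).const_mul Complex.I))
    (fun s _ t => (((hgdd _).comp_hasDerivAt t (hasDerivAt_expPolar_right s t)).clm_apply
      (hasDerivAt_expPolar_right s t)).congr_deriv (by simp only [Function.comp]; rw [hsymm]))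
    (fun s _ t => ((dinv1 s t).fun_mul (((hjd _).comp_hasDerivAt s
      (hasDerivAt_expPolar_left s t)).clm_apply (hasDerivAt_expPolar_left s t))).congr_deriv (by
        simp only [Function.comp]; ring))
    (fun s _ t => ((dinv2 s t).fun_mul (((hjd _).comp_hasDerivAt t
      (hasDerivAt_expPolar_right s t)).clm_apply (hasDerivAt_expPolar_right s t))).congr_deriv (by
        simp only [Function.comp]; ring))
    (fun s _ => by simp only [expPolar_two_pi]) (fun s _ => by simp only [expPolar_two_pi])
    (fun s _ => by simp only [expPolar_two_pi]) ?_ ?_ ?_ ?_ ?_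
  · have hev : ∀ᶠ z in 𝓝 (0 : ℂ), ‖z‖ < Real.exp s₀ :=
      continuous_norm.continuousAt.eventually_lt continuousAt_const (by simpa using Real.exp_pos _)
    have hne : ∀ z : ℂ, z ≠ 0 → ‖z‖ < Real.exp s₀ → g z = 0 := fun z hz h => by
      obtain ⟨t, ht, h'⟩ := exists_expPolar_eq hz
      have := hcyl (Real.log ‖z‖) ((Real.log_lt_iff_lt_exp (norm_pos_iff.2 hz)).2 h) t ht
      rwa [h'] at this
    filter_upwards [hev] with z hz
    rcases eq_or_ne z 0 with rfl | h0
    · have h1 := (hflat 1).eq_zero_imp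
      simpa using h1.self_of_nhds
    · exact hne z h0 hz
  · intro s hs t
    obtain ⟨-, h2, h3, -⟩ := hball _ (hin s hs t)
    set z := expPolar s t with hz
    have hz0 : z ≠ 0 := expPolar_ne_zero s t
    have e : z⁻¹ * j z z - Complex.I = z⁻¹ * ((j z - j 0) z) := by
      rw [sub_apply, hj0]; field_simp
    rw [e, norm_mul, norm_inv, inv_mul_le_iff₀ (norm_pos_iff.2 hz0), mul_comm]
    exact ((j z - j 0).le_opNorm z).trans
      (mul_le_mul_of_nonneg_right (h2.trans h3.le) (norm_nonneg _))
  · intro s hs t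
    obtain ⟨h1, -, -, -⟩ := hball _ (hin s hs t)
    rw [← norm_expPolar s t]
    set z := expPolar s t with hz
    have hz0 : z ≠ 0 := expPolar_ne_zero s t
    rw [norm_mul, norm_inv, inv_mul_le_iff₀ (norm_pos_iff.2 hz0)]
    refine ((fderiv ℝ j z).le_opNorm₂ z z).trans ?_
    have : ‖fderiv ℝ j z‖ ≤ K := by linarith
    calc ‖fderiv ℝ j z‖ * ‖z‖ * ‖z‖ ≤ K * ‖z‖ * ‖z‖ := by gcongr
      _ = ‖z‖ * (K * ‖z‖) := by ring
  · intro s hs t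
    obtain ⟨h1, h2, -, -⟩ := hball _ (hin s hs t)
    rw [← norm_expPolar s t]
    set z := expPolar s t with hz
    have hz0 : z ≠ 0 := expPolar_ne_zero s t
    rw [norm_mul, norm_inv, inv_mul_le_iff₀ (norm_pos_iff.2 hz0)]
    have e : fderiv ℝ j z (Complex.I * z) z + j z (Complex.I * z) - Complex.I * j z z =
        fderiv ℝ j z (Complex.I * z) z +
          ((j z - j 0) (Complex.I * z) - Complex.I * ((j z - j 0) z)) := by
      simp only [sub_apply, hj0]; ring
    have b1 : ‖fderiv ℝ j z (Complex.I * z) z‖ ≤ M * ‖z‖ * ‖z‖ := by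
      refine ((fderiv ℝ j z).le_opNorm₂ _ z).trans ?_
      rw [norm_mul, Complex.norm_I, one_mul]
      gcongr
    have b2 : ‖(j z - j 0) (Complex.I * z)‖ ≤ M * ‖z‖ * ‖z‖ := by
      refine ((j z - j 0).le_opNorm _).trans ?_
      rw [norm_mul, Complex.norm_I, one_mul]
      gcongr
    have b3 : ‖Complex.I * ((j z - j 0) z)‖ ≤ M * ‖z‖ * ‖z‖ := by
      rw [norm_mul, Complex.norm_I, one_mul]
      refine ((j z - j 0).le_opNorm _).trans ?_
      gcongr
    rw [e]
    calc _ ≤ M * ‖z‖ * ‖z‖ + (M * ‖z‖ * ‖z‖ + M * ‖z‖ * ‖z‖) :=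
          (norm_add_le _ _).trans (add_le_add b1 ((norm_sub_le _ _).trans (add_le_add b2 b3)))
      _ = ‖z‖ * (3 * M * ‖z‖) := by ring
      _ ≤ ‖z‖ * (K * ‖z‖) := by gcongr
  · intro s hs t
    obtain ⟨-, -, -, h⟩ := hball _ (hin s hs t)
    rw [← norm_expPolar s t]
    set z := expPolar s t with hz
    have hz0 : z ≠ 0 := expPolar_ne_zero s t
    have h1 := h z
    set c := z⁻¹ * j z z with hc
    have e : j z z = c.re • z + c.im • (Complex.I * z) := by
      have : j z z = c * z := by rw [hc]; field_simp
      rw [this]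
      conv_lhs => rw [← Complex.re_add_im c]
      simp only [Complex.real_smul]; ring
    rw [e, map_add, map_smul, map_smul] at h1
    refine h1.trans ?_
    calc C * ‖g z‖ * ‖z‖ ≤ K * ‖g z‖ * ‖z‖ := by gcongr
      _ = K * ‖z‖ * ‖g z‖ := by ring
  · intro N
    obtain ⟨c, hc⟩ := (hflat N).bound
    obtain ⟨ρ, hρ, hρball⟩ := Metric.eventually_nhds_iff_ball.1 hc
    obtain ⟨B, hB⟩ := (isCompact_closedBall (0 : ℂ) r).exists_bound_of_continuousOn
      hg.continuous.continuousOn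
    refine ⟨max c (B / ρ ^ N), fun s hs t => ?_⟩
    rw [Real.exp_nat_mul, ← norm_expPolar s t]
    have hz := hin s hs t
    set z := expPolar s t
    rcases lt_or_ge ‖z‖ ρ with h | h
    · refine (hρball z (mem_ball_zero_iff.2 h)).trans ?_
      rw [norm_pow, norm_norm]
      gcongr
      exact le_max_left _ _
    · have hB0 : 0 ≤ B := (norm_nonneg _).trans (hB z (ball_subset_closedBall hz))
      calc ‖g z‖ ≤ B := hB z (ball_subset_closedBall hz)
        _ = B / ρ ^ N * ρ ^ N := by field_simp
        _ ≤ B / ρ ^ N * ‖z‖ ^ N := by gcongr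
        _ ≤ _ := by gcongr; exact le_max_right _ _

end Polar

section UniqueContinuation

variable {E : Type*} [NormedAddCommGroup E] [InnerProductSpace ℝ E]

/-- A linear complex structure on `ℂ` is conjugate to the standard one. -/
theorem exists_equiv_conj_standard {j : ℂ →L[ℝ] ℂ} (hj : ∀ w, j (j w) = -w) :
    ∃ L : ℂ ≃L[ℝ] ℂ, ∀ w, L (j w) = Complex.I * L w := by
  let L : ℂ →ₗ[ℝ] ℂ :=
    { toFun := fun w => (w.re : ℂ) - Complex.I * ((j w).re : ℂ)
      map_add' := fun x y => by simp; ring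
      map_smul' := fun r x => by rw [map_smul]; simp; ring }
  have hL : ∀ w, L w = (w.re : ℂ) - Complex.I * ((j w).re : ℂ) := fun w => rfl
  have hinj : Function.Injective L := by
    rw [← LinearMap.ker_eq_bot, LinearMap.ker_eq_bot']
    intro w hw
    have h1 : w.re = 0 := by simpa [hL] using congrArg Complex.re hw
    have h2 : (j w).re = 0 := by simpa [hL] using congrArg Complex.im hw
    by_contra hne
    have h3 : w.im ≠ 0 := fun h => hne (Complex.ext h1 h)
    have h4 : j w = ((j w).im / w.im) • w := by
      refine Complex.ext ?_ ?_
      · simp [h1, h2]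
      · simp [h3]
    have h5 : j (j w) = ((j w).im / w.im) • (((j w).im / w.im) • w) := by
      rw [← h4, ← map_smul, ← h4]
    rw [hj] at h5
    have h6 := congrArg Complex.im h5
    simp only [neg_im, Complex.smul_im, smul_eq_mul] at h6
    have h7 : (((j w).im / w.im) ^ 2 + 1) * w.im = 0 := by linarith
    rcases mul_eq_zero.1 h7 with h | h
    · nlinarith [sq_nonneg ((j w).im / w.im)]
    · exact h3 h
  refine ⟨(LinearEquiv.ofInjectiveEndo L hinj).toContinuousLinearEquiv, fun w => ?_⟩
  change L (j w) = Complex.I * L w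
  rw [hL, hL, hj]
  simp only [neg_re, ofReal_neg]
  linear_combination (((j w).re : ℂ)) * Complex.I_mul_I

theorem eventually_eq_zero_of_flat_of_standard_domain {h : ℂ → E} {J : ℂ → E →L[ℝ] E}
    {j : ℂ → ℂ →L[ℝ] ℂ} {C : ℝ} (hh : ContDiff ℝ 2 h) (hJ : ContDiff ℝ 2 J)
    (hJsq : ∀ z x, J z (J z x) = -x) (hj : ContDiff ℝ 1 j) (hj0 : ∀ w, j 0 w = Complex.I * w)
    (hCR : ∀ᶠ z in 𝓝 0, ∀ w, ‖fderiv ℝ h z (j z w) - J z (fderiv ℝ h z w)‖ ≤ C * ‖h z‖ * ‖w‖)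
    (hflat : ∀ N : ℕ, h =O[𝓝 0] fun z => ‖z‖ ^ N) :
    ∀ᶠ z in 𝓝 0, h z = 0 := by
  set P : (E × E) ≃L[ℝ] WithLp 2 (E × E) := (WithLp.prodContinuousLinearEquiv 2 ℝ E E).symm with hP
  have Pinner : ∀ x y, ⟪P x, P y⟫ = ⟪x.1, y.1⟫ + ⟪x.2, y.2⟫ := fun x y =>
    WithLp.prod_inner_apply _ _
  have Pnorm : ∀ x, ‖x.1‖ ≤ ‖P x‖ := fun x => by
    have h1 := Pinner x x
    simp only [real_inner_self_eq_norm_sq] at h1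
    exact abs_le_of_sq_le_sq' (by nlinarith [sq_nonneg ‖x.2‖]) (norm_nonneg _) |>.2
  have Pnorm' : ∀ x, ‖P x‖ ≤ ‖x.1‖ + ‖x.2‖ := fun x => by
    have h1 := Pinner x x
    simp only [real_inner_self_eq_norm_sq] at h1
    refine abs_le_of_sq_le_sq' ?_ (by positivity) |>.2
    nlinarith [mul_nonneg (norm_nonneg x.1) (norm_nonneg x.2)]
  set R : (E × E) →L[ℝ] (E × E) :=
    (-ContinuousLinearMap.snd ℝ E E).prod (ContinuousLinearMap.fst ℝ E E) with hR
  have hRa : ∀ x, R x = (-x.2, x.1) := fun x => rfl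
  set I : WithLp 2 (E × E) →L[ℝ] WithLp 2 (E × E) :=
    (P : (E × E) →L[ℝ] WithLp 2 (E × E)).comp
      (R.comp (P.symm : WithLp 2 (E × E) →L[ℝ] E × E)) with hI
  have hIP : ∀ x, I (P x) = P (-x.2, x.1) := fun x => by simp [hI, hRa]
  have hIskew : ∀ x y, ⟪I x, y⟫ = -⟪x, I y⟫ := fun x y => by
    obtain ⟨x, rfl⟩ := P.surjective x
    obtain ⟨y, rfl⟩ := P.surjective y
    rw [hIP, hIP, Pinner, Pinner]
    simp
  have hIsq : ∀ x, I (I x) = -x := fun x => by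
    obtain ⟨x, rfl⟩ := P.surjective x
    rw [hIP, hIP, ← map_neg]; rfl
  set g : ℂ → WithLp 2 (E × E) := fun z => P (h z, -(J z (h z))) with hgdef
  have hJh : ContDiff ℝ 2 fun z => J z (h z) := hJ.clm_apply hh
  have hg : ContDiff ℝ 2 g := P.contDiff.comp (hh.prodMk hJh.neg)
  have hhd : ∀ z, HasFDerivAt h (fderiv ℝ h z) z := fun z =>
    (hh.differentiable (by norm_num) z).hasFDerivAt
  have hJd : ∀ z, HasFDerivAt J (fderiv ℝ J z) z := fun z =>
    (hJ.differentiable (by norm_num) z).hasFDerivAt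
  have hgd : ∀ z w, fderiv ℝ g z w =
      P (fderiv ℝ h z w, -(J z (fderiv ℝ h z w) + fderiv ℝ J z w (h z))) := fun z w => by
    have h1 := P.hasFDerivAt.comp z ((hhd z).prodMk ((hJd z).clm_apply (hhd z)).fun_neg)
    have h2 : fderiv ℝ g z = _ := h1.fderiv
    rw [h2]
    simp
  have hJc : Continuous fun z => ‖J z‖ := hJ.continuous.norm
  have hJc' : Continuous fun z => ‖fderiv ℝ J z‖ := (hJ.continuous_fderiv (by norm_num)).norm
  have hjc : Continuous fun z => ‖j z‖ := hj.continuous.norm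
  set M := ‖J 0‖ + ‖fderiv ℝ J 0‖ + ‖j 0‖ + 1 with hM
  have hMpos : 0 < M := by positivity
  have hev1 : ∀ᶠ z in 𝓝 (0 : ℂ), ‖J z‖ < M :=
    hJc.continuousAt.eventually_lt continuousAt_const
      (by linarith [norm_nonneg (J 0), norm_nonneg (fderiv ℝ J 0), norm_nonneg (j 0)])
  have hev2 : ∀ᶠ z in 𝓝 (0 : ℂ), ‖fderiv ℝ J z‖ < M :=
    hJc'.continuousAt.eventually_lt continuousAt_const
      (by linarith [norm_nonneg (J 0), norm_nonneg (fderiv ℝ J 0), norm_nonneg (j 0)])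
  have hev3 : ∀ᶠ z in 𝓝 (0 : ℂ), ‖j z‖ < M :=
    hjc.continuousAt.eventually_lt continuousAt_const
      (by linarith [norm_nonneg (J 0), norm_nonneg (fderiv ℝ J 0), norm_nonneg (j 0)])
  have hfin := eventually_eq_zero_of_flat_of_standard_at_zero (g := g) (j := j)
    (C := |C| + M * |C| + M * M + M) hIskew hIsq hg hj hj0 ?_ ?_
  · filter_upwards [hfin] with z hz
    have := Pnorm (h z, -(J z (h z)))
    rw [show P (h z, -(J z (h z))) = 0 from hz, norm_zero] at this
    exact norm_le_zero_iff.1 this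
  · filter_upwards [hev1, hev2, hev3, hCR] with z h1 h2 h3 h4 w
    set e := fderiv ℝ h z (j z w) - J z (fderiv ℝ h z w) with he
    have e0 : fderiv ℝ h z (j z w) = J z (fderiv ℝ h z w) + e := by rw [he]; abel
    have e1 : fderiv ℝ g z (j z w) - I (fderiv ℝ g z w) =
        P (e - fderiv ℝ J z w (h z), -(J z e) - fderiv ℝ J z (j z w) (h z)) := by
      rw [hgd, hgd, hIP, ← map_sub, e0]
      congr 1
      simp only [map_add, hJsq, Prod.mk_sub_mk, Prod.mk.injEq]
      constructor <;> abel
    have hen : ‖e‖ ≤ |C| * ‖h z‖ * ‖w‖ := (h4 w).trans (by gcongr; exact le_abs_self C)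
    have b1 : ‖fderiv ℝ J z w (h z)‖ ≤ M * ‖w‖ * ‖h z‖ := by
      refine ((fderiv ℝ J z).le_opNorm₂ _ _).trans ?_
      gcongr
    have b2 : ‖J z e‖ ≤ M * (|C| * ‖h z‖ * ‖w‖) := by
      refine ((J z).le_opNorm _).trans ?_
      gcongr
    have b3 : ‖fderiv ℝ J z (j z w) (h z)‖ ≤ M * (M * ‖w‖) * ‖h z‖ := by
      refine ((fderiv ℝ J z).le_opNorm₂ _ _).trans ?_
      gcongr
      exact ((j z).le_opNorm w).trans (by gcongr)
    rw [e1]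
    have b4 : ‖h z‖ ≤ ‖g z‖ := Pnorm (h z, -(J z (h z)))
    calc _ ≤ ‖e - fderiv ℝ J z w (h z)‖ + ‖-(J z e) - fderiv ℝ J z (j z w) (h z)‖ := Pnorm' _
      _ ≤ (‖e‖ + ‖fderiv ℝ J z w (h z)‖) + (‖-(J z e)‖ + ‖fderiv ℝ J z (j z w) (h z)‖) :=
        add_le_add (norm_sub_le _ _) (norm_sub_le _ _)
      _ ≤ (|C| * ‖h z‖ * ‖w‖ + M * ‖w‖ * ‖h z‖) +
          (M * (|C| * ‖h z‖ * ‖w‖) + M * (M * ‖w‖) * ‖h z‖) := by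
        rw [norm_neg]; gcongr
      _ = (|C| + M * |C| + M * M + M) * ‖h z‖ * ‖w‖ := by ring
      _ ≤ _ := by gcongr
  · intro N
    refine IsBigO.trans (IsBigO.of_bound (1 + M) ?_) (hflat N)
    filter_upwards [hev1] with z h1
    refine (Pnorm' _).trans ?_
    rw [norm_neg, add_mul, one_mul]
    gcongr
    exact ((J z).le_opNorm _).trans (by gcongr)

/-- **Strong unique continuation** for the differential inequality `|Dh ∘ j - J ∘ Dh| ≤ C |h|`. -/
theorem eventually_eq_zero_of_flat {h : ℂ → E} {J : ℂ → E →L[ℝ] E}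
    {j : ℂ → ℂ →L[ℝ] ℂ} {C : ℝ} {z₀ : ℂ} (hh : ContDiff ℝ 2 h) (hJ : ContDiff ℝ 2 J)
    (hJsq : ∀ z x, J z (J z x) = -x) (hj : ContDiff ℝ 1 j) (hjsq : ∀ w, j z₀ (j z₀ w) = -w)
    (hCR : ∀ᶠ z in 𝓝 z₀, ∀ w, ‖fderiv ℝ h z (j z w) - J z (fderiv ℝ h z w)‖ ≤ C * ‖h z‖ * ‖w‖)
    (hflat : ∀ N : ℕ, h =O[𝓝 z₀] fun z => ‖z - z₀‖ ^ N) :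
    ∀ᶠ z in 𝓝 z₀, h z = 0 := by
  obtain ⟨L, hL⟩ := exists_equiv_conj_standard hjsq
  set A : ℂ → ℂ := fun ζ => z₀ + L.symm ζ with hA
  have hAc : ∀ {n}, ContDiff ℝ n A := fun {n} => contDiff_const.add L.symm.contDiff
  have hA0 : A 0 = z₀ := by simp [hA]
  have hAt : Tendsto A (𝓝 0) (𝓝 z₀) := by
    have := (hAc (n := 0)).continuous.tendsto 0
    rwa [hA0] at this
  have hAd : ∀ ζ, HasFDerivAt A (L.symm : ℂ →L[ℝ] ℂ) ζ := fun ζ =>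
    (L.symm.hasFDerivAt).const_add z₀
  have hd : ∀ ζ w, fderiv ℝ (h ∘ A) ζ w = fderiv ℝ h (A ζ) (L.symm w) := fun ζ w => by
    rw [((hh.differentiable (by norm_num) (A ζ)).hasFDerivAt.comp ζ (hAd ζ)).fderiv]; rfl
  set c := ‖(L.symm : ℂ →L[ℝ] ℂ)‖ with hc
  have hfin := eventually_eq_zero_of_flat_of_standard_domain (h := h ∘ A) (J := J ∘ A)
    (j := fun ζ => (L : ℂ →L[ℝ] ℂ).comp ((j (A ζ)).comp (L.symm : ℂ →L[ℝ] ℂ))) (C := |C| * c)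
    (hh.comp hAc) (hJ.comp hAc) (fun _ _ => hJsq _ _)
    (contDiff_const.clm_comp ((hj.comp hAc).clm_comp contDiff_const))
    (fun w => by simp [hA0, hL]) ?_ ?_
  · have hB : Tendsto (fun z => L (z - z₀)) (𝓝 z₀) (𝓝 0) := by
      have : Continuous fun z => L (z - z₀) := by fun_prop
      simpa using this.tendsto z₀
    filter_upwards [hB.eventually hfin] with z hz
    simpa [hA] using hz
  · filter_upwards [hAt.eventually hCR] with ζ hζ w
    rw [hd, hd]
    have h1 := hζ (L.symm w)
    simp only [Function.comp, ContinuousLinearMap.comp_apply, ContinuousLinearEquiv.coe_coe,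
      ContinuousLinearEquiv.symm_apply_apply]
    refine h1.trans ?_
    calc C * ‖h (A ζ)‖ * ‖L.symm w‖ ≤ |C| * ‖h (A ζ)‖ * (c * ‖w‖) := by
          gcongr
          · exact le_abs_self C
          · exact (L.symm : ℂ →L[ℝ] ℂ).le_opNorm w
      _ = |C| * c * ‖h (A ζ)‖ * ‖w‖ := by ring
  · intro N
    refine ((hflat N).comp_tendsto hAt).trans
      (IsBigO.of_bound (c ^ N) (Eventually.of_forall fun ζ => ?_))
    simp only [Function.comp, hA, add_sub_cancel_left, norm_pow, norm_norm, ← mul_pow]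
    gcongr
    exact (L.symm : ℂ →L[ℝ] ℂ).le_opNorm ζ

end UniqueContinuation

section Jets

variable {D E F G : Type*} [NormedAddCommGroup D] [NormedSpace ℝ D]
  [NormedAddCommGroup E] [NormedSpace ℝ E] [NormedAddCommGroup F] [NormedSpace ℝ F]
  [NormedAddCommGroup G] [NormedSpace ℝ G]

/-- The derivatives of `f` of order less than `k` vanish at the origin. -/
def JetVanishes (k : ℕ) (f : D → E) : Prop := ∀ i < k, iteratedFDeriv ℝ i f 0 = 0

namespace JetVanishes

theorem zero (f : D → E) : JetVanishes 0 f := fun _ h => absurd h (Nat.not_lt_zero _)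

theorem mono {k l : ℕ} {f : D → E} (h : JetVanishes l f) (hkl : k ≤ l) : JetVanishes k f :=
  fun i hi => h i (hi.trans_le hkl)

theorem succ_iff {k : ℕ} {f : D → E} :
    JetVanishes (k + 1) f ↔ f 0 = 0 ∧ JetVanishes k (fderiv ℝ f) := by
  have h0 : iteratedFDeriv ℝ 0 f 0 = 0 ↔ f 0 = 0 := by
    rw [← norm_eq_zero, norm_iteratedFDeriv_zero, norm_eq_zero]
  have hs : ∀ i, iteratedFDeriv ℝ i (fderiv ℝ f) 0 = 0 ↔ iteratedFDeriv ℝ (i + 1) f 0 = 0 := by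
    intro i
    rw [← norm_eq_zero, norm_iteratedFDeriv_fderiv, norm_eq_zero]
  constructor
  · exact fun h => ⟨h0.1 (h 0 (Nat.succ_pos _)), fun i hi => (hs i).2 (h _ (Nat.succ_lt_succ hi))⟩
  · rintro ⟨h1, h2⟩ (_ | i) hi
    · exact h0.2 h1
    · exact (hs i).1 (h2 i (Nat.lt_of_succ_lt_succ hi))

theorem apply_zero {k : ℕ} {f : D → E} (h : JetVanishes (k + 1) f) : f 0 = 0 := (succ_iff.1 h).1

theorem fderiv {k : ℕ} {f : D → E} (h : JetVanishes (k + 1) f) : JetVanishes k (fderiv ℝ f) :=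
  (succ_iff.1 h).2

theorem one_iff {f : D → E} : JetVanishes 1 f ↔ f 0 = 0 :=
  succ_iff.trans ⟨fun h => h.1, fun h => ⟨h, zero _⟩⟩

theorem add {k : ℕ} {f g : D → E} (hf : ContDiff ℝ ∞ f) (hg : ContDiff ℝ ∞ g)
    (h : JetVanishes k f) (h' : JetVanishes k g) : JetVanishes k fun z => f z + g z := by
  intro i hi
  have := iteratedFDeriv_add_apply (i := i) (x := 0) (hf.of_le (mod_cast le_top)).contDiffAt
    (hg.of_le (mod_cast le_top)).contDiffAt
  rw [h i hi, h' i hi, add_zero] at this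
  exact this

theorem sub {k : ℕ} {f g : D → E} (hf : ContDiff ℝ ∞ f) (hg : ContDiff ℝ ∞ g)
    (h : JetVanishes k f) (h' : JetVanishes k g) : JetVanishes k fun z => f z - g z := by
  intro i hi
  have := iteratedFDeriv_sub_apply (i := i) (x := 0) (hf.of_le (mod_cast le_top)).contDiffAt
    (hg.of_le (mod_cast le_top)).contDiffAt
  rw [h i hi, h' i hi, sub_zero] at this
  exact this

theorem clm {k : ℕ} {f : D → E} (hf : ContDiff ℝ ∞ f) (h : JetVanishes k f) (L : E →L[ℝ] F) :
    JetVanishes k fun z => L (f z) := by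
  intro i hi
  have := L.norm_iteratedFDeriv_comp_left (hf.contDiffAt (x := 0)) (n := i) (mod_cast le_top)
  rw [h i hi, norm_zero, mul_zero] at this
  exact norm_le_zero_iff.1 this

theorem bilinear {k l : ℕ} {f : D → E} {g : D → F} (hf : ContDiff ℝ ∞ f) (hg : ContDiff ℝ ∞ g)
    (h : JetVanishes k f) (h' : JetVanishes l g) (B : E →L[ℝ] F →L[ℝ] G) :
    JetVanishes (k + l) fun z => B (f z) (g z) := by
  intro i hi
  have := B.norm_iteratedFDeriv_le_of_bilinear hf hg 0 (n := i) (mod_cast le_top)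
  rw [Finset.sum_eq_zero, mul_zero] at this
  · exact norm_le_zero_iff.1 this
  · intro m hmi
    have hmi' := Finset.mem_range_succ_iff.1 hmi
    rcases lt_or_ge m k with hm | hm
    · simp [h m hm]
    · simp [h' (i - m) (by omega)]

theorem congr {k : ℕ} {f g : D → E} (h : JetVanishes k f) (hfg : f =ᶠ[𝓝 0] g) :
    JetVanishes k g := fun i hi => by
  rw [← (hfg.iteratedFDeriv ℝ i).eq_of_nhds, h i hi]

theorem isBigO {k : ℕ} {f : ℂ → E} (hf : ContDiff ℝ ∞ f) (h : JetVanishes k f) :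
    f =O[𝓝 0] fun z => ‖z‖ ^ k := by
  induction k generalizing E with
  | zero => simpa using hf.continuous.continuousAt.tendsto.isBigO_one ℝ
  | succ k ih =>
    obtain ⟨c, hc⟩ := (ih (hf.fderiv_right (m := ∞) le_rfl) h.fderiv).bound
    obtain ⟨r, hr, hball⟩ := Metric.eventually_nhds_iff_ball.1 hc
    refine IsBigO.of_bound c ?_
    filter_upwards [ball_mem_nhds (0 : ℂ) hr] with z hz
    have hz' : ‖z‖ < r := mem_ball_zero_iff.1 hz
    have hsub : closedBall (0 : ℂ) ‖z‖ ⊆ ball 0 r := closedBall_subset_ball hz'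
    have hc' : ∀ x ∈ closedBall (0 : ℂ) ‖z‖, ‖_root_.fderiv ℝ f x‖ ≤ |c| * ‖z‖ ^ k := fun x hx => by
      refine (hball x (hsub hx)).trans ?_
      rw [norm_pow, norm_norm]
      gcongr
      · exact le_abs_self c
      · exact mem_closedBall_zero_iff.1 hx
    have hc0 : 0 ≤ c ∨ z = 0 := by
      by_contra! hcon
      have h1 := (norm_nonneg _).trans (hball z hz)
      have h2 : 0 < ‖‖z‖ ^ k‖ := norm_pos_iff.2 (pow_ne_zero _ (norm_ne_zero_iff.2 hcon.2))
      nlinarith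
    have := (convex_closedBall (0 : ℂ) ‖z‖).norm_image_sub_le_of_norm_fderiv_le (𝕜 := ℝ)
      (fun x _ => (hf.differentiable (by norm_num) x)) hc'
      (mem_closedBall_self (norm_nonneg z)) (mem_closedBall_zero_iff.2 le_rfl)
    rw [h.apply_zero, sub_zero, sub_zero] at this
    rcases hc0 with h0 | h0
    · rw [abs_of_nonneg h0] at this
      rw [norm_pow, norm_norm, pow_succ, ← mul_assoc]
      exact this
    · simp [h0, h.apply_zero]

end JetVanishes

/-- A smooth function satisfying the Cauchy-Riemann equation up to order `k` and vanishing to order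
`k` has a complex monomial as its leading Taylor term. -/
theorem exists_jet_leadingCoeff {f : ℂ → ℂ} {k : ℕ} (hf : ContDiff ℝ ∞ f) (h : JetVanishes k f)
    (hq : JetVanishes k fun z => fderiv ℝ f z Complex.I - Complex.I * fderiv ℝ f z 1) :
    ∃ a : ℂ, JetVanishes (k + 1) fun z => f z - a * z ^ k := by
  induction k generalizing f with
  | zero => exact ⟨f 0, JetVanishes.one_iff.2 (by simp)⟩
  | succ k ih =>
    have hf' : ContDiff ℝ ∞ (fderiv ℝ f) := hf.fderiv_right (m := ∞) le_rfl
    have hfd : ∀ z, HasFDerivAt f (fderiv ℝ f z) z := fun z =>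
      (hf.differentiable (by norm_num) z).hasFDerivAt
    have hfd' : ∀ z, HasFDerivAt (fderiv ℝ f) (fderiv ℝ (fderiv ℝ f) z) z := fun z =>
      (hf'.differentiable (by norm_num) z).hasFDerivAt
    set g : ℂ → ℂ := fun z => fderiv ℝ f z 1 with hg
    set q : ℂ → ℂ := fun z => fderiv ℝ f z Complex.I - Complex.I * fderiv ℝ f z 1 with hqdef
    have hgs : ContDiff ℝ ∞ g := hf'.clm_apply contDiff_const
    have hqs : ContDiff ℝ ∞ q :=
      (hf'.clm_apply contDiff_const).sub (contDiff_const.mul (hf'.clm_apply contDiff_const))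
    have hgd : ∀ z w, fderiv ℝ g z w = fderiv ℝ (fderiv ℝ f) z w 1 := fun z w => by
      rw [((hfd' z).clm_apply (hasFDerivAt_const (1 : ℂ) z)).fderiv]; simp
    have hqd : ∀ z w, fderiv ℝ q z w = fderiv ℝ (fderiv ℝ f) z w Complex.I -
        Complex.I * fderiv ℝ (fderiv ℝ f) z w 1 := fun z w => by
      rw [(((hfd' z).clm_apply (hasFDerivAt_const Complex.I z)).fun_sub
        (((hfd' z).clm_apply (hasFDerivAt_const (1 : ℂ) z)).const_mul Complex.I)).fderiv]
      simp
    obtain ⟨a, ha⟩ := ih hgs (h.fderiv.clm hf' (ContinuousLinearMap.apply ℝ ℂ (1 : ℂ))) (by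
      have h1 := hq.fderiv.clm (hqs.fderiv_right (m := ∞) le_rfl)
        (ContinuousLinearMap.apply ℝ ℂ (1 : ℂ))
      convert h1 using 2 with z
      change _ = fderiv ℝ q z 1
      rw [hgd, hgd, hqd, second_derivative_symmetric hfd (hfd' z) Complex.I 1])
    refine ⟨a / (k + 1), JetVanishes.succ_iff.2 ⟨by simp [h.apply_zero], ?_⟩⟩
    have hk : ((k : ℂ) + 1) ≠ 0 := by exact_mod_cast Nat.succ_ne_zero k
    set ga : ℂ → ℂ := fun z => g z - a * z ^ k with hga
    have hgas : ContDiff ℝ ∞ ga := hgs.sub (contDiff_const.mul (contDiff_id.pow k))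
    have hD : fderiv ℝ (fun z => f z - a / (k + 1) * z ^ (k + 1)) = fun z =>
        ContinuousLinearMap.mul ℝ ℂ (ga z) + Complex.imCLM.smulRight (q z) := by
      funext z
      have hpow : HasFDerivAt (fun z : ℂ => z ^ (k + 1)) (((k + 1 : ℕ) * z ^ k) •
          (1 : ℂ →L[ℝ] ℂ)) z := by
        have := ((hasDerivAt_pow (k + 1) z).hasFDerivAt.restrictScalars ℝ)
        refine this.congr_fderiv ?_
        ext; simp [mul_comm]
      rw [((hfd z).fun_sub (hpow.const_mul (a / (k + 1)))).fderiv]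
      refine ContinuousLinearMap.ext fun w => ?_
      have hw : fderiv ℝ f z w = w.re * fderiv ℝ f z 1 + w.im * fderiv ℝ f z Complex.I := by
        conv_lhs => rw [← Complex.re_add_im w,
          show (w.re : ℂ) + w.im * Complex.I = w.re • (1 : ℂ) + w.im • Complex.I by simp]
        rw [map_add, map_smul, map_smul]; simp
      simp only [sub_apply, add_apply, smul_apply, ContinuousLinearMap.mul_apply',
        ContinuousLinearMap.smulRight_apply, hga, hg, hqdef, hw]
      simp only [one_apply_eq_self, smul_eq_mul, imCLM_apply, Complex.real_smul]
      have hw' : w = w.re + w.im * Complex.I := (Complex.re_add_im w).symm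
      have ha' : a / (k + 1) * ((k + 1 : ℕ) * z ^ k * w) = a * z ^ k * w := by
        push_cast; field_simp
      rw [ha']
      linear_combination (-(fderiv ℝ f z 1)) * hw'
    rw [hD]
    refine JetVanishes.add ((ContinuousLinearMap.mul ℝ ℂ).contDiff.comp hgas)
      ((contDiff_const (c := Complex.imCLM)).smulRight hqs) (ha.clm hgas _) ?_
    exact hq.clm hqs (ContinuousLinearMap.smulRightL ℝ ℂ ℂ Complex.imCLM)

end Jets

section FlatDivision

variable {G : Type*} [NormedAddCommGroup G] [NormedSpace ℝ G]

theorem isBigO_inv_pow_smul_of_flat {f : ℂ → G} {d : ℂ → ℝ} {c r : ℝ} {m : ℕ} (hr : 0 < r)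
    (hc : 0 < c) (hlow : ∀ z ∈ ball (0 : ℂ) r, c * ‖z‖ ^ m ≤ |d z|) (hf : ContDiff ℝ ∞ f)
    (hflat : ∀ n, JetVanishes n f) (p N : ℕ) :
    (fun z => (d z ^ p)⁻¹ • f z) =O[𝓝 0] fun z => ‖z‖ ^ N := by
  obtain ⟨K, hK⟩ := ((hflat (m * p + N)).isBigO hf).bound
  refine IsBigO.of_bound (K / c ^ p) ?_
  filter_upwards [hK, ball_mem_nhds (0 : ℂ) hr] with z hz hzr
  rw [norm_pow, norm_norm, pow_add, pow_mul] at hz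
  rw [norm_smul, norm_inv, norm_pow, Real.norm_eq_abs, norm_pow, norm_norm]
  rcases eq_or_ne z 0 with rfl | h0
  · rw [(hflat 1).apply_zero, norm_zero, mul_zero]
    rcases N.eq_zero_or_pos with rfl | hN
    · rcases (m * p).eq_zero_or_pos with h | h
      · rw [← pow_mul, h] at hz
        have : 0 ≤ K := by simpa using (norm_nonneg _).trans hz
        positivity
      · simp only [pow_zero, mul_one]
        obtain ⟨w, hw, hw0⟩ : ∃ w : ℂ, ‖f w‖ ≤ K * ‖‖w‖ ^ (m * p + 0)‖ ∧ w ≠ 0 := by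
          have : ∃ᶠ w in 𝓝 (0 : ℂ), w ≠ 0 :=
            frequently_iff_neBot.2 (inferInstanceAs (𝓝[≠] (0 : ℂ)).NeBot)
          exact (this.and_eventually hK).exists.imp fun w hw => ⟨hw.2, hw.1⟩
        have h1 : 0 < ‖‖w‖ ^ (m * p + 0)‖ := by
          rw [norm_pow, norm_norm]; exact pow_pos (norm_pos_iff.2 hw0) _
        have : 0 ≤ K := by
          by_contra! hcon
          nlinarith [norm_nonneg (f w)]
        positivity
    · simp [hN.ne']
  · have hz0 : 0 < ‖z‖ := norm_pos_iff.2 h0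
    have h1 : (c * ‖z‖ ^ m) ^ p ≤ |d z| ^ p := by gcongr; exact hlow z hzr
    have h2 : 0 < (c * ‖z‖ ^ m) ^ p := by positivity
    calc (|d z| ^ p)⁻¹ * ‖f z‖ ≤ ((c * ‖z‖ ^ m) ^ p)⁻¹ * (K * ((‖z‖ ^ m) ^ p * ‖z‖ ^ N)) := by
          gcongr
      _ = K / c ^ p * ‖z‖ ^ N := by rw [mul_pow]; field_simp

theorem hasFDerivAt_inv_pow_smul_of_flat {f : ℂ → G} {d : ℂ → ℝ} {c r : ℝ} {m : ℕ}
    (hr : 0 < r) (hc : 0 < c) (hlow : ∀ z ∈ ball (0 : ℂ) r, c * ‖z‖ ^ m ≤ |d z|)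
    (hd : ContDiff ℝ ∞ d) (hf : ContDiff ℝ ∞ f) (hflat : ∀ n, JetVanishes n f) (p : ℕ)
    {z : ℂ} (hz : z ∈ ball (0 : ℂ) r) :
    HasFDerivAt (fun z => (d z ^ p)⁻¹ • f z)
      ((d z ^ p)⁻¹ • fderiv ℝ f z -
        (d z ^ (p + 1))⁻¹ • ((p : ℝ) • (fderiv ℝ d z).smulRight (f z))) z := by
  rcases eq_or_ne z 0 with rfl | h0
  · have h1 := isBigO_inv_pow_smul_of_flat hr hc hlow hf hflat p 2
    have h2 : HasFDerivAt (fun z => (d z ^ p)⁻¹ • f z) (0 : ℂ →L[ℝ] G) 0 :=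
      IsBigO.hasFDerivAt (n := 2) (by simpa using h1) (by norm_num)
    refine h2.congr_fderiv ?_
    rw [(hflat 1).apply_zero, (hflat 2).fderiv.apply_zero]
    ext; simp
  · have hd0 : d z ≠ 0 := fun h => by
      have := hlow z hz
      rw [h, abs_zero] at this
      have : 0 < c * ‖z‖ ^ m := by have := norm_pos_iff.2 h0; positivity
      linarith
    have h1 : HasFDerivAt (fun z => (d z ^ p)⁻¹)
        ((-((p : ℝ) * (d z ^ (p + 1))⁻¹)) • fderiv ℝ d z) z := by
      have h2 : HasDerivAt (fun x : ℝ => (x ^ p)⁻¹) (-((p : ℝ) * (d z ^ (p + 1))⁻¹)) (d z) := by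
        refine ((hasDerivAt_pow p (d z)).fun_inv (pow_ne_zero _ hd0)).congr_deriv ?_
        rcases p with _ | p
        · simp
        · simp only [Nat.add_sub_cancel]
          field_simp
          ring
      exact h2.comp_hasFDerivAt z ((hd.differentiable (by norm_num) z).hasFDerivAt)
    refine (h1.fun_smul (hf.differentiable (by norm_num) z).hasFDerivAt).congr_fderiv ?_
    ext
    simp only [add_apply, sub_apply, smul_apply, ContinuousLinearMap.smulRight_apply]
    module

theorem contDiffOn_inv_pow_smul_of_flat {f : ℂ → G} {d : ℂ → ℝ} {c r : ℝ} {m : ℕ}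
    (hr : 0 < r) (hc : 0 < c) (hlow : ∀ z ∈ ball (0 : ℂ) r, c * ‖z‖ ^ m ≤ |d z|)
    (hd : ContDiff ℝ ∞ d) (hf : ContDiff ℝ ∞ f) (hflat : ∀ n, JetVanishes n f) (p n : ℕ) :
    ContDiffOn ℝ n (fun z => (d z ^ p)⁻¹ • f z) (ball 0 r) := by
  induction n generalizing G p with
  | zero =>
    exact contDiffOn_zero.2 fun z hz =>
      (hasFDerivAt_inv_pow_smul_of_flat hr hc hlow hd hf hflat p hz).continuousAt.continuousWithinAt
  | succ n ih =>
    rw [Nat.cast_succ, contDiffOn_succ_iff_fderiv_of_isOpen isOpen_ball]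
    refine ⟨fun z hz => (hasFDerivAt_inv_pow_smul_of_flat hr hc hlow hd hf hflat p
      hz).differentiableAt.differentiableWithinAt, by simp, ?_⟩
    have hf' : ContDiff ℝ ∞ (fderiv ℝ f) := hf.fderiv_right (m := ∞) le_rfl
    have hd' : ContDiff ℝ ∞ (fderiv ℝ d) := hd.fderiv_right (m := ∞) le_rfl
    have hs : ContDiff ℝ ∞ fun z => (p : ℝ) • (fderiv ℝ d z).smulRight (f z) :=
      (hd'.smulRight hf).const_smul _
    have hsf : ∀ n, JetVanishes n fun z => (p : ℝ) • (fderiv ℝ d z).smulRight (f z) := fun n => by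
      have := (JetVanishes.zero (fderiv ℝ d)).bilinear hd' hf (hflat n)
        ((p : ℝ) • ContinuousLinearMap.smulRightL ℝ ℂ G)
      rw [zero_add] at this
      exact this
    have h1 := ih hf' (fun n => (hflat (n + 1)).fderiv) p
    have h2 := ih hs hsf (p + 1)
    exact (h1.sub h2).congr fun z hz =>
      (hasFDerivAt_inv_pow_smul_of_flat hr hc hlow hd hf hflat p hz).fderiv

theorem contDiff_intervalIntegral_param {P : Type*} [NormedAddCommGroup P] [NormedSpace ℝ P]
    [CompleteSpace G] {Φ : P → ℝ → G} (hΦ : ContDiff ℝ ∞ fun q : P × ℝ => Φ q.1 q.2) :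
    ContDiff ℝ ∞ fun p => ∫ t in (0 : ℝ)..1, Φ p t := by
  let b : ContDiffBump (0 : ℝ) := ⟨1, 2, by norm_num, by norm_num⟩
  have h := contDiffOn_convolution_right_with_param (μ := volume) (n := ⊤)
    (ContinuousLinearMap.lsmul ℝ ℝ : ℝ →L[ℝ] G →L[ℝ] G)
    (f := indicator (Ioc (0 : ℝ) 1) fun _ => (1 : ℝ)) (g := fun (p : P) (x : ℝ) => b x • Φ p (-x))
    (s := univ) (k := closedBall 0 2) isOpen_univ (isCompact_closedBall _ _)
    (fun p x _ hx => by
      rw [b.zero_of_le_dist (le_of_lt (not_le.1 hx)), zero_smul])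
    ((integrable_indicator_iff measurableSet_Ioc).2 (by simp)).locallyIntegrable
    (by
      have h1 : ContDiff ℝ ∞ fun q : P × ℝ => b q.2 • Φ q.1 (-q.2) :=
        (b.contDiff.comp contDiff_snd).smul
          (hΦ.comp (contDiff_fst.prodMk contDiff_snd.neg))
      exact h1.contDiffOn)
  rw [univ_prod_univ, contDiffOn_univ] at h
  have h2 := h.comp
    (contDiff_id.prodMk (contDiff_const (c := (0 : ℝ))) : ContDiff ℝ ∞ fun p : P => (p, (0 : ℝ)))
  refine (congrArg (ContDiff ℝ ∞) (funext fun p => ?_)).mp h2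
  symm
  simp only [Function.comp, id, convolution]
  rw [intervalIntegral.integral_of_le zero_le_one, ← integral_indicator measurableSet_Ioc]
  congr 1
  funext t
  by_cases ht : t ∈ Ioc (0 : ℝ) 1
  · have : b (0 - t) = 1 := b.one_of_mem_closedBall (by
      simp only [mem_closedBall, zero_sub, dist_zero_right, norm_neg, Real.norm_eq_abs, b]
      rw [abs_of_pos ht.1]; exact ht.2)
    rw [zero_sub] at this
    simp [ht, this]
  · simp [ht]

theorem intervalIntegral_apply_apply {V : Type*} [NormedAddCommGroup V] [NormedSpace ℝ V]
    [CompleteSpace G] {A : ℝ → V →L[ℝ] V →L[ℝ] G} (hA : Continuous A) (a b : ℝ) (x y : V) :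
    (∫ t in a..b, A t) x y = ∫ t in a..b, A t x y := by
  rw [ContinuousLinearMap.intervalIntegral_apply (hA.intervalIntegrable a b),
    ContinuousLinearMap.intervalIntegral_apply
      ((hA.clm_apply continuous_const).intervalIntegrable a b)]

set_option maxHeartbeats 1000000 in
/-- Second order Taylor formula with integral remainder. -/
theorem taylor_two_integral_remainder {V : Type*} [NormedAddCommGroup V] [NormedSpace ℝ V]
    [CompleteSpace G] {v : V → G} (hv : ContDiff ℝ 2 v) (z η : V) :
    v (z + η) = v z + fderiv ℝ v z η +
      (∫ t in (0 : ℝ)..1, (1 - t) • fderiv ℝ (fderiv ℝ v) (z + t • η)) η η := by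
  have hv' : ContDiff ℝ 1 (fderiv ℝ v) := hv.fderiv_right (by norm_num)
  have hγ : ∀ t : ℝ, HasDerivAt (fun t : ℝ => z + t • η) η t := fun t => by
    simpa using ((hasDerivAt_id t).smul_const η).const_add z
  have hd : ∀ t : ℝ, HasDerivAt (fun t : ℝ => (1 - t) • fderiv ℝ v (z + t • η) η + v (z + t • η))
      ((1 - t) • fderiv ℝ (fderiv ℝ v) (z + t • η) η η) t := fun t => by
    have h1 := ((hv.differentiable (by norm_num) (z + t • η)).hasFDerivAt).comp_hasDerivAt t (hγ t)
    have h2 := (((hv'.differentiable (by norm_num) (z + t • η)).hasFDerivAt).comp_hasDerivAt t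
      (hγ t)).clm_apply (hasDerivAt_const t η)
    have h3 := (((hasDerivAt_id t).const_sub 1).fun_smul h2).fun_add h1
    refine h3.congr_deriv ?_
    simp
  have hc : Continuous fun t : ℝ => (1 - t) • fderiv ℝ (fderiv ℝ v) (z + t • η) :=
    (by fun_prop : Continuous fun t : ℝ => 1 - t).smul
      ((hv'.continuous_fderiv (by norm_num)).comp (by fun_prop))
  have h4 : (∫ t in (0 : ℝ)..1, (1 - t) • fderiv ℝ (fderiv ℝ v) (z + t • η) η η) =
      v (z + η) - (fderiv ℝ v z η + v z) := by
    rw [intervalIntegral.integral_eq_sub_of_hasDerivAt (fun t _ => hd t)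
      (Continuous.intervalIntegrable
        (((hc.clm_apply continuous_const).clm_apply continuous_const)) _ _)]
    simp
  rw [intervalIntegral_apply_apply hc]
  simp only [smul_apply]
  rw [h4]
  abel

end FlatDivision

/-- Smooth implicit function theorem for a perturbation of the second coordinate. -/
theorem exists_smooth_implicit {Φ : ℂ × ℂ → ℂ} (hΦ : ∀ᶠ p in 𝓝 0, ContDiffAt ℝ ∞ Φ p)
    (hΦ0 : Φ 0 = 0) (hΦ' : ∀ w, fderiv ℝ Φ 0 (0, w) = w) :
    ∃ χ : ℂ → ℂ, χ 0 = 0 ∧ ∀ᶠ z in 𝓝 0, ContDiffAt ℝ ∞ χ z ∧ Φ (z, χ z) = 0 := by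
  set Ψ : ℂ × ℂ → ℂ × ℂ := fun p => (p.1, Φ p) with hΨ
  have hΨs : ∀ᶠ p in 𝓝 0, ContDiffAt ℝ ∞ Ψ p := hΦ.mono fun p hp => contDiffAt_fst.prodMk hp
  have h0 := hΦ.self_of_nhds
  have hd0 := (h0.differentiableAt (by norm_num)).hasFDerivAt
  have hsplit : ∀ x : ℂ × ℂ, fderiv ℝ Φ 0 x = fderiv ℝ Φ 0 (x.1, 0) + x.2 := fun x => by
    conv_lhs => rw [show x = (x.1, 0) + (0, x.2) by simp]
    rw [map_add, hΦ']
  let D : (ℂ × ℂ) ≃L[ℝ] (ℂ × ℂ) := ContinuousLinearEquiv.equivOfInverse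
    ((ContinuousLinearMap.fst ℝ ℂ ℂ).prod (fderiv ℝ Φ 0))
    ((ContinuousLinearMap.fst ℝ ℂ ℂ).prod (ContinuousLinearMap.snd ℝ ℂ ℂ -
      (fderiv ℝ Φ 0).comp ((ContinuousLinearMap.inl ℝ ℂ ℂ).comp (ContinuousLinearMap.fst ℝ ℂ ℂ))))
    (fun x => Prod.ext (by simp) (by simp [hsplit x]))
    (fun x => Prod.ext (by simp) (by simp [hsplit (x.1, x.2 - fderiv ℝ Φ 0 (x.1, 0))]))
  have hΨd : HasFDerivAt Ψ (D : (ℂ × ℂ) →L[ℝ] (ℂ × ℂ)) 0 := hasFDerivAt_fst.prodMk hd0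
  have hΨ0 : Ψ 0 = 0 := by simp [hΨ, hΦ0]
  set e := hΨs.self_of_nhds.toOpenPartialHomeomorph Ψ hΨd (by norm_num) with he
  have hee : ∀ p, e p = Ψ p := fun p => rfl
  have hsrc : (0 : ℂ × ℂ) ∈ e.source := ContDiffAt.mem_toOpenPartialHomeomorph_source _ _ _
  have htgt : (0 : ℂ × ℂ) ∈ e.target := by
    have := e.map_source hsrc
    rwa [hee, hΨ0] at this
  have hsymm0 : e.symm 0 = 0 := by
    have := e.left_inv hsrc
    rwa [hee, hΨ0] at this
  have hcont : ContinuousAt e.symm 0 := e.symm.continuousAt htgt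
  have hcd : ContinuousAt (fderiv ℝ Ψ) 0 :=
    (hΨs.self_of_nhds.fderiv_right (m := 0) (by norm_num)).continuousAt
  have hinv : ∀ᶠ p in 𝓝 (0 : ℂ × ℂ), ∃ f' : (ℂ × ℂ) ≃L[ℝ] (ℂ × ℂ),
      HasFDerivAt Ψ (f' : (ℂ × ℂ) →L[ℝ] (ℂ × ℂ)) p := by
    have h1 : ∀ᶠ p in 𝓝 (0 : ℂ × ℂ), fderiv ℝ Ψ p ∈
        range ((↑) : ((ℂ × ℂ) ≃L[ℝ] (ℂ × ℂ)) → ((ℂ × ℂ) →L[ℝ] (ℂ × ℂ))) :=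
      hcd.eventually (by rw [hΨd.fderiv]; exact ContinuousLinearEquiv.nhds D)
    filter_upwards [h1, hΨs] with p ⟨f', hf'⟩ hp
    exact ⟨f', hf' ▸ (hp.differentiableAt (by norm_num)).hasFDerivAt⟩
  have hall : ∀ᶠ a in 𝓝 (0 : ℂ × ℂ), ContDiffAt ℝ ∞ e.symm a ∧ e (e.symm a) = a := by
    have h1 : Tendsto e.symm (𝓝 0) (𝓝 0) := by
      have := hcont.tendsto
      rwa [hsymm0] at this
    filter_upwards [h1.eventually hinv, h1.eventually hΨs, e.open_target.mem_nhds htgt]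
      with a ⟨f', hf'⟩ h3 h4
    exact ⟨e.contDiffAt_symm h4 hf' h3, e.right_inv h4⟩
  have hι : Tendsto (fun z : ℂ => (z, (0 : ℂ))) (𝓝 0) (𝓝 0) := by
    have : Continuous fun z : ℂ => (z, (0 : ℂ)) := by fun_prop
    exact this.tendsto 0
  refine ⟨fun z => (e.symm (z, 0)).2, by
    change (e.symm 0).2 = 0
    rw [hsymm0]; rfl, ?_⟩
  filter_upwards [hι.eventually hall] with z ⟨h1, h2⟩
  refine ⟨contDiffAt_snd.comp z (h1.comp z (contDiffAt_id.prodMk contDiffAt_const)), ?_⟩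
  rw [hee] at h2
  have h3 : (e.symm (z, 0)).1 = z := congrArg Prod.fst h2
  have h4 : Φ (e.symm (z, 0)) = 0 := congrArg Prod.snd h2
  convert h4 using 2
  exact Prod.ext h3.symm rfl

section Projection

variable {E : Type*} [NormedAddCommGroup E] [NormedSpace ℝ E]

theorem exists_contDiff_eventuallyEq {F : Type*} [NormedAddCommGroup F] [NormedSpace ℝ F]
    {f : ℂ → F} {z₀ : ℂ} (hf : ∀ᶠ z in 𝓝 z₀, ContDiffAt ℝ ∞ f z) :
    ∃ g : ℂ → F, ContDiff ℝ ∞ g ∧ g =ᶠ[𝓝 z₀] f := by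
  obtain ⟨r, hr, hball⟩ := Metric.eventually_nhds_iff_ball.1 hf
  let b : ContDiffBump z₀ := ⟨r / 3, r / 2, by positivity, by linarith⟩
  refine ⟨fun z => b z • f z, contDiff_iff_contDiffAt.2 fun z => ?_, ?_⟩
  · by_cases hz : z ∈ ball z₀ r
    · exact b.contDiff.contDiffAt.smul (hball z hz)
    · have hz' : z ∈ (closedBall z₀ (r / 2))ᶜ := fun h => hz (by
        rw [mem_closedBall] at h; rw [mem_ball]; linarith)
      refine (contDiffAt_const (c := (0 : F))).congr_of_eventuallyEq ?_
      filter_upwards [isClosed_closedBall.isOpen_compl.mem_nhds hz'] with y hy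
      rw [b.zero_of_le_dist (le_of_lt (not_le.1 hy)), zero_smul]
  · filter_upwards [b.eventuallyEq_one] with z hz
    rw [hz, Pi.one_apply, one_smul]

theorem not_jetVanishes_clm {f : ℂ → E} {k : ℕ} (hf : ContDiff ℝ ∞ f) (h : JetVanishes k f)
    (h' : ¬ JetVanishes (k + 1) f) : ∃ l : E →L[ℝ] ℝ, ¬ JetVanishes (k + 1) fun z => l (f z) := by
  have hne : iteratedFDeriv ℝ k f 0 ≠ 0 := fun h0 => h' fun i hi => by
    rcases Nat.lt_succ_iff_lt_or_eq.1 hi with hlt | rfl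
    · exact h i hlt
    · exact h0
  obtain ⟨x, hx⟩ : ∃ x, iteratedFDeriv ℝ k f 0 x ≠ 0 := by
    by_contra! hcon
    exact hne (ContinuousMultilinearMap.ext hcon)
  obtain ⟨l, hl⟩ := SeparatingDual.exists_ne_zero (R := ℝ) hx
  refine ⟨l, fun hcon => hl ?_⟩
  have h1 := hcon k (Nat.lt_succ_self k)
  have h2 := l.iteratedFDeriv_comp_left (hf.contDiffAt (x := 0)) (i := k) (mod_cast le_top)
  have h3 : iteratedFDeriv ℝ k (l ∘ f) 0 = 0 := h1
  rw [h2] at h3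
  simpa using congrArg (fun M => M x) h3

theorem exists_leading_projection {u : ℂ → E} {J : E → E →L[ℝ] E} {j : ℂ → ℂ →L[ℝ] ℂ}
    (hu : ContDiff ℝ ∞ u) (hJ : ContDiff ℝ ∞ J) (hJsq : ∀ x y, J x (J x y) = -y)
    (hj : ContDiff ℝ ∞ j) (hj0 : ∀ w, j 0 w = I * w)
    (hCR : ∀ᶠ z in 𝓝 0, ∀ w, fderiv ℝ u z (j z w) = J (u z) (fderiv ℝ u z w))
    (hu0 : u 0 = 0) (hnf : ¬ ∀ n, JetVanishes n u) :
    ∃ (m : ℕ) (c : ℂ) (p : ℂ → E →L[ℝ] ℂ), c ≠ 0 ∧ ContDiff ℝ ∞ p ∧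
      (∀ z x, p z (J (u z) x) = I * p z x) ∧ JetVanishes m (fderiv ℝ u) ∧
      (fun z => (p z).comp (fderiv ℝ u z) - (c * z ^ m) • (1 : ℂ →L[ℝ] ℂ)) =O[𝓝 0]
        fun z => ‖z‖ ^ (m + 1) := by
  classical
  have hex : ∃ n, ¬ JetVanishes n u := not_forall.1 hnf
  obtain ⟨m, hm⟩ : ∃ m, Nat.find hex = m + 2 := by
    have h0 : Nat.find hex ≠ 0 := fun h => Nat.find_spec hex (h ▸ JetVanishes.zero u)
    have h1 : Nat.find hex ≠ 1 := fun h => Nat.find_spec hex (h ▸ JetVanishes.one_iff.2 hu0)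
    exact ⟨Nat.find hex - 2, by omega⟩
  have hjet : JetVanishes (m + 1) u := not_not.1 (Nat.find_min hex (by omega))
  have hjet' : ¬ JetVanishes (m + 1 + 1) u := by
    have := Nat.find_spec hex
    rwa [hm] at this
  obtain ⟨l, hl⟩ := not_jetVanishes_clm hu hjet hjet'
  set Λ : E →L[ℝ] ℂ := ofRealCLM.comp l with hΛ
  set p : ℂ → E →L[ℝ] ℂ := fun z => Λ - (I • Λ).comp (J (u z)) with hp
  have hps : ContDiff ℝ ∞ p := contDiff_const.sub (contDiff_const.clm_comp (hJ.comp hu))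
  have hpJ : ∀ z x, p z (J (u z) x) = I * p z x := fun z x => by
    simp only [hp, hΛ, sub_apply, ContinuousLinearMap.comp_apply, smul_apply, hJsq, map_neg,
      smul_eq_mul, mul_sub, ← mul_assoc, I_mul_I]
    ring
  have hu' : ContDiff ℝ ∞ (fderiv ℝ u) := hu.fderiv_right (m := ∞) le_rfl
  have hDu : JetVanishes m (fderiv ℝ u) := hjet.fderiv
  set f : ℂ → ℂ := fun z => p 0 (u z) with hf
  have hfs : ContDiff ℝ ∞ f := (p 0).contDiff.comp hu
  have hfd : ∀ z, fderiv ℝ f z = (p 0).comp (fderiv ℝ u z) := fun z =>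
    ((p 0).hasFDerivAt.comp z (hu.differentiable (by norm_num) z).hasFDerivAt).fderiv
  have hfjet : JetVanishes (m + 1) f := hjet.clm hu (p 0)
  have hq : JetVanishes (m + 1) fun z => fderiv ℝ f z I - I * fderiv ℝ f z 1 := by
    have h1 : ContDiff ℝ ∞ fun z => I - j z 1 := contDiff_const.sub (hj.clm_apply contDiff_const)
    have h1' : JetVanishes 1 fun z => I - j z 1 := JetVanishes.one_iff.2 (by simp [hj0])
    have h2 : ContDiff ℝ ∞ fun z => J (u z) - J (u 0) := (hJ.comp hu).sub contDiff_const
    have h2' : JetVanishes 1 fun z => J (u z) - J (u 0) := JetVanishes.one_iff.2 (by simp)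
    have h3 : ContDiff ℝ ∞ fun z => fderiv ℝ u z (I - j z 1) := hu'.clm_apply h1
    have h3' : JetVanishes (m + 1) fun z => fderiv ℝ u z (I - j z 1) :=
      JetVanishes.bilinear hu' h1 hDu h1' (ContinuousLinearMap.id ℝ (ℂ →L[ℝ] E))
    have h4 : ContDiff ℝ ∞ fun z => fderiv ℝ u z 1 := hu'.clm_apply contDiff_const
    have h4' : JetVanishes m fun z => fderiv ℝ u z 1 :=
      hDu.clm hu' (ContinuousLinearMap.apply ℝ E (1 : ℂ))
    have h5 : ContDiff ℝ ∞ fun z => (J (u z) - J (u 0)) (fderiv ℝ u z 1) := h2.clm_apply h4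
    have h5' : JetVanishes (1 + m) fun z => (J (u z) - J (u 0)) (fderiv ℝ u z 1) :=
      JetVanishes.bilinear h2 h4 h2' h4' (ContinuousLinearMap.id ℝ (E →L[ℝ] E))
    rw [add_comm] at h5'
    refine ((JetVanishes.add h3 h5 h3' h5').clm (h3.add h5) (p 0)).congr ?_
    filter_upwards [hCR] with z hz
    simp only [hfd, ContinuousLinearMap.comp_apply, ← hpJ 0 (fderiv ℝ u z 1), map_add, map_sub,
      sub_apply, hz]
    ring
  obtain ⟨a, ha⟩ := exists_jet_leadingCoeff hfs hfjet hq
  have hzs : ContDiff ℝ ∞ fun z : ℂ => a * z ^ (m + 1) := contDiff_const.mul (contDiff_id.pow _)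
  have ha0 : a ≠ 0 := fun h => hl (by
    have h1 := ha.clm (hfs.sub hzs) reCLM
    refine h1.congr (Eventually.of_forall fun z => ?_)
    simp [h, hf, hp, hΛ])
  refine ⟨m, a * (m + 1), p, mul_ne_zero ha0 (by exact_mod_cast Nat.succ_ne_zero m), hps, hpJ, hDu,
    ?_⟩
  have h6 : ContDiff ℝ ∞ (fderiv ℝ fun z => f z - a * z ^ (m + 1)) :=
    (hfs.sub hzs).fderiv_right (m := ∞) le_rfl
  have h7 : ContDiff ℝ ∞ fun z => p z - p 0 := hps.sub contDiff_const
  have h7' : JetVanishes 1 fun z => p z - p 0 := JetVanishes.one_iff.2 (by simp)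
  have h8 : JetVanishes (1 + m) fun z => (p z - p 0).comp (fderiv ℝ u z) :=
    JetVanishes.bilinear h7 hu' h7' hDu (ContinuousLinearMap.compL ℝ ℂ E ℂ)
  rw [add_comm] at h8
  have h9 := (JetVanishes.add h6 (h7.clm_comp hu') ha.fderiv h8).isBigO
    (h6.add (h7.clm_comp hu'))
  refine h9.congr_left fun z => ?_
  have h10 : HasFDerivAt (fun z : ℂ => a * z ^ (m + 1))
      ((a * (m + 1) * z ^ m) • (1 : ℂ →L[ℝ] ℂ)) z := by
    have := ((hasDerivAt_pow (m + 1) z).const_mul a).hasFDerivAt.restrictScalars ℝ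
    refine this.congr_fderiv ?_
    ext
    simp
    ring
  have h11 := ((hfs.differentiable (by norm_num) z).hasFDerivAt.fun_sub h10).fderiv
  rw [h11, hfd]
  ext
  simp

end Projection

section Reparametrization

variable {E : Type*} [NormedAddCommGroup E] [NormedSpace ℝ E]

theorem eventually_norm_le_add_one {X G : Type*} [TopologicalSpace X] [SeminormedAddCommGroup G]
    {f : X → G} {x : X} (h : ContinuousAt f x) : ∀ᶠ y in 𝓝 x, ‖f y‖ ≤ ‖f x‖ + 1 :=
  h.norm.eventually (eventually_le_nhds (lt_add_one _))

theorem exists_solution_of_quadratic_perturbation {g : ℂ → ℂ} {M : ℂ × ℂ → ℂ →L[ℝ] ℂ →L[ℝ] ℂ}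
    (hg : ∀ᶠ z in 𝓝 0, ContDiffAt ℝ ∞ g z) (hg0 : g 0 = 0) (hg0' : fderiv ℝ g 0 = 0)
    (hM : ContDiff ℝ ∞ M) :
    ∃ χ : ℂ → ℂ, χ 0 = 0 ∧ χ =O[𝓝 0] g ∧
      ∀ᶠ z in 𝓝 0, ContDiffAt ℝ ∞ χ z ∧ g z + χ z + M (z, χ z) (χ z) (χ z) = 0 := by
  have hQ : ContDiff ℝ ∞ fun p : ℂ × ℂ => M p p.2 p.2 :=
    (hM.clm_apply contDiff_snd).clm_apply contDiff_snd
  have hfst : Tendsto (Prod.fst : ℂ × ℂ → ℂ) (𝓝 0) (𝓝 0) := continuous_fst.tendsto 0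
  have hMb : ∀ᶠ p in 𝓝 (0 : ℂ × ℂ), ‖M p‖ ≤ ‖M 0‖ + 1 :=
    eventually_norm_le_add_one hM.continuous.continuousAt
  have hQ0 : HasFDerivAt (fun p : ℂ × ℂ => M p p.2 p.2) (0 : ℂ × ℂ →L[ℝ] ℂ) 0 := by
    refine IsBigO.hasFDerivAt (n := 2) (IsBigO.of_bound (‖M 0‖ + 1) ?_) (by norm_num)
    filter_upwards [hMb] with p hp
    rw [sub_zero, norm_pow, norm_norm]
    calc ‖M p p.2 p.2‖ ≤ ‖M p‖ * ‖p.2‖ * ‖p.2‖ := (M p).le_opNorm₂ _ _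
      _ ≤ (‖M 0‖ + 1) * ‖p‖ * ‖p‖ := by gcongr <;> exact norm_snd_le p
      _ = _ := by ring
  have hg' : HasFDerivAt g (0 : ℂ →L[ℝ] ℂ) 0 := by
    rw [← hg0']; exact (hg.self_of_nhds.differentiableAt (by norm_num)).hasFDerivAt
  have hd : HasFDerivAt (fun p : ℂ × ℂ => g p.1 + p.2 + M p p.2 p.2)
      ((0 : ℂ →L[ℝ] ℂ).comp (ContinuousLinearMap.fst ℝ ℂ ℂ) + ContinuousLinearMap.snd ℝ ℂ ℂ + 0)
      0 :=
    ((HasFDerivAt.comp (0 : ℂ × ℂ) (f := Prod.fst) (g := g) hg' hasFDerivAt_fst).fun_add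
      hasFDerivAt_snd).fun_add hQ0
  obtain ⟨χ, hχ0, hχ⟩ := exists_smooth_implicit (Φ := fun p : ℂ × ℂ => g p.1 + p.2 + M p p.2 p.2)
    (by
      filter_upwards [hfst.eventually hg] with p hp
      exact ((hp.comp p contDiffAt_fst).add contDiffAt_snd).add hQ.contDiffAt)
    (by simp [hg0]) (fun w => by rw [hd.fderiv]; simp)
  refine ⟨χ, hχ0, ?_, hχ⟩
  have hχc : ContinuousAt χ 0 := hχ.self_of_nhds.1.continuousAt
  have hcp : Tendsto (fun z => (z, χ z)) (𝓝 0) (𝓝 0) := by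
    have h : ContinuousAt (fun z => (z, χ z)) 0 := continuousAt_id.prodMk hχc
    have h' := h.tendsto
    rwa [hχ0, Prod.mk_zero_zero] at h'
  have hsmall : ∀ᶠ z in 𝓝 0, (‖M 0‖ + 1) * ‖χ z‖ ≤ 1 / 2 := by
    have h : Tendsto (fun z => (‖M 0‖ + 1) * ‖χ z‖) (𝓝 0) (𝓝 ((‖M 0‖ + 1) * ‖χ 0‖)) :=
      (hχc.norm.const_mul _ :)
    rw [hχ0, norm_zero, mul_zero] at h
    exact h.eventually (eventually_le_nhds (by norm_num))
  refine IsBigO.of_bound 2 ?_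
  filter_upwards [hχ, hcp.eventually hMb, hsmall] with z ⟨_, h1⟩ h2 h3
  have h4 : χ z = -(g z + M (z, χ z) (χ z) (χ z)) := by linear_combination h1
  have h5 : ‖M (z, χ z) (χ z) (χ z)‖ ≤ 1 / 2 * ‖χ z‖ :=
    calc _ ≤ ‖M (z, χ z)‖ * ‖χ z‖ * ‖χ z‖ := (M (z, χ z)).le_opNorm₂ _ _
      _ ≤ (‖M 0‖ + 1) * ‖χ z‖ * ‖χ z‖ := by gcongr
      _ ≤ 1 / 2 * ‖χ z‖ := by gcongr
  have h6 : ‖χ z‖ ≤ ‖g z‖ + ‖M (z, χ z) (χ z) (χ z)‖ := by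
    conv_lhs => rw [h4, norm_neg]
    exact norm_add_le _ _
  linarith

/-- The adjugate of a real-linear endomorphism of `ℂ`. -/
theorem exists_contDiff_adjugate {A : ℂ → ℂ →L[ℝ] ℂ} {c : ℂ} {m : ℕ} (hA : ContDiff ℝ ∞ A)
    (hc : c ≠ 0) (hAO : (fun z => A z - (c * z ^ m) • (1 : ℂ →L[ℝ] ℂ)) =O[𝓝 0]
      fun z => ‖z‖ ^ (m + 1)) :
    ∃ (d : ℂ → ℝ) (B : ℂ → ℂ →L[ℝ] ℂ) (c' r : ℝ), ContDiff ℝ ∞ d ∧ ContDiff ℝ ∞ B ∧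
      (∀ z w, A z (B z w) = d z • w) ∧ 0 < c' ∧ 0 < r ∧
      ∀ z ∈ ball (0 : ℂ) r, c' * ‖z‖ ^ (2 * m) ≤ |d z| := by
  set α : ℂ → ℂ := fun z => (A z 1 - I * A z I) / 2 with hα
  set β : ℂ → ℂ := fun z => (A z 1 + I * A z I) / 2 with hβ
  have hA1 : ContDiff ℝ ∞ fun z => A z 1 := hA.clm_apply contDiff_const
  have hAI : ContDiff ℝ ∞ fun z => I * A z I :=
    contDiff_const.mul (hA.clm_apply contDiff_const)
  have hαs : ContDiff ℝ ∞ α := (hA1.sub hAI).div_const 2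
  have hβs : ContDiff ℝ ∞ β := (hA1.add hAI).div_const 2
  have hAw : ∀ z w, A z w = α z * w + β z * (starRingEnd ℂ) w := fun z w => by
    have h1 : w = w.re • (1 : ℂ) + w.im • I := by
      simp [Complex.re_add_im]
    have h2 : A z w = w.re * A z 1 + w.im * A z I := by
      conv_lhs => rw [h1]
      rw [map_add, map_smul, map_smul, real_smul, real_smul]
    rw [h2, hα, hβ]
    apply Complex.ext <;> simp <;> ring
  refine ⟨fun z => normSq (α z) - normSq (β z), fun z =>
    (starRingEnd ℂ (α z)) • (1 : ℂ →L[ℝ] ℂ) - β z • (conjCLE : ℂ →L[ℝ] ℂ), ?_⟩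
  obtain ⟨K, hK⟩ := hAO.bound
  have hKs : ∀ᶠ z : ℂ in 𝓝 0, |K| * ‖z‖ ≤ ‖c‖ / 4 := by
    have h : Tendsto (fun z : ℂ => |K| * ‖z‖) (𝓝 0) (𝓝 (|K| * ‖(0 : ℂ)‖)) :=
      (continuous_const.mul continuous_norm).tendsto 0
    rw [norm_zero, mul_zero] at h
    exact h.eventually (eventually_le_nhds (by have := norm_pos_iff.2 hc; positivity))
  obtain ⟨r, hr, hball⟩ := Metric.eventually_nhds_iff_ball.1 (hK.and hKs)
  have hc0 := norm_pos_iff.2 hc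
  refine ⟨‖c‖ ^ 2 / 2, r, ?_, ?_, ?_, by positivity, hr, ?_⟩
  · have hn : ContDiff ℝ ∞ fun z : ℂ => normSq z := by
      simp only [normSq_apply]
      exact (reCLM.contDiff.mul reCLM.contDiff).add (imCLM.contDiff.mul imCLM.contDiff)
    exact (hn.comp hαs).sub (hn.comp hβs)
  · exact ((conjCLE.contDiff.comp hαs).smul contDiff_const).sub (hβs.smul contDiff_const)
  · intro z w
    rw [hAw]
    simp only [sub_apply, smul_apply, one_apply_eq_self, smul_eq_mul,
      ContinuousLinearEquiv.coe_coe, conjCLE_apply, map_sub, map_mul, conj_conj, real_smul,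
      ofReal_sub, normSq_eq_conj_mul_self]
    ring
  · intro z hz
    obtain ⟨h1, h2⟩ := hball z hz
    rw [norm_pow, norm_norm] at h1
    set D := A z - (c * z ^ m) • (1 : ℂ →L[ℝ] ℂ) with hD
    have h3 : ‖D‖ ≤ ‖c‖ / 4 * ‖z‖ ^ m := by
      calc ‖D‖ ≤ K * ‖z‖ ^ (m + 1) := h1
        _ ≤ |K| * ‖z‖ ^ (m + 1) := by gcongr; exact le_abs_self K
        _ = |K| * ‖z‖ * ‖z‖ ^ m := by ring
        _ ≤ _ := by gcongr
    have hD1 : ‖D 1‖ ≤ ‖D‖ := by simpa using D.le_opNorm 1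
    have hDI : ‖I * D I‖ ≤ ‖D‖ := by simpa using D.le_opNorm I
    have h4 : α z = c * z ^ m + (D 1 - I * D I) / 2 := by
      simp only [hα, hD, sub_apply, smul_apply, one_apply_eq_self, smul_eq_mul]
      linear_combination (-c * z ^ m / 2) * I_mul_I
    have h5 : β z = (D 1 + I * D I) / 2 := by
      simp only [hβ, hD, sub_apply, smul_apply, one_apply_eq_self, smul_eq_mul]
      linear_combination (c * z ^ m / 2) * I_mul_I
    have h6 : ‖β z‖ ≤ ‖c‖ / 4 * ‖z‖ ^ m := by
      rw [h5, norm_div, RCLike.norm_ofNat]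
      linarith [norm_add_le (D 1) (I * D I)]
    have h7 : 3 / 4 * ‖c‖ * ‖z‖ ^ m ≤ ‖α z‖ := by
      have h8 : ‖c * z ^ m‖ ≤ ‖α z‖ + ‖(D 1 - I * D I) / 2‖ := by
        have : c * z ^ m = α z - (D 1 - I * D I) / 2 := by rw [h4]; ring
        rw [this]; exact norm_sub_le _ _
      rw [norm_div (D 1 - I * D I), RCLike.norm_ofNat, norm_mul, norm_pow] at h8
      linarith [norm_sub_le (D 1) (I * D I)]
    refine le_trans ?_ (le_abs_self _)
    simp only [normSq_eq_norm_sq]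
    have h9 : (3 / 4 * ‖c‖ * ‖z‖ ^ m) ^ 2 ≤ ‖α z‖ ^ 2 := by gcongr
    have h10 : ‖β z‖ ^ 2 ≤ (‖c‖ / 4 * ‖z‖ ^ m) ^ 2 := by gcongr
    rw [mul_comm 2 m, pow_mul]
    linarith

end Reparametrization

section Reparametrization

variable {E : Type*} [NormedAddCommGroup E] [NormedSpace ℝ E]

theorem contDiff_one_sub_smul {P : Type*} [NormedAddCommGroup P] [NormedSpace ℝ P]
    {F : P × ℝ → E} (hF : ContDiff ℝ ∞ F) : ContDiff ℝ ∞ fun q => (1 - q.2) • F q :=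
  (contDiff_const.sub contDiff_snd).smul hF

theorem exists_contDiff_taylor_remainder [CompleteSpace E] {v : ℂ → E} (hv : ContDiff ℝ ∞ v) :
    ∃ R : ℂ × ℂ → ℂ →L[ℝ] ℂ →L[ℝ] E, ContDiff ℝ ∞ R ∧
      ∀ z η, v (z + η) = v z + fderiv ℝ v z η + R (z, η) η η := by
  have hv' : ContDiff ℝ ∞ (fderiv ℝ v) := hv.fderiv_right (m := ∞) le_rfl
  have hv'' : ContDiff ℝ ∞ (fderiv ℝ (fderiv ℝ v)) := hv'.fderiv_right (m := ∞) le_rfl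
  refine ⟨fun q => ∫ t in (0 : ℝ)..1, (1 - t) • fderiv ℝ (fderiv ℝ v) (q.1 + t • q.2), ?_,
    fun z η => taylor_two_integral_remainder (hv.of_le ENat.LEInfty.out) z η⟩
  refine contDiff_intervalIntegral_param
    (Φ := fun (q : ℂ × ℂ) t => (1 - t) • fderiv ℝ (fderiv ℝ v) (q.1 + t • q.2)) ?_
  exact contDiff_one_sub_smul (hv''.comp
    ((contDiff_fst.comp contDiff_fst).add (contDiff_snd.smul (contDiff_snd.comp contDiff_fst))))

theorem exists_projected_reparametrization [CompleteSpace E] {u v : ℂ → E} {p : ℂ → E →L[ℝ] ℂ}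
    {c : ℂ} {m : ℕ} (hu : ContDiff ℝ ∞ u) (hv : ContDiff ℝ ∞ v) (hp : ContDiff ℝ ∞ p)
    (hflat : ∀ n, JetVanishes n fun z => v z - u z) (hc : c ≠ 0)
    (hA : (fun z => (p z).comp (fderiv ℝ v z) - (c * z ^ m) • (1 : ℂ →L[ℝ] ℂ)) =O[𝓝 0]
      fun z => ‖z‖ ^ (m + 1)) :
    ∃ φ : ℂ → ℂ, ContDiff ℝ ∞ φ ∧ (∀ N : ℕ, (fun z => φ z - z) =O[𝓝 0] fun z => ‖z‖ ^ N) ∧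
      ∀ᶠ z in 𝓝 0, p z (v (φ z)) = p z (u z) := by
  have hv' : ContDiff ℝ ∞ (fderiv ℝ v) := hv.fderiv_right (m := ∞) le_rfl
  obtain ⟨d, B, c', r, hd, hB, hAB, hc', hr, hlow⟩ :=
    exists_contDiff_adjugate (hp.clm_comp hv') hc hA
  obtain ⟨R, hR, hvR⟩ := exists_contDiff_taylor_remainder hv
  set f : ℂ → ℂ := fun z => p z (v z - u z) with hf
  have hfs : ContDiff ℝ ∞ f := hp.clm_apply (hv.sub hu)
  have hff : ∀ n, JetVanishes n f := fun n => by
    have := JetVanishes.bilinear hp (hv.sub hu) (JetVanishes.zero p) (hflat n)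
      (ContinuousLinearMap.id ℝ (E →L[ℝ] ℂ))
    rwa [zero_add] at this
  set g : ℂ → ℂ := fun z => (d z ^ 2)⁻¹ • f z with hg
  have hgs : ContDiffOn ℝ ∞ g (ball 0 r) := contDiffOn_infty.2 fun n =>
    contDiffOn_inv_pow_smul_of_flat hr hc' hlow hd hfs hff 2 n
  have hgd := hasFDerivAt_inv_pow_smul_of_flat hr hc' hlow hd hfs hff 2 (mem_ball_self hr)
  set η : ℂ × ℂ → ℂ := fun q => d q.1 • B q.1 q.2 with hη
  have hB1 : ContDiff ℝ ∞ fun q : ℂ × ℂ => B q.1 := hB.comp contDiff_fst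
  have hηs : ContDiff ℝ ∞ η := (hd.comp contDiff_fst).smul (hB1.clm_apply contDiff_snd)
  set M : ℂ × ℂ → ℂ →L[ℝ] ℂ →L[ℝ] ℂ := fun q =>
    (ContinuousLinearMap.compL ℝ ℂ E ℂ (p q.1)).comp
      (((ContinuousLinearMap.compL ℝ ℂ ℂ E).flip (B q.1)).comp
        ((R (q.1, η q)).comp (B q.1))) with hM
  have hRB : ContDiff ℝ ∞ fun q : ℂ × ℂ => (R (q.1, η q)).comp (B q.1) :=
    (hR.comp (contDiff_fst.prodMk hηs)).clm_comp hB1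
  have hBc : ContDiff ℝ ∞ fun q : ℂ × ℂ => (ContinuousLinearMap.compL ℝ ℂ ℂ E).flip (B q.1) :=
    contDiff_const.clm_apply hB1
  have hpc : ContDiff ℝ ∞ fun q : ℂ × ℂ => ContinuousLinearMap.compL ℝ ℂ E ℂ (p q.1) :=
    contDiff_const.clm_apply (hp.comp contDiff_fst)
  have hMs : ContDiff ℝ ∞ M := hpc.clm_comp (hBc.clm_comp hRB)
  obtain ⟨χ, -, hχg, hχ⟩ := exists_solution_of_quadratic_perturbation (g := g) (M := M)
    (by filter_upwards [ball_mem_nhds (0 : ℂ) hr] with z hz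
        exact hgs.contDiffAt (isOpen_ball.mem_nhds hz))
    (by simp [hg, (hff 1).apply_zero])
    (by rw [hgd.fderiv, (hff 1).apply_zero, (hff 2).fderiv.apply_zero]; ext; simp)
    hMs
  have hφ₀ : ∀ᶠ z in 𝓝 0, ContDiffAt ℝ ∞ (fun z => z + d z • B z (χ z)) z := by
    filter_upwards [hχ] with z hz
    exact contDiffAt_id.add (hd.contDiffAt.smul (hB.contDiffAt.clm_apply hz.1))
  obtain ⟨φ, hφs, hφ⟩ := exists_contDiff_eventuallyEq hφ₀
  refine ⟨φ, hφs, fun N => ?_, ?_⟩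
  · have h1 : (fun z => d z • B z (χ z)) =O[𝓝 0] χ := by
      refine IsBigO.of_bound ((‖d 0‖ + 1) * (‖B 0‖ + 1)) ?_
      filter_upwards [eventually_norm_le_add_one (hd.continuous.continuousAt (x := 0)),
        eventually_norm_le_add_one (hB.continuous.continuousAt (x := 0))] with z h2 h3
      rw [norm_smul, mul_assoc]
      gcongr
      exact (B z).le_of_opNorm_le h3 _
    refine ((h1.trans hχg).trans
      (isBigO_inv_pow_smul_of_flat hr hc' hlow hfs hff 2 N)).congr' ?_ EventuallyEq.rfl
    filter_upwards [hφ] with z hz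
    rw [hz]; ring
  · filter_upwards [hφ, hχ, ball_mem_nhds (0 : ℂ) hr] with z h1 h2 hz
    have h3 : f z = d z ^ 2 • g z := by
      rcases eq_or_ne (d z) 0 with h | h
      · have h4 : z = 0 := by
          have := hlow z hz
          rw [h, abs_zero] at this
          by_contra h0
          have := norm_pos_iff.2 h0
          have : 0 < c' * ‖z‖ ^ (2 * m) := by positivity
          linarith
        rw [h4, (hff 1).apply_zero]
        simp [hg, (hff 1).apply_zero]
      · rw [hg, smul_smul, mul_inv_cancel₀ (pow_ne_zero 2 h), one_smul]
    have h4 : p z (v z) = p z (u z) + f z := by simp [hf]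
    have h5 := hAB z (χ z)
    rw [ContinuousLinearMap.comp_apply] at h5
    have h6 : M (z, χ z) (χ z) (χ z) =
        p z (R (z, d z • B z (χ z)) (B z (χ z)) (B z (χ z))) := rfl
    rw [h1, hvR, map_add, map_add, map_smul, map_smul, h5, h4, h3]
    simp only [map_smul, smul_apply]
    rw [← h6]
    simp only [real_smul]
    push_cast
    linear_combination (d z : ℂ) ^ 2 * h2.2

end Reparametrization

section LocalTheorem

variable {E : Type*} [NormedAddCommGroup E] [InnerProductSpace ℝ E]

/-- If `U` is holomorphic for `(j, Ju)` and `W` is holomorphic for `Jw` and some other complex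
structure on the domain, then a bound on a transverse projection of `U - W` controls its full
Cauchy-Riemann defect. -/
theorem norm_cauchyRiemann_defect_le {p : E →L[ℝ] ℂ} {Dp : ℂ →L[ℝ] E →L[ℝ] ℂ}
    {U W : ℂ →L[ℝ] E} {Ju Jw : E →L[ℝ] E} {j : ℂ →L[ℝ] ℂ} {h : E}
    {a γ K₁ K₂ K₃ K₄ K₅ K₆ : ℝ} (hγ : 0 < γ) (hK₁ : 0 ≤ K₁) (hK₄ : 0 ≤ K₄)
    (hpJ : ∀ x, p (Ju x) = I * p x) (hU : ∀ x, U (j x) = Ju (U x))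
    (hW : ∀ x, ∃ y, W y = Jw (W x)) (hp : ∀ x, p (U x - W x) + Dp x h = 0)
    (hDp : ‖Dp‖ ≤ K₁) (hpn : ‖p‖ ≤ K₂) (hJ : ‖Ju - Jw‖ ≤ K₃ * ‖h‖) (hWa : ‖W‖ ≤ K₄ * a)
    (hWn : ‖W‖ ≤ K₅) (hj : ‖j‖ ≤ K₆) (hlow : ∀ x, γ * a * ‖x‖ ≤ ‖p (U x)‖)
    (hsmall : K₁ * ‖h‖ ≤ γ / 2 * a) (x : ℂ) :
    ‖(U - W) (j x) - Ju ((U - W) x)‖ ≤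
      (K₄ * (2 / γ * (K₁ * K₆ + K₁ + K₂ * K₃ * K₅)) + K₃ * K₅) * ‖h‖ * ‖x‖ := by
  obtain ⟨y, hy⟩ := hW x
  have hK₂ : 0 ≤ K₂ := (norm_nonneg _).trans hpn
  have hK₅ : 0 ≤ K₅ := (norm_nonneg _).trans hWn
  have hDpx : ∀ x, ‖Dp x h‖ ≤ K₁ * ‖x‖ * ‖h‖ := fun x =>
    (Dp.le_opNorm₂ x h).trans (by gcongr)
  have hJx : ‖(Ju - Jw) (W x)‖ ≤ K₃ * ‖h‖ * (K₅ * ‖x‖) := by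
    refine ((Ju - Jw).le_opNorm _).trans ?_
    gcongr
    · exact (norm_nonneg _).trans hJ
    · exact W.le_of_opNorm_le hWn x
  set k := j x - y with hk
  have h1 : p (W k) = Dp (j x) h - I * Dp x h + p ((Ju - Jw) (W x)) := by
    have e1 := hp (j x)
    have e2 := hp x
    have e3 := hpJ (W x)
    rw [map_sub] at e1 e2
    rw [hU, hpJ] at e1
    rw [hk, map_sub, map_sub, hy, sub_apply, map_sub, e3]
    linear_combination -e1 + I * e2
  have h2 : ‖p (W k)‖ ≤ (K₁ * K₆ + K₁ + K₂ * K₃ * K₅) * ‖h‖ * ‖x‖ := by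
    rw [h1]
    have e1 : ‖Dp (j x) h‖ ≤ K₁ * (K₆ * ‖x‖) * ‖h‖ := (hDpx _).trans (by
      gcongr; exact j.le_of_opNorm_le hj x)
    have e2 : ‖I * Dp x h‖ ≤ K₁ * ‖x‖ * ‖h‖ := by
      rw [norm_mul, norm_I, one_mul]; exact hDpx x
    have e3 : ‖p ((Ju - Jw) (W x))‖ ≤ K₂ * (K₃ * ‖h‖ * (K₅ * ‖x‖)) :=
      (p.le_opNorm _).trans (by gcongr)
    calc _ ≤ ‖Dp (j x) h‖ + ‖I * Dp x h‖ + ‖p ((Ju - Jw) (W x))‖ :=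
          (norm_add_le _ _).trans (by gcongr; exact norm_sub_le _ _)
      _ ≤ K₁ * (K₆ * ‖x‖) * ‖h‖ + K₁ * ‖x‖ * ‖h‖ + K₂ * (K₃ * ‖h‖ * (K₅ * ‖x‖)) := by gcongr
      _ = _ := by ring
  have h3 : a * ‖k‖ ≤ 2 / γ * ((K₁ * K₆ + K₁ + K₂ * K₃ * K₅) * ‖h‖ * ‖x‖) := by
    have e1 : p (U k) = p (W k) - Dp k h := by
      have := hp k
      rw [map_sub] at this
      linear_combination this
    have e2 : ‖p (U k)‖ ≤ ‖p (W k)‖ + ‖Dp k h‖ := e1 ▸ norm_sub_le _ _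
    have e3 : K₁ * ‖k‖ * ‖h‖ ≤ γ / 2 * a * ‖k‖ := by
      nlinarith [mul_le_mul_of_nonneg_right hsmall (norm_nonneg k)]
    have e4 := hlow k
    have e5 := hDpx k
    rw [div_mul_eq_mul_div, le_div_iff₀ hγ]
    nlinarith
  have h4 : (U - W) (j x) - Ju ((U - W) x) = (Ju - Jw) (W x) - W k := by
    simp only [hk, sub_apply, map_sub, hU, hy]
    abel
  rw [h4]
  have hWk : ‖W k‖ ≤ K₄ * (a * ‖k‖) := (W.le_of_opNorm_le hWa k).trans (by rw [mul_assoc])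
  calc _ ≤ K₃ * ‖h‖ * (K₅ * ‖x‖) +
        K₄ * (2 / γ * ((K₁ * K₆ + K₁ + K₂ * K₃ * K₅) * ‖h‖ * ‖x‖)) :=
        (norm_sub_le _ _).trans (add_le_add hJx (hWk.trans (by gcongr)))
    _ = _ := by ring

end LocalTheorem

section LocalTheorem

variable {E : Type*} [NormedAddCommGroup E]

theorem eventually_mul_norm_le (K : ℝ) {ε : ℝ} (hε : 0 < ε) : ∀ᶠ z : ℂ in 𝓝 0, K * ‖z‖ ≤ ε := by
  have h : Tendsto (fun z : ℂ => K * ‖z‖) (𝓝 0) (𝓝 (K * ‖(0 : ℂ)‖)) :=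
    (continuous_const.mul continuous_norm).tendsto 0
  rw [norm_zero, mul_zero] at h
  exact h.eventually (eventually_le_nhds hε)

theorem isBigO_comp_sub_comp {X Y : Type*} [NormedAddCommGroup X] [NormedSpace ℝ X]
    [NormedAddCommGroup Y] [NormedSpace ℝ Y] {F : X → Y} (hF : ContDiff ℝ ∞ F) {a b : ℂ → X}
    {x : X} (ha : Tendsto a (𝓝 0) (𝓝 x)) (hb : Tendsto b (𝓝 0) (𝓝 x)) :
    (fun z => F (a z) - F (b z)) =O[𝓝 0] fun z => a z - b z :=
  (hF.contDiffAt.hasStrictFDerivAt (by norm_num)).isBigO_sub.comp_tendsto (ha.prodMk_nhds hb)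

theorem eventually_surjective_fderiv {φ : ℂ → ℂ} (hφ : ContDiff ℝ ∞ φ)
    (hφ' : HasFDerivAt φ (1 : ℂ →L[ℝ] ℂ) 0) :
    ∀ᶠ z in 𝓝 0, Function.Bijective (fderiv ℝ φ z) := by
  have hc : ContinuousAt (fderiv ℝ φ) 0 := (hφ.continuous_fderiv (by norm_num)).continuousAt
  have h1 : ∀ᶠ z in 𝓝 (0 : ℂ), fderiv ℝ φ z ∈
      range ((↑) : (ℂ ≃L[ℝ] ℂ) → (ℂ →L[ℝ] ℂ)) :=
    hc.eventually (by
      rw [hφ'.fderiv]; exact ContinuousLinearEquiv.nhds (ContinuousLinearEquiv.refl ℝ ℂ))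
  filter_upwards [h1] with z ⟨e, he⟩
  rw [← he]
  exact e.bijective

variable [InnerProductSpace ℝ E]

theorem exists_local_reparametrization [CompleteSpace E] {u v : ℂ → E} {J : E → E →L[ℝ] E}
    {j₁ j₂ : ℂ → ℂ →L[ℝ] ℂ} (hu : ContDiff ℝ ∞ u) (hv : ContDiff ℝ ∞ v) (hJ : ContDiff ℝ ∞ J)
    (hJsq : ∀ x y, J x (J x y) = -y) (hj₁ : ContDiff ℝ ∞ j₁) (hj0 : ∀ w, j₁ 0 w = I * w)
    (huCR : ∀ᶠ z in 𝓝 0, ∀ w, fderiv ℝ u z (j₁ z w) = J (u z) (fderiv ℝ u z w))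
    (hvCR : ∀ᶠ z in 𝓝 0, ∀ w, fderiv ℝ v z (j₂ z w) = J (v z) (fderiv ℝ v z w))
    (hu0 : u 0 = 0) (hflat : ∀ n, JetVanishes n fun z => v z - u z)
    (hnf : ¬ ∀ n, JetVanishes n u) :
    ∃ φ : ℂ → ℂ, ContDiff ℝ ∞ φ ∧ φ 0 = 0 ∧ HasFDerivAt φ (1 : ℂ →L[ℝ] ℂ) 0 ∧
      ∀ᶠ z in 𝓝 0, u z = v (φ z) := by
  obtain ⟨m, c, p, hc, hp, hpJ, hDu, hA⟩ :=
    exists_leading_projection hu hJ hJsq hj₁ hj0 huCR hu0 hnf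
  have hu' : ContDiff ℝ ∞ (fderiv ℝ u) := hu.fderiv_right (m := ∞) le_rfl
  have hv' : ContDiff ℝ ∞ (fderiv ℝ v) := hv.fderiv_right (m := ∞) le_rfl
  have hDflat : ∀ n, JetVanishes n fun z => fderiv ℝ v z - fderiv ℝ u z := fun n =>
    (hflat (n + 1)).fderiv.congr (Eventually.of_forall fun z =>
      fderiv_fun_sub (hv.differentiable (by norm_num) z) (hu.differentiable (by norm_num) z))
  have hDv : JetVanishes m (fderiv ℝ v) := by
    have := JetVanishes.add (hv'.sub hu') hu' (hDflat m) hDu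
    simpa using this
  have hAv : (fun z => (p z).comp (fderiv ℝ v z) - (c * z ^ m) • (1 : ℂ →L[ℝ] ℂ)) =O[𝓝 0]
      fun z => ‖z‖ ^ (m + 1) := by
    have h1 : JetVanishes (0 + (m + 1)) fun z => (p z).comp (fderiv ℝ v z - fderiv ℝ u z) :=
      JetVanishes.bilinear hp (hv'.sub hu') (JetVanishes.zero p) (hDflat (m + 1))
        (ContinuousLinearMap.compL ℝ ℂ E ℂ)
    rw [zero_add] at h1
    refine (hA.add (h1.isBigO (hp.clm_comp (hv'.sub hu')))).congr_left fun z => ?_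
    rw [ContinuousLinearMap.comp_sub]
    abel
  obtain ⟨φ, hφ, hφO, hpφ⟩ := exists_projected_reparametrization hu hv hp hflat hc hAv
  have hφ0 : φ 0 = 0 := by
    have h := (hφO 1).eq_zero_imp.self_of_nhds
    simpa using h
  have hφ1 : HasFDerivAt φ (1 : ℂ →L[ℝ] ℂ) 0 := by
    have h1 : HasFDerivAt (fun z => φ z - z) (0 : ℂ →L[ℝ] ℂ) 0 :=
      IsBigO.hasFDerivAt (n := 2) (by simpa using hφO 2) (by norm_num)
    have h2 := h1.fun_add (hasFDerivAt_id (𝕜 := ℝ) (0 : ℂ))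
    simpa [ContinuousLinearMap.one_def] using h2
  refine ⟨φ, hφ, hφ0, hφ1, ?_⟩
  have hφt : Tendsto φ (𝓝 0) (𝓝 0) := by simpa [hφ0] using hφ.continuous.tendsto 0
  set w : ℂ → E := fun z => v (φ z) with hw
  have hws : ContDiff ℝ ∞ w := hv.comp hφ
  have hwd : ∀ z, fderiv ℝ w z = (fderiv ℝ v (φ z)).comp (fderiv ℝ φ z) := fun z =>
    ((hv.differentiable (by norm_num) (φ z)).hasFDerivAt.comp z
      (hφ.differentiable (by norm_num) z).hasFDerivAt).fderiv
  set h : ℂ → E := fun z => u z - w z with hh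
  have hhs : ContDiff ℝ ∞ h := hu.sub hws
  have hhd : ∀ z, fderiv ℝ h z = fderiv ℝ u z - fderiv ℝ w z := fun z =>
    fderiv_fun_sub (hu.differentiable (by norm_num) z) (hws.differentiable (by norm_num) z)
  have hhflat : ∀ N : ℕ, h =O[𝓝 0] fun z => ‖z‖ ^ N := fun N => by
    have h1 := ((hflat N).isBigO (hv.sub hu)).neg_left
    have h2 : (fun z => v z - v (φ z)) =O[𝓝 0] fun z => z - φ z :=
      isBigO_comp_sub_comp hv (a := fun z => z) tendsto_id hφt
    have h3 := h2.trans ((hφO N).neg_left.congr_left (f₂ := fun z => z - φ z) fun z => by ring)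
    refine (h1.add h3).congr_left fun z => ?_
    simp only [hh, hw]
    abel
  have hph : ∀ᶠ z in 𝓝 0, p z (h z) = 0 := by
    filter_upwards [hpφ] with z hz
    simp only [hh, hw, map_sub, hz, sub_self]
  have hpDh : ∀ᶠ z in 𝓝 0, ∀ x,
      p z (fderiv ℝ u z x - fderiv ℝ w z x) + fderiv ℝ p z x (h z) = 0 := by
    filter_upwards [hph.eventually_nhds] with z hz x
    have h1 := (hp.differentiable (by norm_num) z).hasFDerivAt.clm_apply
      (hhs.differentiable (by norm_num) z).hasFDerivAt
    have h2 : HasFDerivAt (fun z => p z (h z)) (0 : ℂ →L[ℝ] ℂ) z :=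
      (hasFDerivAt_const (0 : ℂ) z).congr_of_eventuallyEq hz
    have h3 := congrArg (fun L => L x) (h1.unique h2)
    simpa [hhd] using h3
  have hφbig : φ =O[𝓝 0] fun z => ‖z‖ := by
    have h1 : (fun z : ℂ => z) =O[𝓝 0] fun z => ‖z‖ := (isBigO_refl _ _).norm_right
    refine (((hφO 1).congr_right fun z => pow_one _).add h1).congr_left fun z => by ring
  have hDw : fderiv ℝ w =O[𝓝 0] fun z => ‖z‖ ^ m := by
    have h1 : (fun z => fderiv ℝ v (φ z)) =O[𝓝 0] fun z => ‖φ z‖ ^ m :=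
      (hDv.isBigO hv').comp_tendsto hφt
    have h2 := h1.trans (hφbig.norm_left.pow m)
    refine IsBigO.trans (IsBigO.of_bound (‖fderiv ℝ φ 0‖ + 1) ?_) h2
    filter_upwards [eventually_norm_le_add_one
      (hφ.continuous_fderiv (by norm_num)).continuousAt] with z hz
    rw [hwd, mul_comm]
    exact (ContinuousLinearMap.opNorm_comp_le _ _).trans (by gcongr)
  obtain ⟨K₃, hK₃⟩ := (isBigO_comp_sub_comp hJ
    (by simpa [hu0] using hu.continuous.tendsto 0 : Tendsto u (𝓝 0) (𝓝 0))
    (by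
      have h1 := hws.continuous.tendsto 0
      have h2 := (hhflat 1).eq_zero_imp.self_of_nhds
      have h3 : w 0 = 0 := by simpa [hh, hu0] using h2
      rwa [h3] at h1 : Tendsto w (𝓝 0) (𝓝 0))).bound
  obtain ⟨K₄, hK₄, hDwK⟩ := hDw.exists_pos
  obtain ⟨KA, hKA⟩ := hA.bound
  obtain ⟨Kh, hKh⟩ := (hhflat (m + 1)).bound
  have hc0 := norm_pos_iff.2 hc
  set K₁ := ‖fderiv ℝ p 0‖ + 1 with hK₁
  set K₂ := ‖p 0‖ + 1 with hK₂
  set K₅ := ‖fderiv ℝ w 0‖ + 1 with hK₅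
  set K₆ := ‖j₁ 0‖ + 1 with hK₆
  have hfin := eventually_eq_zero_of_flat (h := h) (J := fun z => J (u z)) (j := j₁)
    (C := K₄ * (2 / (‖c‖ / 2) * (K₁ * K₆ + K₁ + K₂ * K₃ * K₅)) + K₃ * K₅) (z₀ := 0)
    (hhs.of_le ENat.LEInfty.out) ((hJ.comp hu).of_le ENat.LEInfty.out) (fun z => hJsq (u z))
    (hj₁.of_le ENat.LEInfty.out) (fun w => by simp [hj0, ← mul_assoc]) ?_ (by simpa using hhflat)
  · filter_upwards [hfin] with z hz
    exact sub_eq_zero.1 hz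
  filter_upwards [huCR, hφt.eventually hvCR, hpDh, hK₃, hDwK.bound, hKA, hKh,
    eventually_surjective_fderiv hφ hφ1,
    eventually_norm_le_add_one (hp.continuous_fderiv (by norm_num)).continuousAt,
    eventually_norm_le_add_one (hp.continuous.continuousAt (x := 0)),
    eventually_norm_le_add_one (hws.continuous_fderiv (by norm_num)).continuousAt,
    eventually_norm_le_add_one (hj₁.continuous.continuousAt (x := 0)),
    eventually_mul_norm_le KA (half_pos hc0),
    eventually_mul_norm_le (K₁ * Kh) (half_pos (half_pos hc0))]
    with z e1 e2 e3 e4 e5 e6 e7 e8 e9 e10 e11 e12 e13 e14 x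
  rw [norm_pow, norm_norm] at e5 e6 e7
  rw [hhd]
  refine norm_cauchyRiemann_defect_le (a := ‖z‖ ^ m) (half_pos hc0) (by positivity) hK₄.le (hpJ z)
    e1 (Jw := J (w z)) (fun x => ?_) e3 e9 e10 e4 e5 e11 e12 (fun x => ?_) ?_ x
  · obtain ⟨y, hy⟩ := e8.2 (j₂ (φ z) (fderiv ℝ φ z x))
    exact ⟨y, by rw [hwd, ContinuousLinearMap.comp_apply, hy, e2]; rfl⟩
  · set D := (p z).comp (fderiv ℝ u z) - (c * z ^ m) • (1 : ℂ →L[ℝ] ℂ) with hD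
    have f1 : ‖D x‖ ≤ ‖c‖ / 2 * ‖z‖ ^ m * ‖x‖ := by
      refine D.le_of_opNorm_le (e6.trans ?_) x
      calc KA * ‖z‖ ^ (m + 1) = KA * ‖z‖ * ‖z‖ ^ m := by ring
        _ ≤ _ := by gcongr
    have f2 : c * z ^ m * x = p z (fderiv ℝ u z x) - D x := by simp [hD]
    have f3 : ‖c‖ * ‖z‖ ^ m * ‖x‖ ≤ ‖p z (fderiv ℝ u z x)‖ + ‖D x‖ := by
      rw [← norm_pow, ← norm_mul, ← norm_mul, f2]
      exact norm_sub_le _ _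
    linarith
  · calc K₁ * ‖h z‖ ≤ K₁ * (Kh * ‖z‖ ^ (m + 1)) := by gcongr
      _ = K₁ * Kh * ‖z‖ * ‖z‖ ^ m := by ring
      _ ≤ _ := by gcongr

end LocalTheorem

section Main

variable {E : Type*} [NormedAddCommGroup E]

theorem JetVanishes.comp_continuousLinearMap [NormedSpace ℝ E] {k : ℕ} {f : ℂ → E}
    (hf : ContDiff ℝ ∞ f) (h : JetVanishes k f) (L : ℂ →L[ℝ] ℂ) :
    JetVanishes k fun z => f (L z) := fun i hi => by
  have h1 := L.iteratedFDeriv_comp_right hf 0 (i := i) (mod_cast le_top)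
  rw [map_zero, h i hi] at h1
  refine Eq.trans h1 ?_
  ext
  simp

variable [InnerProductSpace ℝ E]

/-- Strong unique continuation for pseudoholomorphic curves at a point with vanishing jet. -/
theorem eventually_eq_zero_of_iteratedFDeriv_eq_zero {u : ℂ → E} {J : E → E →L[ℝ] E}
    {j : ℂ → ℂ →L[ℝ] ℂ} {z₀ : ℂ} (hu : ∀ᶠ z in 𝓝 z₀, ContDiffAt ℝ ∞ u z)
    (hj : ∀ᶠ z in 𝓝 z₀, ContDiffAt ℝ ∞ j z) (hJ : ContDiff ℝ ∞ J)
    (hJsq : ∀ x y, J x (J x y) = -y) (hjsq : ∀ w, j z₀ (j z₀ w) = -w)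
    (hCR : ∀ᶠ z in 𝓝 z₀, ∀ w, fderiv ℝ u z (j z w) = J (u z) (fderiv ℝ u z w))
    (hjet : ∀ k, iteratedFDeriv ℝ k u z₀ = 0) : ∀ᶠ z in 𝓝 z₀, u z = 0 := by
  obtain ⟨g, hg, hgu⟩ := exists_contDiff_eventuallyEq hu
  obtain ⟨i, hi, hij⟩ := exists_contDiff_eventuallyEq hj
  have hflat : ∀ N : ℕ, g =O[𝓝 z₀] fun z => ‖z - z₀‖ ^ N := fun N => by
    have h1 : JetVanishes N fun z => g (z₀ + z) := fun k _ => by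
      rw [iteratedFDeriv_comp_add_left, add_zero, (hgu.iteratedFDeriv ℝ k).eq_of_nhds, hjet]
    have h2 := h1.isBigO (hg.comp (contDiff_const.add contDiff_id))
    have h3 : Tendsto (fun z => z - z₀) (𝓝 z₀) (𝓝 0) := by
      have : Continuous fun z => z - z₀ := by fun_prop
      simpa using this.tendsto z₀
    simpa [Function.comp_def] using h2.comp_tendsto h3
  have h0 := eventually_eq_zero_of_flat (h := g) (J := fun z => J (g z)) (j := i) (C := 0)
    (hg.of_le ENat.LEInfty.out) ((hJ.comp hg).of_le ENat.LEInfty.out) (fun z => hJsq (g z))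
    (hi.of_le ENat.LEInfty.out) (by rw [hij.eq_of_nhds]; exact hjsq)
    (by
      filter_upwards [hCR, hgu, hij, hgu.fderiv (𝕜 := ℝ)] with z h1 h2 h3 h4 w
      rw [h2, h3, h4, h1, sub_self]
      simp)
    hflat
  filter_upwards [h0, hgu] with z h1 h2
  rw [← h2, h1]

theorem eq_zero_of_iteratedFDeriv_eq_zero {u : ℂ → E} {J : E → E →L[ℝ] E}
    {j : ℂ → ℂ →L[ℝ] ℂ} {s : Set ℂ} {z₀ : ℂ} (hs : IsOpen s) (hs' : IsPreconnected s) (hz₀ : z₀ ∈ s)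
    (hu : ContDiffOn ℝ ∞ u s) (hj : ContDiffOn ℝ ∞ j s) (hJ : ContDiff ℝ ∞ J)
    (hJsq : ∀ x y, J x (J x y) = -y) (hjsq : ∀ z ∈ s, ∀ w, j z (j z w) = -w)
    (hCR : ∀ z ∈ s, ∀ w, fderiv ℝ u z (j z w) = J (u z) (fderiv ℝ u z w))
    (hjet : ∀ k, iteratedFDeriv ℝ k u z₀ = 0) {z : ℂ} (hz : z ∈ s) : u z = 0 := by
  have key : ∀ z ∈ s, (∀ k, iteratedFDeriv ℝ k u z = 0) → ∀ᶠ y in 𝓝 z, u y = 0 := fun z hz hk =>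
    eventually_eq_zero_of_iteratedFDeriv_eq_zero (j := j)
      (by filter_upwards [hs.mem_nhds hz] with y hy using hu.contDiffAt (hs.mem_nhds hy))
      (by filter_upwards [hs.mem_nhds hz] with y hy using hj.contDiffAt (hs.mem_nhds hy))
      hJ hJsq (hjsq z hz) (by filter_upwards [hs.mem_nhds hz] with y hy using hCR y hy) hk
  have hsub : s ⊆ {z | ∀ᶠ y in 𝓝 z, u y = 0} := by
    refine hs'.subset_of_closure_inter_subset isOpen_setOfPred_eventually_nhds
      ⟨z₀, hz₀, key z₀ hz₀ hjet⟩ fun y hy => key y hy.2 fun k => ?_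
    have hc : ContinuousAt (iteratedFDeriv ℝ k u) y :=
      ((hu.contDiffAt (hs.mem_nhds hy.2)).iteratedFDeriv_right (m := 0) (i := k)
        (by exact_mod_cast le_top)).continuousAt
    have h1 : ∃ᶠ x in 𝓝 y, iteratedFDeriv ℝ k u x = 0 :=
      (mem_closure_iff_frequently.1 hy.1).mono fun x hx => by
        have h2 : u =ᶠ[𝓝 x] fun _ => 0 := hx
        rw [(h2.iteratedFDeriv ℝ k).eq_of_nhds]
        simp
    exact isClosed_singleton.mem_of_frequently_of_tendsto h1 hc.tendsto
  exact (hsub hz).self_of_nhds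

theorem exists_contDiff_reparametrization [CompleteSpace E] {u v : ℂ → E} {J : E → E →L[ℝ] E}
    {j₁ j₂ : ℂ → ℂ →L[ℝ] ℂ} (hu : ∀ᶠ z in 𝓝 0, ContDiffAt ℝ ∞ u z)
    (hv : ∀ᶠ z in 𝓝 0, ContDiffAt ℝ ∞ v z) (hj₁ : ∀ᶠ z in 𝓝 0, ContDiffAt ℝ ∞ j₁ z)
    (hJ : ContDiff ℝ ∞ J) (hJsq : ∀ x y, J x (J x y) = -y) (hj0 : ∀ w, j₁ 0 (j₁ 0 w) = -w)
    (huCR : ∀ᶠ z in 𝓝 0, ∀ w, fderiv ℝ u z (j₁ z w) = J (u z) (fderiv ℝ u z w))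
    (hvCR : ∀ᶠ z in 𝓝 0, ∀ w, fderiv ℝ v z (j₂ z w) = J (v z) (fderiv ℝ v z w))
    (hu0 : u 0 = 0) (hjet : ∀ k, iteratedFDeriv ℝ k u 0 = iteratedFDeriv ℝ k v 0)
    (hnf : ¬ ∀ k, iteratedFDeriv ℝ k u 0 = 0) :
    ∃ φ : ℂ → ℂ, ContDiff ℝ ∞ φ ∧ φ 0 = 0 ∧ HasFDerivAt φ (1 : ℂ →L[ℝ] ℂ) 0 ∧
      ∀ᶠ z in 𝓝 0, u z = v (φ z) := by
  obtain ⟨U, hU, hUu⟩ := exists_contDiff_eventuallyEq hu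
  obtain ⟨V, hV, hVv⟩ := exists_contDiff_eventuallyEq hv
  obtain ⟨i, hi, hij⟩ := exists_contDiff_eventuallyEq hj₁
  obtain ⟨L, hL⟩ := exists_equiv_conj_standard hj0
  have hflat : ∀ n, JetVanishes n fun z => V z - U z := fun n k _ => by
    have h1 := iteratedFDeriv_sub_apply (i := k) (x := 0)
      ((hV.of_le (mod_cast le_top)).contDiffAt (x := 0)) (hU.of_le (mod_cast le_top)).contDiffAt
    rw [(hVv.iteratedFDeriv ℝ k).eq_of_nhds, (hUu.iteratedFDeriv ℝ k).eq_of_nhds, hjet,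
      sub_self] at h1
    exact h1
  have hLt : Tendsto L.symm (𝓝 0) (𝓝 0) := by simpa using L.symm.continuous.tendsto 0
  have hLt' : Tendsto L (𝓝 0) (𝓝 0) := by simpa using L.continuous.tendsto 0
  have hd : ∀ {f : ℂ → E}, ContDiff ℝ ∞ f → ∀ z w,
      fderiv ℝ (fun z => f (L.symm z)) z w = fderiv ℝ f (L.symm z) (L.symm w) := fun hf z w => by
    have h1 := ((hf.differentiable (by norm_num) (L.symm z)).hasFDerivAt.comp z
      L.symm.hasFDerivAt).fderiv
    exact congrArg (fun T => T w) h1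
  have hULs : ContDiff ℝ ∞ fun z => U (L.symm z) := hU.comp L.symm.contDiff
  obtain ⟨ψ, hψ, hψ0, hψ', hψe⟩ := exists_local_reparametrization
    (u := fun z => U (L.symm z)) (v := fun z => V (L.symm z)) (J := J)
    (j₁ := fun z => (L : ℂ →L[ℝ] ℂ).comp ((i (L.symm z)).comp (L.symm : ℂ →L[ℝ] ℂ)))
    (j₂ := fun z => (L : ℂ →L[ℝ] ℂ).comp ((j₂ (L.symm z)).comp (L.symm : ℂ →L[ℝ] ℂ)))
    hULs (hV.comp L.symm.contDiff) hJ hJsq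
    (contDiff_const.clm_comp ((hi.comp L.symm.contDiff).clm_comp contDiff_const))
    (fun w => by simp [hij.eq_of_nhds, hL])
    (by
      filter_upwards [hLt.eventually huCR, hLt.eventually hUu, hLt.eventually hij,
        hLt.eventually (hUu.fderiv (𝕜 := ℝ))] with z h1 h2 h3 h4 w
      rw [hd hU, hd hU, h2, h3, h4, ← h1]
      simp)
    (by
      filter_upwards [hLt.eventually hvCR, hLt.eventually hVv,
        hLt.eventually (hVv.fderiv (𝕜 := ℝ))] with z h1 h2 h4 w
      rw [hd hV, hd hV, h2, h4, ← h1]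
      simp)
    (by simp [hUu.eq_of_nhds, hu0])
    (fun n => (hflat n).comp_continuousLinearMap (hV.sub hU) (L.symm : ℂ →L[ℝ] ℂ))
    (fun hcon => hnf fun k => by
      have h1 := (hcon (k + 1)).comp_continuousLinearMap hULs (L : ℂ →L[ℝ] ℂ)
      simp only [ContinuousLinearEquiv.coe_coe, ContinuousLinearEquiv.symm_apply_apply] at h1
      rw [← (hUu.iteratedFDeriv ℝ k).eq_of_nhds]
      exact h1 k (Nat.lt_succ_self k))
  set φ : ℂ → ℂ := fun z => L.symm (ψ (L z)) with hφ
  have hφs : ContDiff ℝ ∞ φ := L.symm.contDiff.comp (hψ.comp L.contDiff)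
  have hφ0 : φ 0 = 0 := by simp [hφ, hψ0]
  refine ⟨φ, hφs, hφ0, ?_, ?_⟩
  · have h1 : HasFDerivAt ψ (1 : ℂ →L[ℝ] ℂ) (L 0) := by rwa [map_zero]
    refine (L.symm.hasFDerivAt.comp (0 : ℂ) (h1.comp (0 : ℂ) L.hasFDerivAt)).congr_fderiv ?_
    apply ContinuousLinearMap.ext
    intro x
    simp
  · have hφt : Tendsto φ (𝓝 0) (𝓝 0) := by simpa [hφ0] using hφs.continuous.tendsto 0
    filter_upwards [hUu, hφt.eventually hVv, hLt'.eventually hψe] with z h1 h2 h3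
    rw [← h1, ← h2]
    simpa [hφ] using h3

end Main

theorem eventually_contDiffAt_of_contDiffOn {E : Type*} [NormedAddCommGroup E] [NormedSpace ℝ E]
    {f : ℂ → E} {s : Set ℂ} {z : ℂ} (hf : ContDiffOn ℝ ∞ f s) (hs : s ∈ 𝓝 z) :
    ∀ᶠ y in 𝓝 z, ContDiffAt ℝ ∞ f y :=
  (eventually_mem_nhds_iff.2 hs).mono fun _ hy => hf.contDiffAt hy

theorem exists_injOn_nhds {φ : ℂ → ℂ} (hφ : ContDiff ℝ ∞ φ)
    (hφ' : HasFDerivAt φ (1 : ℂ →L[ℝ] ℂ) 0) : ∃ t ∈ 𝓝 (0 : ℂ), InjOn φ t := by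
  have h1 : HasFDerivAt φ ((ContinuousLinearEquiv.refl ℝ ℂ : ℂ ≃L[ℝ] ℂ) : ℂ →L[ℝ] ℂ) 0 := hφ'
  have h2 := hφ.contDiffAt.hasStrictFDerivAt' h1 (by norm_num)
  exact ⟨_, (h2.toOpenPartialHomeomorph φ).open_source.mem_nhds
    h2.mem_toOpenPartialHomeomorph_source, (h2.toOpenPartialHomeomorph φ).injOn⟩

end AuxiliaryResults

open scoped Topology in
open Filter in
/-- **Unique continuation up to reparametrization.**  Let `j₁, j₂` be smooth complex
structures on the unit ball `B ⊂ ℂ` and `J` an almost complex structure on `ℂⁿ`.  If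
`u, v : B → ℂⁿ` are smooth nonconstant pseudoholomorphic curves (for `(j₁, J)` resp.
`(j₂, J)`) with `u(0) = v(0) = 0` and matching iterated derivatives at `0` to all
orders, then for all sufficiently small `ε > 0` there is a smooth embedding
`φ : B_ε → B` with `φ(0) = 0` and `u = v ∘ φ` on `B_ε`. -/
theorem unique_continuation_up_to_reparametrization (n : ℕ)
    (j₁ j₂ : ℂ → (ℂ →L[ℝ] ℂ))
    (hj₁smooth : ContDiffOn ℝ (⊤ : ℕ∞) j₁ (ball 0 1))
    (hj₂smooth : ContDiffOn ℝ (⊤ : ℕ∞) j₂ (ball 0 1))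
    (hj₁sq : ∀ z ∈ ball (0 : ℂ) 1, ∀ w : ℂ, j₁ z (j₁ z w) = -w)
    (hj₂sq : ∀ z ∈ ball (0 : ℂ) 1, ∀ w : ℂ, j₂ z (j₂ z w) = -w)
    (J : EuclideanSpace ℂ (Fin n) →
      (EuclideanSpace ℂ (Fin n) →L[ℝ] EuclideanSpace ℂ (Fin n)))
    (hJsmooth : ContDiff ℝ (⊤ : ℕ∞) J)
    (hJsq : ∀ x w, J x (J x w) = -w)
    (u v : ℂ → EuclideanSpace ℂ (Fin n))
    (husmooth : ContDiffOn ℝ (⊤ : ℕ∞) u (ball 0 1))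
    (hvsmooth : ContDiffOn ℝ (⊤ : ℕ∞) v (ball 0 1))
    (hunonconst : ∃ z ∈ ball (0 : ℂ) 1, ∃ w ∈ ball (0 : ℂ) 1, u z ≠ u w)
    (hvnonconst : ∃ z ∈ ball (0 : ℂ) 1, ∃ w ∈ ball (0 : ℂ) 1, v z ≠ v w)
    (huCR : ∀ z ∈ ball (0 : ℂ) 1,
      (fderiv ℝ u z).comp (j₁ z) = (J (u z)).comp (fderiv ℝ u z))
    (hvCR : ∀ z ∈ ball (0 : ℂ) 1,
      (fderiv ℝ v z).comp (j₂ z) = (J (v z)).comp (fderiv ℝ v z))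
    (hu0 : u 0 = 0) (hv0 : v 0 = 0)
    (hjet : ∀ k : ℕ, iteratedFDeriv ℝ k u 0 = iteratedFDeriv ℝ k v 0) :
    ∃ ε₀ : ℝ, 0 < ε₀ ∧ ∀ ε : ℝ, 0 < ε → ε ≤ ε₀ →
      ∃ φ : ℂ → ℂ,
        ContDiffOn ℝ (⊤ : ℕ∞) φ (ball 0 ε) ∧
        Set.InjOn φ (ball 0 ε) ∧
        Set.MapsTo φ (ball 0 ε) (ball 0 1) ∧
        (∀ z ∈ ball (0 : ℂ) ε, Function.Injective (fderiv ℝ φ z)) ∧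
        φ 0 = 0 ∧
        ∀ z ∈ ball (0 : ℂ) ε, u z = v (φ z) := by
  have hball : ball (0 : ℂ) 1 ∈ 𝓝 (0 : ℂ) := ball_mem_nhds 0 one_pos
  have h0 : (0 : ℂ) ∈ ball (0 : ℂ) 1 := mem_ball_self one_pos
  have huCR' : ∀ z ∈ ball (0 : ℂ) 1, ∀ w, fderiv ℝ u z (j₁ z w) = J (u z) (fderiv ℝ u z w) :=
    fun z hz w => congrArg (fun T => T w) (huCR z hz)
  have hvCR' : ∀ z ∈ ball (0 : ℂ) 1, ∀ w, fderiv ℝ v z (j₂ z w) = J (v z) (fderiv ℝ v z w) :=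
    fun z hz w => congrArg (fun T => T w) (hvCR z hz)
  obtain ⟨φ, hφ, hφ0, hφ', huφ⟩ := exists_contDiff_reparametrization (j₁ := j₁) (j₂ := j₂) (u := u)
    (v := v) (J := J) (eventually_contDiffAt_of_contDiffOn husmooth hball)
    (eventually_contDiffAt_of_contDiffOn hvsmooth hball)
    (eventually_contDiffAt_of_contDiffOn hj₁smooth hball) hJsmooth hJsq (hj₁sq 0 h0)
    (by filter_upwards [hball] with z hz using huCR' z hz)
    (by filter_upwards [hball] with z hz using hvCR' z hz) hu0 hjet
    (fun hk => by
      obtain ⟨z, hz, w, hw, hne⟩ := hunonconst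
      have hzero : ∀ y ∈ ball (0 : ℂ) 1, u y = 0 := fun y hy =>
        eq_zero_of_iteratedFDeriv_eq_zero isOpen_ball (convex_ball 0 1).isPreconnected h0 husmooth
          hj₁smooth hJsmooth hJsq hj₁sq huCR' hk hy
      exact hne ((hzero z hz).trans (hzero w hw).symm))
  have hφt : Tendsto φ (𝓝 0) (𝓝 0) := by
    have h := hφ.continuous.tendsto 0
    rwa [hφ0] at h
  obtain ⟨t, ht, hinj⟩ := exists_injOn_nhds hφ hφ'
  obtain ⟨ε₀, hε₀, hε⟩ := Metric.eventually_nhds_iff_ball.1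
    (((eventually_mem_set.2 ht).and (hφt.eventually hball)).and
      ((eventually_surjective_fderiv hφ hφ').and huφ))
  refine ⟨ε₀, hε₀, fun ε _ hle => ?_⟩
  have hsub : ball (0 : ℂ) ε ⊆ ball 0 ε₀ := ball_subset_ball hle
  exact ⟨φ, hφ.contDiffOn, hinj.mono fun z hz => (hε z (hsub hz)).1.1,
    fun z hz => (hε z (hsub hz)).1.2, fun z hz => (hε z (hsub hz)).2.1.1, hφ0,
    fun z hz => (hε z (hsub hz)).2.2⟩
end

section
/- Weyl's lemma for the Cauchy–Riemann operator: Let u : B → ℂ be Lebesgue-integrable on the open unit ball B ⊂ ℂ and suppose u is a weak solution of ∂̄u = 0, meaning that ∫_B u(z)·(∂ₛφ(z) + i·∂ₜφ(z)) dλ(z) = 0 for every smooth function φ : ℂ → ℂ with compact support contained in B. Then u agrees almost everywhere on B with a function that is holomorphic on B. -/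
open Metric Complex MeasureTheory

open scoped Convolution ContDiff Topology

/-- The integral of a continuous function against a compactly supported radial weight, written
through its averages over the circles centred at the origin. -/
lemma integral_radial_smul_eq_integral_circleAverage {k : ℂ → ℝ} (hk : Continuous k)
    (hcomp : HasCompactSupport k) (hrad : ∀ w, k w = k (‖w‖ : ℂ)) {G : ℂ → ℂ}
    (hG : Continuous G) :
    ∫ w, k w • G w =
      ∫ r in Set.Ioi (0 : ℝ), (r * k (r : ℂ)) • (2 * Real.pi) • Real.circleAverage G 0 r := by
  rw [← Complex.integral_comp_polarCoord_symm, polarCoord_target]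
  have hcont : Continuous fun p : ℝ × ℝ ↦
      p.1 • k (Complex.polarCoord.symm p) • G (Complex.polarCoord.symm p) := by
    have : Continuous fun p : ℝ × ℝ ↦ Complex.polarCoord.symm p := by
      simp only [Complex.polarCoord_symm_apply]; fun_prop
    fun_prop
  obtain ⟨M, hM⟩ := hcomp.isCompact.isBounded.subset_closedBall (0 : ℂ)
  have hint : IntegrableOn (fun p : ℝ × ℝ ↦
      p.1 • k (Complex.polarCoord.symm p) • G (Complex.polarCoord.symm p))
      (Set.Ioi (0 : ℝ) ×ˢ Set.Ioo (-Real.pi) Real.pi) := by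
    have hK : IntegrableOn (fun p : ℝ × ℝ ↦
        p.1 • k (Complex.polarCoord.symm p) • G (Complex.polarCoord.symm p))
        (Set.Icc (0 : ℝ) M ×ˢ Set.Icc (-Real.pi) Real.pi) :=
      hcont.continuousOn.integrableOn_compact (isCompact_Icc.prod isCompact_Icc)
    refine hK.of_forall_sdiff_eq_zero (measurableSet_Ioi.prod measurableSet_Ioo) ?_
    rintro ⟨r, θ⟩ ⟨⟨hr, hθ⟩, hn⟩
    have hr' : M < r := by
      by_contra! h
      exact hn ⟨⟨(Set.mem_Ioi.1 hr).le, h⟩, Set.Ioo_subset_Icc_self hθ⟩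
    have : k (Complex.polarCoord.symm (r, θ)) = 0 := by
      refine image_eq_zero_of_notMem_tsupport fun h ↦ ?_
      have := hM h
      rw [mem_closedBall_zero_iff, Complex.norm_polarCoord_symm] at this
      exact absurd ((le_abs_self _).trans this) (not_le.2 hr')
    simp only [this, zero_smul, smul_zero]
  rw [Measure.volume_eq_prod] at hint ⊢
  rw [setIntegral_prod _ hint]
  refine setIntegral_congr_fun measurableSet_Ioi fun r hr ↦ ?_
  have hr0 : (0 : ℝ) < r := hr
  have hsymm : ∀ θ : ℝ, Complex.polarCoord.symm (r, θ) = circleMap 0 r θ := fun θ ↦ by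
    simp [circleMap, Complex.exp_mul_I]
  have hkr : ∀ θ : ℝ, k (circleMap 0 r θ) = k r := fun θ ↦ by
    rw [hrad]; simp [abs_of_pos hr0]
  simp only [hsymm, hkr]
  rw [Real.circleAverage_eq_integral_add (-Real.pi), smul_inv_smul₀ (by positivity)]
  rw [← integral_Ioc_eq_integral_Ioo, ← intervalIntegral.integral_of_le (by linarith [Real.pi_pos])]
  simp only [← mul_smul, intervalIntegral.integral_smul]
  congr 1
  rw [intervalIntegral.integral_comp_add_right (fun θ ↦ G (circleMap 0 r θ))]
  congr 1 <;> ring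

/-- The mean value property for a radial weight. -/
lemma integral_radial_smul {k : ℂ → ℝ} (hk : Continuous k) {δ : ℝ}
    (hsupp : tsupport k ⊆ closedBall 0 δ) (hrad : ∀ w, k w = k (‖w‖ : ℂ)) {G : ℂ → ℂ}
    (hG : Continuous G) (hd : ∀ w ∈ ball (0 : ℂ) δ, DifferentiableAt ℂ G w) :
    ∫ w, k w • G w = (∫ w, k w) • G 0 := by
  have hcomp : HasCompactSupport k :=
    (isCompact_closedBall (0 : ℂ) δ).of_isClosed_subset (isClosed_tsupport k) hsupp
  rw [← integral_smul_const, integral_radial_smul_eq_integral_circleAverage hk hcomp hrad hG,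
    integral_radial_smul_eq_integral_circleAverage hk hcomp hrad (continuous_const (y := G 0))]
  refine setIntegral_congr_fun measurableSet_Ioi fun r hr ↦ ?_
  have hr0 : (0 : ℝ) < r := hr
  by_cases hrδ : r ≤ δ
  · have h : Real.circleAverage G 0 r = G 0 :=
      circleAverage_of_differentiable_on_off_countable Set.countable_empty hG.continuousOn
        fun w hw ↦ hd w (ball_subset_ball (by rwa [abs_of_pos hr0]) hw.1)
    simp only [h, Real.circleAverage_const]
  · have : k r = 0 := image_eq_zero_of_notMem_tsupport fun h ↦ hrδ <| by
      simpa [abs_of_pos hr0] using hsupp h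
    simp [this]

/-- A normalized smooth radial kernel supported in a given closed disc. -/
lemma exists_radial_mollifier {δ : ℝ} (hδ : 0 < δ) :
    ∃ k : ℂ → ℝ, ContDiff ℝ ∞ k ∧ tsupport k ⊆ closedBall 0 δ ∧ (∀ w, k w = k (‖w‖ : ℂ)) ∧
      ∫ w, k w = 1 := by
  let b : ContDiffBump (0 : ℝ) := ⟨δ ^ 2 / 2, δ ^ 2, by positivity, half_lt_self (by positivity)⟩
  let h : ℂ → ℝ := fun w ↦ b (‖w‖ ^ 2)
  have hh : ContDiff ℝ ∞ h := b.contDiff.comp (contDiff_norm_sq ℝ)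
  have hsupp : tsupport h ⊆ closedBall 0 δ := by
    refine closure_minimal (fun w hw ↦ ?_) isClosed_closedBall
    have : ‖w‖ ^ 2 ∈ ball (0 : ℝ) (δ ^ 2) := by
      rw [← b.support_eq]; exact hw
    rw [mem_ball_zero_iff, Real.norm_of_nonneg (by positivity)] at this
    rw [mem_closedBall_zero_iff]
    exact (abs_le_of_sq_le_sq' this.le hδ.le).2
  have hcomp : HasCompactSupport h :=
    (isCompact_closedBall (0 : ℂ) δ).of_isClosed_subset (isClosed_tsupport h) hsupp
  have hpos : 0 < ∫ w, h w := by
    refine hh.continuous.integral_pos_of_hasCompactSupport_nonneg_nonzero (x := 0) hcomp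
      (fun w ↦ b.nonneg) ?_
    have : b 0 = 1 := b.one_of_mem_closedBall (mem_closedBall_self b.rIn_pos.le)
    simp [h, this]
  refine ⟨fun w ↦ (∫ w, h w)⁻¹ * h w, contDiff_const.mul hh, ?_, fun w ↦ by simp [h], ?_⟩
  · exact (tsupport_mul_subset_right).trans hsupp
  · rw [integral_const_mul, inv_mul_cancel₀ hpos.ne']

/-- The defining property of a weak solution of `∂̄u = 0` on the unit disc. -/
def IsWeaklyHolomorphic (u : ℂ → ℂ) : Prop :=
  ∀ φ : ℂ → ℂ, ContDiff ℝ (⊤ : ℕ∞) φ → HasCompactSupport φ → tsupport φ ⊆ ball 0 1 →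
    ∫ z in ball (0 : ℂ) 1, u z * (fderiv ℝ φ z 1 + Complex.I * fderiv ℝ φ z Complex.I) = 0

/-- Mollifying a weak solution of `∂̄u = 0` yields a function which is holomorphic away from the
boundary. -/
lemma IsWeaklyHolomorphic.differentiableAt_convolution {u : ℂ → ℂ} (hweak : IsWeaklyHolomorphic u)
    (hu : IntegrableOn u (ball 0 1)) {k : ℂ → ℝ} (hk : ContDiff ℝ ∞ k) {ε : ℝ}
    (hsupp : tsupport k ⊆ closedBall 0 ε) {z : ℂ} (hz : ‖z‖ + ε < 1) :
    DifferentiableAt ℂ (k ⋆[ContinuousLinearMap.lsmul ℝ ℝ] (ball 0 1).indicator u) z := by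
  set L := ContinuousLinearMap.lsmul ℝ ℝ (E := ℂ)
  set U := (ball (0 : ℂ) 1).indicator u
  have hU : Integrable U := hu.integrable_indicator measurableSet_ball
  have hcomp : HasCompactSupport k :=
    (isCompact_closedBall (0 : ℂ) ε).of_isClosed_subset (isClosed_tsupport k) hsupp
  have hd := hcomp.hasFDerivAt_convolution_left L (hk.of_le (by simp)) hU.locallyIntegrable z
    (μ := volume)
  have hk1 : Continuous (fderiv ℝ k) := hk.continuous_fderiv (by simp)
  have hex : ConvolutionExistsAt (fderiv ℝ k) U z (L.precompL ℂ) volume :=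
    (hcomp.fderiv ℝ).convolutionExists_left _ hk1 hU.locallyIntegrable z
  have hval : ∀ v, (fderiv ℝ k ⋆[L.precompL ℂ] U) z v = ∫ t, (fderiv ℝ k (z - t) v) • U t := by
    intro v
    rw [convolution_eq_swap, ContinuousLinearMap.integral_apply hex.integrable_swap]
    rfl
  have hint : ∀ v, Integrable fun t ↦ (fderiv ℝ k (z - t) v) • U t := fun v ↦
    hex.integrable_swap.apply_continuousLinearMap v
  let φ : ℂ → ℂ := fun t ↦ (k (z - t) : ℂ)
  have hφ : ContDiff ℝ ∞ φ := ofRealCLM.contDiff.comp (hk.comp (contDiff_const.sub contDiff_id))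
  have hφsupp : tsupport φ ⊆ closedBall z ε := by
    refine closure_minimal (fun t ht ↦ ?_) isClosed_closedBall
    have : z - t ∈ tsupport k := subset_tsupport k fun h ↦ ht (by simp [φ, h])
    simpa [dist_eq_norm, norm_sub_rev] using hsupp this
  have hφder : ∀ t v, fderiv ℝ φ t v = -(fderiv ℝ k (z - t) v : ℂ) := fun t v ↦ by
    have h1 : HasFDerivAt (fun t ↦ k (z - t)) ((fderiv ℝ k (z - t)).comp
        (-ContinuousLinearMap.id ℝ ℂ)) t :=
      ((hk.differentiable (by simp)) (z - t)).hasFDerivAt.comp t ((hasFDerivAt_id t).const_sub z)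
    have h2 : HasFDerivAt φ _ t := ofRealCLM.hasFDerivAt.comp t h1
    rw [h2.fderiv]
    simp
  have hzero := hweak φ hφ
    ((isCompact_closedBall z ε).of_isClosed_subset (isClosed_tsupport φ) hφsupp)
    (hφsupp.trans (closedBall_subset_ball' (by simpa [add_comm] using hz)))
  have hsum : (fderiv ℝ k ⋆[L.precompL ℂ] U) z 1 +
      Complex.I * (fderiv ℝ k ⋆[L.precompL ℂ] U) z Complex.I = 0 := by
    rw [hval, hval, ← integral_const_mul, ← integral_add (hint 1) ((hint _).const_mul _),
      ← neg_eq_zero, ← integral_neg, ← hzero, ← integral_indicator measurableSet_ball]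
    congr 1
    ext t
    by_cases ht : t ∈ ball (0 : ℂ) 1
    · simp only [U, Set.indicator_of_mem ht, hφder, real_smul]
      ring
    · simp [U, Set.indicator_of_notMem ht]
  rw [differentiableAt_complex_iff_differentiableAt_real]
  refine ⟨hd.differentiableAt, ?_⟩
  rw [hd.fderiv, smul_eq_mul]
  linear_combination -Complex.I * hsum +
    (fderiv ℝ k ⋆[L.precompL ℂ] U) z Complex.I * Complex.I_mul_I

/-- Convolutions with two continuous compactly supported kernels commute. -/
lemma convolution_lsmul_left_comm {k l : ℂ → ℝ} (hk : Continuous k) (hkc : HasCompactSupport k)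
    (hl : Continuous l) (hlc : HasCompactSupport l) {U : ℂ → ℂ} (hU : LocallyIntegrable U) :
    k ⋆[ContinuousLinearMap.lsmul ℝ ℝ] (l ⋆[ContinuousLinearMap.lsmul ℝ ℝ] U) =
      l ⋆[ContinuousLinearMap.lsmul ℝ ℝ] (k ⋆[ContinuousLinearMap.lsmul ℝ ℝ] U) := by
  have hUnorm : LocallyIntegrable fun z ↦ ‖U z‖ := fun z ↦
    let ⟨s, hs, h⟩ := hU z; ⟨s, hs, h.norm⟩
  have assoc : ∀ {k l : ℂ → ℝ}, Continuous k → HasCompactSupport k → Continuous l →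
      HasCompactSupport l → (k ⋆[ContinuousLinearMap.mul ℝ ℝ] l)
        ⋆[ContinuousLinearMap.lsmul ℝ ℝ] U =
      k ⋆[ContinuousLinearMap.lsmul ℝ ℝ] (l ⋆[ContinuousLinearMap.lsmul ℝ ℝ] U) := by
    intro k l hk hkc hl hlc
    ext z
    refine convolution_assoc _ _ _ _ (fun x y w ↦ by simp [mul_assoc]) hk.aestronglyMeasurable
      hl.aestronglyMeasurable hU.aestronglyMeasurable
      (.of_forall fun x ↦ hkc.convolutionExists_left _ hk hl.locallyIntegrable x)
      (.of_forall fun x ↦ hlc.norm.convolutionExists_left _ hl.norm hUnorm x) ?_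
    exact hkc.norm.convolutionExists_left _ hk.norm
      (hlc.norm.continuous_convolution_left _ hl.norm hUnorm).locallyIntegrable z
  rw [← assoc hk hkc hl hlc, ← assoc hl hlc hk hkc, ← convolution_flip (f := k) (g := l)]
  have hflip : (ContinuousLinearMap.mul ℝ ℝ).flip = ContinuousLinearMap.mul ℝ ℝ := by
    ext; simp
  rw [hflip]

/-- **Weyl's lemma for the Cauchy–Riemann operator.**  If `u : B → ℂ` is Lebesgue
integrable on the open unit ball `B ⊂ ℂ` and is a weak solution of `∂̄u = 0`, i.e.
`∫_B u·(∂ₛφ + i·∂ₜφ) = 0` for every smooth `φ : ℂ → ℂ` with compact support contained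
in `B`, then `u` agrees almost everywhere on `B` with a holomorphic function. -/
theorem weyl_lemma_cauchy_riemann (u : ℂ → ℂ)
    (hu : IntegrableOn u (ball 0 1) volume)
    (hweak : ∀ φ : ℂ → ℂ, ContDiff ℝ (⊤ : ℕ∞) φ → HasCompactSupport φ →
      tsupport φ ⊆ ball 0 1 →
      ∫ z in ball (0 : ℂ) 1,
        u z * (fderiv ℝ φ z 1 + Complex.I * fderiv ℝ φ z Complex.I) = 0) :
    ∃ f : ℂ → ℂ, DifferentiableOn ℂ f (ball 0 1) ∧
      ∀ᵐ z ∂(volume.restrict (ball (0 : ℂ) 1)), u z = f z := by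
  replace hweak : IsWeaklyHolomorphic u := hweak
  set U := (ball (0 : ℂ) 1).indicator u with hUdef
  have hU : LocallyIntegrable U := (hu.integrable_indicator measurableSet_ball).locallyIntegrable
  let ψ : ℕ → ContDiffBump (0 : ℂ) := fun n ↦
    ⟨1 / (n + 1 : ℝ) / 2, 1 / (n + 1 : ℝ), by positivity, half_lt_self (by positivity)⟩
  have hψ : Filter.Tendsto (fun n ↦ (ψ n).rOut) Filter.atTop (𝓝 0) :=
    tendsto_one_div_add_atTop_nhds_zero_nat
  let v : ℕ → ℂ → ℂ := fun n ↦ (ψ n).normed volume ⋆[ContinuousLinearMap.lsmul ℝ ℝ] U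
  have hv : ∀ᵐ z, Filter.Tendsto (fun n ↦ v n z) Filter.atTop (𝓝 (U z)) :=
    ContDiffBump.ae_convolution_tendsto_right_of_locallyIntegrable (K := 2) hψ
      (.of_forall fun n ↦ by simp only [ψ]; linarith) hU
  have hvc : ∀ n, Continuous (v n) := fun n ↦
    (ψ n).hasCompactSupport_normed.continuous_convolution_left _ (ψ n).continuous_normed hU
  have key : ∀ δ > 0, ∃ F : ℂ → ℂ, ∀ z, ‖z‖ + δ < 1 →
      DifferentiableAt ℂ F z ∧ Filter.Tendsto (fun n ↦ v n z) Filter.atTop (𝓝 (F z)) := by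
    intro δ hδ
    obtain ⟨k, hk, hsupp, hrad, hone⟩ := exists_radial_mollifier hδ
    have hkc : HasCompactSupport k :=
      (isCompact_closedBall (0 : ℂ) δ).of_isClosed_subset (isClosed_tsupport k) hsupp
    refine ⟨k ⋆[ContinuousLinearMap.lsmul ℝ ℝ] U, fun z hz ↦
      ⟨hweak.differentiableAt_convolution hu hk hsupp hz, ?_⟩⟩
    refine (ContDiffBump.convolution_tendsto_right_of_continuous (μ := volume) hψ
      (hkc.continuous_convolution_left _ hk.continuous hU) z).congr' ?_
    filter_upwards [hψ.eventually_lt_const (sub_pos.2 hz)] with n hn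
    rw [← convolution_lsmul_left_comm hk.continuous hkc (ψ n).continuous_normed
      (ψ n).hasCompactSupport_normed hU]
    change ∫ w, k w • v n (z - w) = v n z
    rw [integral_radial_smul hk.continuous hsupp hrad (G := fun w ↦ v n (z - w))
      ((hvc n).comp (continuous_const.sub continuous_id)), hone, one_smul, sub_zero]
    intro w hw
    have : DifferentiableAt ℂ (v n) (z - w) :=
      hweak.differentiableAt_convolution hu (ψ n).contDiff_normed
        (ψ n).tsupport_normed_eq.subset (by
          linarith [norm_sub_le z w, mem_ball_zero_iff.1 hw])
    exact this.comp w ((differentiableAt_const z).sub differentiableAt_id)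
  refine ⟨fun z ↦ Filter.limUnder Filter.atTop fun n ↦ v n z, fun z hz ↦ ?_, ?_⟩
  · obtain ⟨F, hF⟩ := key ((1 - ‖z‖) / 2) (by linarith [mem_ball_zero_iff.1 hz])
    have hz' : ‖z‖ + (1 - ‖z‖) / 2 < 1 := by linarith [mem_ball_zero_iff.1 hz]
    refine ((hF z hz').1.congr_of_eventuallyEq ?_).differentiableWithinAt
    filter_upwards [(continuous_norm.add continuous_const).continuousAt.eventually_lt_const hz']
      with w hw using (hF w hw).2.limUnder_eq
  · rw [ae_restrict_iff' measurableSet_ball]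
    filter_upwards [hv] with z hz hzB
    rw [hz.limUnder_eq, hUdef, Set.indicator_of_mem hzB]
end
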